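/- Lower bound on E10 root multiplicities up to height 340: for every nonzero n ∈ ℕ^{10} with ∑_i n_i ≤ 340 and nᵀ A(E10) n ≤ 2, the multiplicity of n in g(A(E10)) satisfies mult(n) ≥ p₈(1 − (nᵀ A(E10) n)/2); moreover there exists such an n for which the inequality is strict. -/

import Mathlib

noncomputable section

open CartanMatrix

/-- A generalized Cartan matrix: `A i i = 2`, off-diagonal entries are non-positive, and
`A i j = 0 ↔ A j i = 0`. -/
def IsGCM {B : Type*} (A : Matrix B B ℤ) : Prop :=
  (∀ i, A i i = 2) ∧ (∀ i j, i ≠ j → A i j ≤ 0) ∧ (∀ i j, A i j = 0 ↔ A j i = 0)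

/-- The images in the Kac–Moody algebra `Matrix.ToLieAlgebra ℚ A` of the generators of the
free Lie algebra. -/
def KMgen {B : Type*} [DecidableEq B] (A : Matrix B B ℤ) (x : Generators B) :
    Matrix.ToLieAlgebra ℚ A :=
  LieSubmodule.Quotient.mk (N := Relations.toIdeal ℚ A) (FreeLieAlgebra.of ℚ x)

/-- The Cartan generator `h i`. -/
def gH {B : Type*} [DecidableEq B] (A : Matrix B B ℤ) (i : B) : Matrix.ToLieAlgebra ℚ A :=
  KMgen A (Generators.H i)

/-- The raising generator `e i`. -/
def gE {B : Type*} [DecidableEq B] (A : Matrix B B ℤ) (i : B) : Matrix.ToLieAlgebra ℚ A :=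
  KMgen A (Generators.E i)

/-- The lowering generator `f i`. -/
def gF {B : Type*} [DecidableEq B] (A : Matrix B B ℤ) (i : B) : Matrix.ToLieAlgebra ℚ A :=
  KMgen A (Generators.F i)

/-- The root space of `g(A)` attached to `n : B → ℤ`: the simultaneous eigenspace of the
adjoint action of the Cartan generators `h i`, with eigenvalues `∑ j, A i j * n j`. -/
def rootSpace {B : Type*} [Fintype B] [DecidableEq B] (A : Matrix B B ℤ) (n : B → ℤ) :
    Submodule ℚ (Matrix.ToLieAlgebra ℚ A) :=
  ⨅ i, Module.End.eigenspace
    (LieAlgebra.ad ℚ (Matrix.ToLieAlgebra ℚ A) (gH A i)) ((∑ j, A i j * n j : ℤ) : ℚ)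

/-- The multiplicity of `n` in `g(A)`: the dimension of the root space. -/
def rootMult {B : Type*} [Fintype B] [DecidableEq B] (A : Matrix B B ℤ) (n : B → ℤ) : ℕ :=
  Module.finrank ℚ (rootSpace A n)

/-- The Cartan matrix of `E10` (node 1 ↦ index `0` is the overextended node; indices `0`–`8`
form a chain and index `9` is attached to index `6`). -/
def E10M : Matrix (Fin 10) (Fin 10) ℤ := fun i j =>
  if i = j then 2
  else if (i.val + 1 = j.val ∧ j.val ≤ 8) ∨ (j.val + 1 = i.val ∧ i.val ≤ 8) ∨
          (i.val = 6 ∧ j.val = 9) ∨ (i.val = 9 ∧ j.val = 6) then -1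
  else 0

/-- The number of partitions of `k` into parts of `c` colours: the number of finitely
supported functions `f : ℕ+ × Fin c → ℕ` with `∑ j·f(j,s) = k` (so that
`∑ k, p_c(k) qᵏ = ∏_{j ≥ 1} (1 - qʲ)⁻ᶜ`), with `p_c(k) = 0` for `k < 0`. -/
def coloredPartitions (c : ℕ) (k : ℤ) : ℕ :=
  if k < 0 then 0
  else Nat.card {f : ℕ+ × Fin c →₀ ℕ // ∑ p ∈ f.support, (p.1 : ℕ) * f p = k.toNat}

/-- The norm `nᵀ A n` of a vector of natural numbers with respect to a Cartan matrix. -/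
def qform {d : ℕ} (A : Matrix (Fin d) (Fin d) ℤ) (n : Fin d → ℕ) : ℤ :=
  ∑ i, ∑ j, (n i : ℤ) * A i j * (n j : ℤ)

set_option linter.all false

/-! ## Basic relations and universal property -/

namespace E10

/-- The Kac–Moody algebra of type E10. -/
abbrev G := Matrix.ToLieAlgebra ℚ E10M

/-- The index lattice. -/
abbrev Q10 := Fin 10 → ℤ

abbrev h (i : Fin 10) : G := gH E10M i
abbrev e (i : Fin 10) : G := gE E10M i
abbrev f (i : Fin 10) : G := gF E10M i

lemma A_symm (i j : Fin 10) : E10M i j = E10M j i := by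
  fin_cases i <;> fin_cases j <;> rfl
lemma A_diag (i : Fin 10) : E10M i i = 2 := by revert i; decide
lemma A_off (i j : Fin 10) (hij : i ≠ j) : E10M i j = 0 ∨ E10M i j = -1 := by
  fin_cases i <;> fin_cases j <;> first | exact absurd rfl hij | (left; rfl) | (right; rfl)

/-- The Chevalley–Serre relations in a Lie algebra. -/
structure Rel {L : Type*} [LieRing L] [LieAlgebra ℚ L] (H E F : Fin 10 → L) : Prop where
  hh : ∀ i j, ⁅H i, H j⁆ = 0
  ef : ∀ i, ⁅E i, F i⁆ = H i
  ef' : ∀ i j, i ≠ j → ⁅E i, F j⁆ = 0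
  he : ∀ i j, ⁅H i, E j⁆ = (E10M i j : ℚ) • E j
  hf : ∀ i j, ⁅H i, F j⁆ = -((E10M i j : ℚ) • F j)
  se0 : ∀ i j, E10M i j = 0 → ⁅E i, E j⁆ = 0
  se1 : ∀ i j, E10M i j = -1 → ⁅E i, ⁅E i, E j⁆⁆ = 0
  sf0 : ∀ i j, E10M i j = 0 → ⁅F i, F j⁆ = 0
  sf1 : ∀ i j, E10M i j = -1 → ⁅F i, ⁅F i, F j⁆⁆ = 0

/-- The quotient map from the free Lie algebra. -/
def mkG : FreeLieAlgebra ℚ (Generators (Fin 10)) →ₗ⁅ℚ⁆ G :=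
  { toFun := fun x => LieSubmodule.Quotient.mk (N := Relations.toIdeal ℚ E10M) x
    map_add' := fun _ _ => rfl
    map_smul' := fun _ _ => rfl
    map_lie' := fun {x y} => LieSubmodule.Quotient.mk_bracket (Relations.toIdeal ℚ E10M) x y }

lemma mkG_surj : Function.Surjective mkG := LieSubmodule.Quotient.surjective_mk' _

lemma mkG_eq_zero {x} (hx : x ∈ Relations.toSet ℚ E10M) : mkG x = 0 := by
  have : x ∈ Relations.toIdeal ℚ E10M := LieSubmodule.subset_lieSpan hx
  exact (LieSubmodule.Quotient.mk_eq_zero' ).2 this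

lemma mkG_H (i) : mkG (FreeLieAlgebra.of ℚ (Generators.H i)) = h i := rfl
lemma mkG_E (i) : mkG (FreeLieAlgebra.of ℚ (Generators.E i)) = e i := rfl
lemma mkG_F (i) : mkG (FreeLieAlgebra.of ℚ (Generators.F i)) = f i := rfl

lemma G_rel : Rel h e f where
  hh i j := by
    have := mkG_eq_zero (x := Relations.HH ℚ (i, j)) (by simp [Relations.toSet])
    simpa [Relations.HH, mkG_H] using this
  ef i := by
    have := mkG_eq_zero (x := Relations.EF ℚ (i, i)) (by simp [Relations.toSet])
    simpa [Relations.EF, mkG_H, mkG_E, mkG_F, sub_eq_zero] using this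
  ef' i j hij := by
    have := mkG_eq_zero (x := Relations.EF ℚ (i, j)) (by simp [Relations.toSet])
    simpa [Relations.EF, mkG_H, mkG_E, mkG_F, sub_eq_zero, hij] using this
  he i j := by
    have := mkG_eq_zero (x := Relations.HE ℚ E10M (i, j)) (by simp [Relations.toSet])
    simp only [Relations.HE, Function.uncurry, Function.comp, map_sub, LieHom.map_lie, mkG_H,
      mkG_E, sub_eq_zero, map_zsmul] at this
    rw [this, Int.cast_smul_eq_zsmul]
  hf i j := by
    have := mkG_eq_zero (x := Relations.HF ℚ E10M (i, j)) (by simp [Relations.toSet])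
    simp only [Relations.HF, Function.uncurry, Function.comp, map_add, LieHom.map_lie, mkG_H,
      mkG_F, map_zsmul] at this
    rw [eq_neg_of_add_eq_zero_left this, Int.cast_smul_eq_zsmul]
  se0 i j hij := by
    have := mkG_eq_zero (x := Relations.adE ℚ E10M (i, j)) (by simp [Relations.toSet])
    simpa [Relations.adE, hij, mkG_E] using this
  se1 i j hij := by
    have := mkG_eq_zero (x := Relations.adE ℚ E10M (i, j)) (by simp [Relations.toSet])
    simpa [Relations.adE, hij, mkG_E] using this
  sf0 i j hij := by
    have := mkG_eq_zero (x := Relations.adF ℚ E10M (i, j)) (by simp [Relations.toSet])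
    simpa [Relations.adF, hij, mkG_F] using this
  sf1 i j hij := by
    have := mkG_eq_zero (x := Relations.adF ℚ E10M (i, j)) (by simp [Relations.toSet])
    simpa [Relations.adF, hij, mkG_F] using this

/-- Universal property. -/
theorem exists_lift {L : Type*} [LieRing L] [LieAlgebra ℚ L] {H E F : Fin 10 → L}
    (r : Rel H E F) : ∃ φ : G →ₗ⁅ℚ⁆ L, (∀ i, φ (h i) = H i) ∧ (∀ i, φ (e i) = E i) ∧
      (∀ i, φ (f i) = F i) := by
  let g0 : Generators (Fin 10) → L := fun x => match x with
    | .H i => H i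
    | .E i => E i
    | .F i => F i
  let ψ := FreeLieAlgebra.lift ℚ g0
  have hH : ∀ i, ψ (FreeLieAlgebra.of ℚ (Generators.H i)) = H i := fun i =>
    FreeLieAlgebra.lift_of_apply (R := ℚ) g0 _
  have hE : ∀ i, ψ (FreeLieAlgebra.of ℚ (Generators.E i)) = E i := fun i =>
    FreeLieAlgebra.lift_of_apply (R := ℚ) g0 _
  have hF : ∀ i, ψ (FreeLieAlgebra.of ℚ (Generators.F i)) = F i := fun i =>
    FreeLieAlgebra.lift_of_apply (R := ℚ) g0 _
  have key : Relations.toIdeal ℚ E10M ≤ ψ.ker := by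
    unfold Relations.toIdeal
    rw [LieSubmodule.lieSpan_le]
    intro x hx
    simp only [SetLike.mem_coe, LieHom.mem_ker]
    simp only [Relations.toSet, Set.mem_union, Set.mem_range, Prod.exists] at hx
    rcases hx with (((((⟨i, j, rfl⟩ | ⟨i, j, rfl⟩) | ⟨i, j, rfl⟩) | ⟨i, j, rfl⟩) |
      ⟨i, j, rfl⟩) | ⟨i, j, rfl⟩)
    · simp [Relations.HH, hH, r.hh]
    · by_cases hij : i = j
      · subst hij; simp [Relations.EF, hH, hE, hF, r.ef]
      · simp [Relations.EF, hE, hF, r.ef' _ _ hij, hij]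
    · simp only [Relations.HE, Function.uncurry, Function.comp, map_sub, LieHom.map_lie,
        map_zsmul, hH, hE]
      rw [r.he, Int.cast_smul_eq_zsmul, sub_self]
    · simp only [Relations.HF, Function.uncurry, Function.comp, map_add, LieHom.map_lie,
        map_zsmul, hH, hF]
      rw [r.hf, Int.cast_smul_eq_zsmul, neg_add_cancel]
    · by_cases hij : i = j
      · subst hij; simp [Relations.adE, A_diag]
      · rcases A_off i j hij with h0 | h0
        · simp [Relations.adE, h0, hE, r.se0 _ _ h0]
        · simp [Relations.adE, h0, hE, r.se1 _ _ h0]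
    · by_cases hij : i = j
      · subst hij; simp [Relations.adF, A_diag]
      · rcases A_off i j hij with h0 | h0
        · simp [Relations.adF, h0, hF, r.sf0 _ _ h0]
        · simp [Relations.adF, h0, hF, r.sf1 _ _ h0]
  let lin : G →ₗ[ℚ] L := Submodule.liftQ (Relations.toIdeal ℚ E10M).toSubmodule ψ.toLinearMap key
  have hlin : ∀ x, lin (mkG x) = ψ x := fun x => Submodule.liftQ_apply _ _ _
  refine ⟨{ lin with map_lie' := ?_ }, fun i => ?_, fun i => ?_, fun i => ?_⟩
  · intro x y
    obtain ⟨x, rfl⟩ := mkG_surj x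
    obtain ⟨y, rfl⟩ := mkG_surj y
    change lin ⁅mkG x, mkG y⁆ = ⁅lin (mkG x), lin (mkG y)⁆
    rw [← LieHom.map_lie, hlin, hlin, hlin, LieHom.map_lie]
  · change lin (mkG _) = _
    rw [hlin]; exact hH i
  · change lin (mkG _) = _
    rw [hlin]; exact hE i
  · change lin (mkG _) = _
    rw [hlin]; exact hF i

/-- Two homomorphisms agreeing on generators agree. -/
theorem hom_ext {L : Type*} [LieRing L] [LieAlgebra ℚ L] {φ ψ : G →ₗ⁅ℚ⁆ L}
    (hH : ∀ i, φ (h i) = ψ (h i)) (hE : ∀ i, φ (e i) = ψ (e i)) (hF : ∀ i, φ (f i) = ψ (f i)) :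
    φ = ψ := by
  have : φ.comp mkG = ψ.comp mkG := by
    apply FreeLieAlgebra.hom_ext
    intro x
    cases x with
    | H i => exact hH i
    | E i => exact hE i
    | F i => exact hF i
  ext x
  obtain ⟨x, rfl⟩ := mkG_surj x
  exact LieHom.congr_fun this x

/-- A subalgebra containing the generators is everything. -/
theorem subalg_top (K : LieSubalgebra ℚ G) (hH : ∀ i, h i ∈ K) (hE : ∀ i, e i ∈ K)
    (hF : ∀ i, f i ∈ K) (x : G) : x ∈ K := by
  have r := G_rel
  have r' : Rel (fun i => (⟨h i, hH i⟩ : K)) (fun i => (⟨e i, hE i⟩ : K))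
      (fun i => (⟨f i, hF i⟩ : K)) := by
    constructor
    · intro i j; ext; exact r.hh i j
    · intro i; ext; exact r.ef i
    · intro i j hij; ext; exact r.ef' i j hij
    · intro i j; ext; exact r.he i j
    · intro i j; ext; exact r.hf i j
    · intro i j hij; ext; exact r.se0 i j hij
    · intro i j hij; ext; exact r.se1 i j hij
    · intro i j hij; ext; exact r.sf0 i j hij
    · intro i j hij; ext; exact r.sf1 i j hij
  obtain ⟨φ, h1, h2, h3⟩ := exists_lift r'
  have : K.incl.comp φ = LieHom.id := by
    apply hom_ext
    · intro i; simp [h1]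
    · intro i; simp [h2]
    · intro i; simp [h3]
  have := LieHom.congr_fun this x
  simp only [LieHom.comp_apply, LieSubalgebra.coe_incl, LieHom.coe_id, id] at this
  rw [← this]; exact (φ x).2

end E10

/-! ## Root spaces and spanning words -/

namespace E10

abbrev R (n : Q10) : Submodule ℚ G := rootSpace E10M n

/-- pairing of a simple root with a lattice vector -/
def pr (i : Fin 10) (n : Q10) : ℤ := ∑ j, E10M i j * n j

abbrev al (i : Fin 10) : Q10 := Pi.single i 1

lemma pr_add (i) (a b : Q10) : pr i (a + b) = pr i a + pr i b := by
  simp [pr, mul_add, Finset.sum_add_distrib]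
lemma pr_neg (i) (a : Q10) : pr i (-a) = - pr i a := by
  simp [pr]
lemma pr_sub (i) (a b : Q10) : pr i (a - b) = pr i a - pr i b := by
  rw [sub_eq_add_neg, pr_add, pr_neg]; ring
lemma pr_zero (i) : pr i 0 = 0 := by simp [pr]
lemma pr_al (i j) : pr i (al j) = E10M i j := by simp [pr, Pi.single_apply]

lemma mem_R {n : Q10} {x : G} : x ∈ R n ↔ ∀ i, ⁅h i, x⁆ = ((pr i n : ℤ) : ℚ) • x := by
  simp [R, rootSpace, Submodule.mem_iInf, pr]

lemma e_mem (i) : e i ∈ R (al i) := mem_R.2 fun j => by rw [pr_al]; exact G_rel.he j i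
lemma f_mem (i) : f i ∈ R (-al i) := mem_R.2 fun j => by
  rw [pr_neg, pr_al]; simpa using G_rel.hf j i
lemma h_mem (i) : h i ∈ R 0 := mem_R.2 fun j => by
  rw [pr_zero]; simpa using G_rel.hh j i

lemma lie_mem {a b : Q10} {x y : G} (hx : x ∈ R a) (hy : y ∈ R b) : ⁅x, y⁆ ∈ R (a + b) := by
  rw [mem_R] at *
  intro i
  rw [leibniz_lie, hx i, hy i, pr_add]
  simp [add_smul]

/-- words in the `e i` -/
def ew : List (Fin 10) → Fin 10 → G
  | [], j => e j
  | i :: l, j => ⁅e i, ew l j⁆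

def fw : List (Fin 10) → Fin 10 → G
  | [], j => f j
  | i :: l, j => ⁅f i, fw l j⁆

/-- weight of a word -/
def ww : List (Fin 10) → Fin 10 → Q10
  | [], j => al j
  | i :: l, j => al i + ww l j

lemma ew_mem (l j) : ew l j ∈ R (ww l j) := by
  induction l with
  | nil => exact e_mem j
  | cons i l ih => exact lie_mem (e_mem i) ih

lemma fw_mem (l j) : fw l j ∈ R (-ww l j) := by
  induction l with
  | nil => exact f_mem j
  | cons i l ih =>
    have := lie_mem (f_mem i) ih
    rwa [← neg_add] at this

/-- spanning index set -/
abbrev SI := (List (Fin 10) × Fin 10) ⊕ (Fin 10 ⊕ (List (Fin 10) × Fin 10))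

def sv : SI → G
  | .inl p => ew p.1 p.2
  | .inr (.inl i) => h i
  | .inr (.inr p) => fw p.1 p.2

def swt : SI → Q10
  | .inl p => ww p.1 p.2
  | .inr (.inl _) => 0
  | .inr (.inr p) => -ww p.1 p.2

lemma sv_mem (s) : sv s ∈ R (swt s) := by
  rcases s with p | i | p
  · exact ew_mem _ _
  · exact h_mem _
  · exact fw_mem _ _

/-- span of the words -/
def W : Submodule ℚ G := Submodule.span ℚ (Set.range sv)

lemma ew_W (l j) : ew l j ∈ W := Submodule.subset_span ⟨.inl (l, j), rfl⟩
lemma h_W (i) : h i ∈ W := Submodule.subset_span ⟨.inr (.inl i), rfl⟩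
lemma fw_W (l j) : fw l j ∈ W := Submodule.subset_span ⟨.inr (.inr (l, j)), rfl⟩

def Wp : Submodule ℚ G := Submodule.span ℚ (Set.range fun p : List (Fin 10) × Fin 10 => ew p.1 p.2)
def Wm : Submodule ℚ G := Submodule.span ℚ (Set.range fun p : List (Fin 10) × Fin 10 => fw p.1 p.2)
def Wh : Submodule ℚ G := Submodule.span ℚ (Set.range h)

lemma span_lie {S : Set G} {V : Submodule ℚ G} {x : G} (H : ∀ y ∈ S, ⁅x, y⁆ ∈ V) :
    ∀ y ∈ Submodule.span ℚ S, ⁅x, y⁆ ∈ V := by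
  intro y hy
  induction hy using Submodule.span_induction with
  | mem y hy => exact H y hy
  | zero => simp
  | add y z _ _ hy hz => rw [lie_add]; exact V.add_mem hy hz
  | smul c y _ hy => rw [lie_smul]; exact V.smul_mem c hy

lemma Wp_le : Wp ≤ W := Submodule.span_le.2 (by rintro _ ⟨p, rfl⟩; exact ew_W _ _)
lemma Wm_le : Wm ≤ W := Submodule.span_le.2 (by rintro _ ⟨p, rfl⟩; exact fw_W _ _)
lemma Wh_le : Wh ≤ W := Submodule.span_le.2 (by rintro _ ⟨p, rfl⟩; exact h_W _)

lemma h_ew (i l j) : ⁅h i, ew l j⁆ ∈ Wp := by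
  rw [mem_R.1 (ew_mem l j) i]
  exact Submodule.smul_mem _ _ (Submodule.subset_span ⟨(l, j), rfl⟩)

lemma h_fw (i l j) : ⁅h i, fw l j⁆ ∈ Wm := by
  rw [mem_R.1 (fw_mem l j) i]
  exact Submodule.smul_mem _ _ (Submodule.subset_span ⟨(l, j), rfl⟩)

lemma e_Wp (i) : ∀ y ∈ Wp, ⁅e i, y⁆ ∈ Wp := span_lie (by
  rintro _ ⟨⟨l, j⟩, rfl⟩
  exact Submodule.subset_span ⟨(i :: l, j), rfl⟩)

lemma f_Wm (i) : ∀ y ∈ Wm, ⁅f i, y⁆ ∈ Wm := span_lie (by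
  rintro _ ⟨⟨l, j⟩, rfl⟩
  exact Submodule.subset_span ⟨(i :: l, j), rfl⟩)

lemma e_Wh (i) : ∀ y ∈ Wh, ⁅e i, y⁆ ∈ Wp := span_lie (by
  rintro _ ⟨j, rfl⟩
  rw [← lie_skew]
  exact Submodule.neg_mem _ (h_ew j [] i))

lemma f_Wh (i) : ∀ y ∈ Wh, ⁅f i, y⁆ ∈ Wm := span_lie (by
  rintro _ ⟨j, rfl⟩
  rw [← lie_skew]
  exact Submodule.neg_mem _ (h_fw j [] i))

lemma f_ew (i l j) : ⁅f i, ew l j⁆ ∈ Wp ⊔ Wh := by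
  induction l with
  | nil =>
    apply Submodule.mem_sup_right
    by_cases hij : j = i
    · subst hij
      rw [ew, ← lie_skew, G_rel.ef]
      exact Submodule.neg_mem _ (Submodule.subset_span ⟨j, rfl⟩)
    · rw [ew, ← lie_skew, G_rel.ef' _ _ hij]; simp
  | cons k l ih =>
    rw [ew, leibniz_lie]
    apply Submodule.add_mem
    · apply Submodule.mem_sup_left
      by_cases hij : k = i
      · subst hij
        rw [← lie_skew (f k), G_rel.ef, neg_lie]
        exact Submodule.neg_mem _ (h_ew _ _ _)
      · rw [← lie_skew (f i), G_rel.ef' _ _ hij]; simp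
    · apply Submodule.mem_sup_left
      obtain ⟨y, hy, z, hz, hyz⟩ := Submodule.mem_sup.1 ih
      rw [← hyz, lie_add]
      exact Submodule.add_mem _ (e_Wp k y hy) (e_Wh k z hz)

lemma e_fw (i l j) : ⁅e i, fw l j⁆ ∈ Wm ⊔ Wh := by
  induction l with
  | nil =>
    apply Submodule.mem_sup_right
    by_cases hij : i = j
    · subst hij
      rw [fw, G_rel.ef]
      exact (Submodule.subset_span ⟨i, rfl⟩)
    · rw [fw, G_rel.ef' _ _ hij]; simp
  | cons k l ih =>
    rw [fw, leibniz_lie]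
    apply Submodule.add_mem
    · apply Submodule.mem_sup_left
      by_cases hij : i = k
      · subst hij
        rw [G_rel.ef]
        exact (h_fw _ _ _)
      · rw [G_rel.ef' _ _ hij]; simp
    · apply Submodule.mem_sup_left
      obtain ⟨y, hy, z, hz, hyz⟩ := Submodule.mem_sup.1 ih
      rw [← hyz, lie_add]
      exact Submodule.add_mem _ (f_Wm k y hy) (f_Wh k z hz)

lemma h_W' (i) : ∀ y ∈ W, ⁅h i, y⁆ ∈ W := span_lie (by
  rintro _ ⟨s, rfl⟩
  rw [mem_R.1 (sv_mem s) i]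
  exact Submodule.smul_mem _ _ (Submodule.subset_span ⟨s, rfl⟩))

lemma e_W' (i) : ∀ y ∈ W, ⁅e i, y⁆ ∈ W := span_lie (by
  rintro _ ⟨p | j | p, rfl⟩
  · exact Wp_le (e_Wp _ _ (Submodule.subset_span ⟨p, rfl⟩))
  · exact Wp_le (e_Wh _ _ (Submodule.subset_span ⟨j, rfl⟩))
  · exact (sup_le Wm_le Wh_le) (e_fw _ _ _))

lemma f_W' (i) : ∀ y ∈ W, ⁅f i, y⁆ ∈ W := span_lie (by
  rintro _ ⟨p | j | p, rfl⟩
  · exact (sup_le Wp_le Wh_le) (f_ew _ _ _)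
  · exact Wm_le (f_Wh _ _ (Submodule.subset_span ⟨j, rfl⟩))
  · exact Wm_le (f_Wm _ _ (Submodule.subset_span ⟨p, rfl⟩)))

/-- the stabilizer of `W` -/
def stabW : LieSubalgebra ℚ G where
  carrier := {x | ∀ y ∈ W, ⁅x, y⁆ ∈ W}
  add_mem' := by
    intro a b ha hb y hy
    rw [add_lie]; exact W.add_mem (ha y hy) (hb y hy)
  zero_mem' := by intro y _; simp
  smul_mem' := by
    intro c a ha y hy
    rw [smul_lie]; exact W.smul_mem c (ha y hy)
  lie_mem' := by
    intro a b ha hb y hy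
    rw [lie_lie]
    exact W.sub_mem (ha _ (hb _ hy)) (hb _ (ha _ hy))

def algW : LieSubalgebra ℚ G where
  toSubmodule := W
  lie_mem' := by
    intro a b _ hb
    exact subalg_top stabW h_W' e_W' f_W' a b hb

lemma W_top : W = ⊤ := by
  rw [eq_top_iff]
  intro x _
  exact subalg_top algW h_W (ew_W []) (fw_W []) x

/-! ### Independence -/

lemma sum10 {M : Type*} [AddCommMonoid M] (g : Fin 10 → M) : ∑ i, g i =
    g 0 + g 1 + g 2 + g 3 + g 4 + g 5 + g 6 + g 7 + g 8 + g 9 := by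
  rw [Fin.sum_univ_castSucc, Fin.sum_univ_castSucc, Fin.sum_univ_eight]
  rfl

lemma pr0 (n : Q10) : pr 0 n = 2 * n 0 - n 1 := by
  rw [pr, sum10]; simp [E10M]; try ring
lemma pr1 (n : Q10) : pr 1 n = 2 * n 1 - n 0 - n 2 := by
  rw [pr, sum10]; simp [E10M]; try ring
lemma pr2 (n : Q10) : pr 2 n = 2 * n 2 - n 1 - n 3 := by
  rw [pr, sum10]; simp [E10M]; try ring
lemma pr3 (n : Q10) : pr 3 n = 2 * n 3 - n 2 - n 4 := by
  rw [pr, sum10]; simp [E10M]; try ring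
lemma pr4 (n : Q10) : pr 4 n = 2 * n 4 - n 3 - n 5 := by
  rw [pr, sum10]; simp [E10M]; try ring
lemma pr5 (n : Q10) : pr 5 n = 2 * n 5 - n 4 - n 6 := by
  rw [pr, sum10]; simp [E10M]; try ring
lemma pr6 (n : Q10) : pr 6 n = 2 * n 6 - n 5 - n 7 - n 9 := by
  rw [pr, sum10]; simp [E10M]; try ring
lemma pr7 (n : Q10) : pr 7 n = 2 * n 7 - n 6 - n 8 := by
  rw [pr, sum10]; simp [E10M]; try ring
lemma pr8 (n : Q10) : pr 8 n = 2 * n 8 - n 7 := by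
  rw [pr, sum10]; simp [E10M]; try ring
lemma pr9 (n : Q10) : pr 9 n = 2 * n 9 - n 6 := by
  rw [pr, sum10]; simp [E10M]; try ring

lemma ext10 {a b : Q10} (h0 : a 0 = b 0) (h1 : a 1 = b 1) (h2 : a 2 = b 2) (h3 : a 3 = b 3)
    (h4 : a 4 = b 4) (h5 : a 5 = b 5) (h6 : a 6 = b 6) (h7 : a 7 = b 7) (h8 : a 8 = b 8)
    (h9 : a 9 = b 9) : a = b := by
  funext i
  fin_cases i <;> assumption

lemma pr_injective {a b : Q10} (H : ∀ i, pr i a = pr i b) : a = b := by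
  have h0 := H 0; have h1 := H 1; have h2 := H 2; have h3 := H 3; have h4 := H 4
  have h5 := H 5; have h6 := H 6; have h7 := H 7; have h8 := H 8; have h9 := H 9
  rw [pr0, pr0] at h0
  rw [pr1, pr1] at h1
  rw [pr2, pr2] at h2
  rw [pr3, pr3] at h3
  rw [pr4, pr4] at h4
  rw [pr5, pr5] at h5
  rw [pr6, pr6] at h6
  rw [pr7, pr7] at h7
  rw [pr8, pr8] at h8
  rw [pr9, pr9] at h9
  apply ext10 <;> linarith

lemma eig_indep {M : Type*} [AddCommGroup M] [Module ℚ M] {ι : Type*} (T : Fin 10 → Module.End ℚ M)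
    (hT : ∀ i j, Commute (T i) (T j)) (c : ι → Fin 10 → ℚ) (hc : Function.Injective c) :
    iSupIndep (fun n : ι => ⨅ i, Module.End.eigenspace (T i) (c n i)) := by
  have h1 := Module.End.independent_iInf_maxGenEigenspace_of_forall_mapsTo T (by
      intro i j φ
      exact Module.End.mapsTo_maxGenEigenspace_of_comm (hT j i) φ)
  have h2 := h1.comp hc
  refine h2.mono ?_
  intro n
  refine iInf_mono ?_
  intro i
  exact Module.End.genEigenspace_le_maximal (T i) (c n i) 1

lemma R_indep : iSupIndep R := by
  refine eig_indep (fun i => LieAlgebra.ad ℚ G (h i)) ?_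
    (fun (n : Q10) (i : Fin 10) => ((pr i n : ℤ) : ℚ)) ?_
  · intro j i
    apply LinearMap.ext
    intro x
    change ⁅h j, ⁅h i, x⁆⁆ = ⁅h i, ⁅h j, x⁆⁆
    rw [leibniz_lie, G_rel.hh, zero_lie, zero_add]
  · intro a b hab
    apply pr_injective
    intro i
    have : ((pr i a : ℤ) : ℚ) = ((pr i b : ℤ) : ℚ) := congrFun hab i
    exact_mod_cast this

lemma R_eq_span (n : Q10) : R n = Submodule.span ℚ (sv '' {s | swt s = n}) := by
  apply le_antisymm
  · intro x hx
    have hsup : (Submodule.span ℚ (sv '' {s | swt s = n})) ⊔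
        (Submodule.span ℚ (sv '' {s | swt s ≠ n})) = ⊤ := by
      rw [← Submodule.span_union, ← Set.image_union, ← W_top, W, ← Set.image_univ]
      congr 2
      ext s; simp [em]
    have hx' : x ∈ (⊤ : Submodule ℚ G) := trivial
    rw [← hsup] at hx'
    obtain ⟨u, hu, v, hv, huv⟩ := Submodule.mem_sup.1 hx'
    have hu' : u ∈ R n := by
      refine (Submodule.span_le.2 ?_) hu
      rintro _ ⟨s, rfl, rfl⟩
      exact sv_mem s
    have hv' : v ∈ ⨆ m, ⨆ (_ : m ≠ n), R m := by
      refine (Submodule.span_le.2 ?_) hv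
      rintro _ ⟨s, hs, rfl⟩
      exact Submodule.mem_iSup_of_mem (swt s) (Submodule.mem_iSup_of_mem hs (sv_mem s))
    have hv2 : v ∈ R n := by
      have : v = x - u := by rw [← huv]; abel
      rw [this]; exact Submodule.sub_mem _ hx hu'
    have := (Submodule.disjoint_def.1 (R_indep n)) v hv2 hv'
    rw [← huv, this, add_zero]; exact hu
  · refine Submodule.span_le.2 ?_
    rintro _ ⟨s, rfl, rfl⟩
    exact sv_mem s

lemma R_iSup : ⨆ n, R n = ⊤ := by
  rw [eq_top_iff, ← W_top]
  refine Submodule.span_le.2 ?_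
  rintro _ ⟨s, rfl⟩
  exact Submodule.mem_iSup_of_mem (swt s) (sv_mem s)

/-! ### Heights and consequences -/

/-- height -/
def ht (n : Q10) : ℤ := ∑ i, n i

lemma ht_add (a b : Q10) : ht (a + b) = ht a + ht b := by simp [ht, Finset.sum_add_distrib]
lemma ht_sub (a b : Q10) : ht (a - b) = ht a - ht b := by simp [ht, Finset.sum_sub_distrib]
lemma ht_neg (a : Q10) : ht (-a) = - ht a := by simp [ht]
lemma ht_al (i) : ht (al i) = 1 := by simp [ht]

lemma ht_ww (l j) : ht (ww l j) = l.length + 1 := by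
  induction l with
  | nil => simp [ww, ht_al]
  | cons i l ih => rw [ww, ht_add, ih, ht_al]; push_cast [List.length_cons]; ring

lemma al_nonneg (i) : 0 ≤ al i := by
  intro j
  by_cases hj : j = i
  · subst hj; simp
  · simp [hj]

lemma ww_nonneg (l j) : 0 ≤ ww l j := by
  induction l with
  | nil => exact al_nonneg j
  | cons i l ih => exact add_nonneg (al_nonneg i) ih

lemma ht_nonneg {n : Q10} (hn : 0 ≤ n) : 0 ≤ ht n := Finset.sum_nonneg fun i _ => hn i

lemma ht_pos {n : Q10} (hn : 0 ≤ n) (h0 : n ≠ 0) : 0 < ht n := by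
  rcases (ht_nonneg hn).lt_or_eq with h1 | h1
  · exact h1
  · exfalso; apply h0
    have := (Finset.sum_eq_zero_iff_of_nonneg (fun i _ => hn i)).1 h1.symm
    funext i; exact this i (Finset.mem_univ i)

lemma R_bot {n : Q10} (h1 : ¬ 0 ≤ n) (h2 : ¬ n ≤ 0) : R n = ⊥ := by
  rw [R_eq_span, Submodule.span_eq_bot]
  rintro _ ⟨s, rfl, rfl⟩
  exfalso
  rcases s with p | i | p
  · exact h1 (ww_nonneg _ _)
  · exact h1 le_rfl
  · exact h2 (neg_nonpos.2 (ww_nonneg p.1 p.2))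

/-- positive root spaces are spanned by words -/
lemma R_pos {n : Q10} (hn : 0 < ht n) :
    R n = Submodule.span ℚ ((fun p : List (Fin 10) × Fin 10 => ew p.1 p.2) ''
      {p | ww p.1 p.2 = n}) := by
  rw [R_eq_span]
  congr 1
  ext x
  constructor
  · rintro ⟨s, rfl, rfl⟩
    rcases s with p | i | p
    · exact ⟨p, rfl, rfl⟩
    · simp [swt, ht] at hn
    · exfalso
      have := ht_ww p.1 p.2
      simp only [swt, ht_neg] at hn
      omega
  · rintro ⟨p, rfl, rfl⟩
    exact ⟨.inl p, rfl, rfl⟩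

lemma R_fin {n : Q10} (hn : 0 < ht n) : FiniteDimensional ℚ (R n) := by
  rw [R_pos hn]
  apply FiniteDimensional.span_of_finite
  apply Set.Finite.image
  have h1 : ({l : List (Fin 10) | l.length = (ht n - 1).toNat} ×ˢ (Set.univ : Set (Fin 10))).Finite :=
    (List.finite_length_eq _ _).prod Set.finite_univ
  refine h1.subset ?_
  rintro ⟨l, j⟩ hp
  simp only [Set.mem_ofPred_eq] at hp
  have := ht_ww l j
  rw [hp] at this
  simp; omega

/-- Induction principle for elements of positive root spaces. -/
lemma R_induction {n : Q10} (hn : 0 < ht n) {p : G → Prop} (h0 : p 0)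
    (hadd : ∀ x y, x ∈ R n → y ∈ R n → p x → p y → p (x + y))
    (hsmul : ∀ (c : ℚ) x, x ∈ R n → p x → p (c • x))
    (hw : ∀ l j, ww l j = n → p (ew l j)) : ∀ x ∈ R n, p x := by
  intro x hx
  have hx' := hx
  rw [R_pos hn] at hx'
  induction hx' using Submodule.span_induction with
  | mem y hy => obtain ⟨⟨l, j⟩, h1, rfl⟩ := hy; exact hw l j h1
  | zero => exact h0
  | add y z hy hz py pz =>
    rw [← R_pos hn] at hy hz
    exact hadd y z hy hz (py hy) (pz hz)
  | smul c y hy py =>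
    rw [← R_pos hn] at hy
    exact hsmul c y hy (py hy)

end E10

/-! ## A nontrivial representation, showing `e i ≠ 0` -/

namespace E10

/-- Relations without the Serre relations. -/
structure PreRel {L : Type*} [LieRing L] [LieAlgebra ℚ L] (H E F : Fin 10 → L) : Prop where
  hh : ∀ i j, ⁅H i, H j⁆ = 0
  ef : ∀ i, ⁅E i, F i⁆ = H i
  ef' : ∀ i j, i ≠ j → ⁅E i, F j⁆ = 0
  he : ∀ i j, ⁅H i, E j⁆ = (E10M i j : ℚ) • E j
  hf : ∀ i j, ⁅H i, F j⁆ = -((E10M i j : ℚ) • F j)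

section
variable {L : Type*} [LieRing L] [LieAlgebra ℚ L] {H E F : Fin 10 → L}

lemma PreRel.swap (r : PreRel H E F) : PreRel (fun i => - H i) F E where
  hh i j := by simp [r.hh]
  ef i := by rw [← lie_skew, r.ef]
  ef' i j hij := by rw [← lie_skew, r.ef' j i (Ne.symm hij), neg_zero]
  he i j := by rw [neg_lie, r.hf, neg_neg]
  hf i j := by rw [neg_lie, r.he]

lemma PreRel.fe (r : PreRel H E F) (i) : ⁅F i, E i⁆ = - H i := by rw [← lie_skew, r.ef]
lemma PreRel.fe' (r : PreRel H E F) (i j) (hij : i ≠ j) : ⁅F i, E j⁆ = 0 := by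
  rw [← lie_skew, r.ef' j i (Ne.symm hij), neg_zero]

lemma PreRel.serre0 (r : PreRel H E F) (i j k) (hij : E10M i j = 0) : ⁅F k, ⁅E i, E j⁆⁆ = 0 := by
  have hji : E10M j i = 0 := by rw [A_symm]; exact hij
  have hne : i ≠ j := by rintro rfl; rw [A_diag] at hij; omega
  rw [leibniz_lie]
  by_cases hki : k = i
  · subst hki
    rw [r.fe, r.fe' k j hne, neg_lie, r.he, hij]; simp
  · rw [r.fe' k i hki]
    by_cases hkj : k = j
    · subst hkj
      rw [r.fe, lie_neg, ← lie_skew (E i), neg_neg, r.he, hji]; simp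
    · rw [r.fe' k j hkj]; simp

lemma PreRel.serre1 (r : PreRel H E F) (i j k) (hij : E10M i j = -1) :
    ⁅F k, ⁅E i, ⁅E i, E j⁆⁆⁆ = 0 := by
  have hji : E10M j i = -1 := by rw [A_symm]; exact hij
  have hne : i ≠ j := by rintro rfl; rw [A_diag] at hij; omega
  rw [leibniz_lie]
  by_cases hki : k = i
  · subst hki
    have h1 : ⁅F k, ⁅E k, E j⁆⁆ = E j := by
      rw [leibniz_lie, r.fe, r.fe' k j hne, neg_lie, r.he, hij]; simp
    rw [h1, r.fe, neg_lie, leibniz_lie, r.he, r.he, hij, A_diag]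
    simp only [smul_lie, lie_smul]
    push_cast
    module
  · rw [r.fe' k i hki]
    by_cases hkj : k = j
    · subst hkj
      have h1 : ⁅F k, ⁅E i, E k⁆⁆ = -E i := by
        rw [leibniz_lie, r.fe' k i hki, r.fe, lie_neg, ← lie_skew (E i), neg_neg, r.he, hji]; simp
      rw [h1]; simp
    · have h1 : ⁅F k, ⁅E i, E j⁆⁆ = 0 := by
        rw [leibniz_lie, r.fe' k i hki, r.fe' k j hkj]; simp
      rw [h1]; simp

end

lemma comm_aux {L : Type*} [LieRing L] [LieAlgebra ℚ L] {H E F K : L} {c d : ℚ}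
    (hd : ⁅H, F⁆ = -(d • F)) (hK : ⁅H, K⁆ = 0) (hcd : ⁅E, F⁆ = 0 ∨ (c = d ∧ ⁅E, F⁆ = K)) :
    ⁅⁅H, E⁆ - c • E, F⁆ = 0 := by
  rw [sub_lie, smul_lie, lie_lie, hd, lie_neg, lie_smul]
  rcases hcd with h0 | ⟨rfl, h0⟩
  · rw [h0]; simp
  · rw [h0, hK]; simp

namespace Rep

attribute [local instance] LieRing.ofAssociativeRing

abbrev V := List (Fin 10) →₀ ℚ

def hw (i : Fin 10) (w : List (Fin 10)) : ℚ := 1 - (w.map fun k => (E10M i k : ℚ)).sum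

def bas (w : List (Fin 10)) : V := Finsupp.single w 1

def F (j : Fin 10) : Module.End ℚ V := Finsupp.linearCombination ℚ (fun w => bas (j :: w))
def H (i : Fin 10) : Module.End ℚ V := Finsupp.linearCombination ℚ (fun w => hw i w • bas w)

def Ev (i : Fin 10) : List (Fin 10) → V
  | [] => 0
  | j :: w => F j (Ev i w) + if i = j then H i (bas w) else 0

def E (i : Fin 10) : Module.End ℚ V := Finsupp.linearCombination ℚ (Ev i)

lemma F_bas (j w) : F j (bas w) = bas (j :: w) := by simp [F, bas]
lemma H_bas (j w) : H j (bas w) = hw j w • bas w := by simp [H, bas]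
lemma E_bas (j w) : E j (bas w) = Ev j w := by simp [E, bas]

lemma ext_bas {S T : Module.End ℚ V} (h : ∀ w, S (bas w) = T (bas w)) : S = T := by
  apply Finsupp.lhom_ext'
  intro w
  apply LinearMap.ext_ring
  exact h w

lemma HF (i j) : ⁅H i, F j⁆ = -((E10M i j : ℚ) • F j) := by
  apply ext_bas
  intro w
  simp only [Ring.lie_def, LinearMap.sub_apply, Module.End.mul_apply, F_bas, H_bas, map_smul,
    LinearMap.neg_apply, LinearMap.smul_apply]
  simp only [hw, List.map_cons, List.sum_cons]
  module

lemma HH (i j) : ⁅H i, H j⁆ = 0 := by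
  apply ext_bas
  intro w
  simp only [Ring.lie_def, LinearMap.sub_apply, Module.End.mul_apply, H_bas, map_smul]
  simp [smul_smul, mul_comm]

lemma EF (i j) : ⁅E i, F j⁆ = if i = j then H i else 0 := by
  apply ext_bas
  intro w
  simp only [Ring.lie_def, LinearMap.sub_apply, Module.End.mul_apply, F_bas, E_bas]
  rw [Ev]
  split_ifs <;> simp

/-- An operator commuting with all `F k` and killing the vacuum vanishes. -/
lemma zero_of_comm {D : Module.End ℚ V} (h0 : D (bas []) = 0) (hc : ∀ k, ⁅D, F k⁆ = 0) : D = 0 := by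
  apply ext_bas
  intro w
  rw [LinearMap.zero_apply]
  induction w with
  | nil => exact h0
  | cons k w ih =>
    have := congrArg (fun T : Module.End ℚ V => T (bas w)) (hc k)
    simp only [Ring.lie_def, LinearMap.sub_apply, Module.End.mul_apply, F_bas, ih, map_zero,
      sub_zero, LinearMap.zero_apply] at this
    exact this

lemma E_vac (i) : E i (bas []) = 0 := by rw [E_bas, Ev]

lemma HE (i j) : ⁅H i, E j⁆ = (E10M i j : ℚ) • E j := by
  rw [← sub_eq_zero]
  apply zero_of_comm
  · simp only [Ring.lie_def, LinearMap.sub_apply, Module.End.mul_apply, E_vac, H_bas, map_smul,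
      LinearMap.smul_apply]
    simp
  · intro k
    refine comm_aux (HF i k) (HH i j) ?_
    by_cases hjk : j = k
    · subst hjk; right; exact ⟨rfl, by rw [EF, if_pos rfl]⟩
    · left; rw [EF, if_neg hjk]

lemma preRel : PreRel H E F where
  hh := HH
  ef i := by rw [EF, if_pos rfl]
  ef' i j hij := by rw [EF, if_neg hij]
  he := HE
  hf := HF

lemma SE0 (i j) (hij : E10M i j = 0) : ⁅E i, E j⁆ = 0 := by
  apply zero_of_comm
  · simp only [Ring.lie_def, LinearMap.sub_apply, Module.End.mul_apply, E_vac]; simp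
  · intro k
    rw [← lie_skew, preRel.serre0 i j k hij, neg_zero]

lemma SE1 (i j) (hij : E10M i j = -1) : ⁅E i, ⁅E i, E j⁆⁆ = 0 := by
  apply zero_of_comm
  · simp only [Ring.lie_def, LinearMap.sub_apply, Module.End.mul_apply, E_vac]; simp [E_vac]
  · intro k
    rw [← lie_skew, preRel.serre1 i j k hij, neg_zero]

/-- vacuum coefficient -/
def eps : V →ₗ[ℚ] ℚ := Finsupp.lapply []

lemma eps_F (j v) : eps (F j v) = 0 := by
  have : eps ∘ₗ F j = 0 := by
    apply Finsupp.lhom_ext'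
    intro w
    apply LinearMap.ext_ring
    change eps (F j (bas w)) = 0
    rw [F_bas]; simp [eps, bas]
  exact LinearMap.congr_fun this v

lemma eps_H (j v) : eps (H j v) = eps v := by
  have : eps ∘ₗ H j = eps := by
    apply Finsupp.lhom_ext'
    intro w
    apply LinearMap.ext_ring
    change eps (H j (bas w)) = eps (bas w)
    rw [H_bas, map_smul]
    rcases w with _ | ⟨a, w⟩
    · simp [eps, bas, hw]
    · simp [eps, bas]
  exact LinearMap.congr_fun this v

/-- words of raising operators -/
def EW : List (Fin 10) → V → V
  | [], v => v
  | i :: l, v => EW l (E i v)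

lemma EW_add (l) : ∀ v u, EW l (v + u) = EW l v + EW l u := by
  induction l with
  | nil => intro v u; rfl
  | cons i l ih => intro v u; simp [EW, ih]

lemma EW_smul (l) (c : ℚ) : ∀ v, EW l (c • v) = c • EW l v := by
  induction l with
  | nil => intro v; rfl
  | cons i l ih => intro v; simp [EW, ih]

/-- The radical. -/
def J : Submodule ℚ V where
  carrier := {v | ∀ l, eps (EW l v) = 0}
  add_mem' := by
    intro a b ha hb l
    rw [EW_add, map_add, ha l, hb l, add_zero]
  zero_mem' := by
    intro l
    have := EW_smul l 0 0
    rw [zero_smul, zero_smul] at this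
    rw [this, map_zero]
  smul_mem' := by
    intro c a ha l
    rw [EW_smul, map_smul, ha l, smul_zero]

lemma E_J (i) : ∀ v ∈ J, E i v ∈ J := fun _ hv l => hv (i :: l)

lemma H_J (i) : ∀ v ∈ J, H i v ∈ J := by
  have key : ∀ l v, (∀ l', eps (EW l' v) = 0) → eps (EW l (H i v)) = 0 := by
    intro l
    induction l with
    | nil => intro v hv; rw [EW, eps_H]; exact hv []
    | cons j l ih =>
      intro v hv
      have h1 : E j (H i v) = H i (E j v) - (E10M i j : ℚ) • E j v := by
        have := congrArg (fun T : Module.End ℚ V => T v) (HE i j)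
        simp only [Ring.lie_def, LinearMap.sub_apply, Module.End.mul_apply,
          LinearMap.smul_apply] at this
        rw [← this]; abel
      rw [EW, h1, sub_eq_add_neg, ← neg_smul, EW_add, EW_smul, map_add, map_smul,
        ih _ (fun l' => hv (j :: l'))]
      have h2 : eps (EW l (E j v)) = 0 := hv (j :: l)
      rw [h2]; simp
  exact fun v hv l => key l v hv

lemma F_J (i) : ∀ v ∈ J, F i v ∈ J := by
  have key : ∀ l v, v ∈ J → eps (EW l (F i v)) = 0 := by
    intro l
    induction l with
    | nil => intro v hv; rw [EW, eps_F]
    | cons j l ih =>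
      intro v hv
      have h1 : E j (F i v) = F i (E j v) + if j = i then H j v else 0 := by
        have := congrArg (fun T : Module.End ℚ V => T v) (EF j i)
        simp only [Ring.lie_def, LinearMap.sub_apply, Module.End.mul_apply] at this
        rw [sub_eq_iff_eq_add] at this
        rw [this, add_comm]
        split_ifs <;> simp
      rw [EW, h1, EW_add, map_add, ih _ (E_J j v hv), zero_add]
      split_ifs with hji
      · exact H_J j v hv l
      · exact J.zero_mem l
  exact fun v hv l => key l v hv

lemma mem_J_of_comm {S : Module.End ℚ V} (h0 : ∀ v, eps (S v) = 0) (hc : ∀ k, ⁅E k, S⁆ = 0) (v) :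
    S v ∈ J := by
  intro l
  induction l generalizing v with
  | nil => exact h0 v
  | cons j l ih =>
    have := congrArg (fun T : Module.End ℚ V => T v) (hc j)
    simp only [Ring.lie_def, LinearMap.sub_apply, Module.End.mul_apply,
      LinearMap.zero_apply, sub_eq_zero] at this
    rw [EW, this]; exact ih _

lemma SF0 (i j) (hij : E10M i j = 0) (v) : ⁅F i, F j⁆ v ∈ J := by
  refine mem_J_of_comm ?_ (fun k => preRel.swap.serre0 i j k hij) v
  intro v
  simp only [Ring.lie_def, LinearMap.sub_apply, Module.End.mul_apply, map_sub, eps_F, sub_zero]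

lemma SF1 (i j) (hij : E10M i j = -1) (v) : ⁅F i, ⁅F i, F j⁆⁆ v ∈ J := by
  refine mem_J_of_comm ?_ (fun k => preRel.swap.serre1 i j k hij) v
  intro v
  simp only [Ring.lie_def, LinearMap.sub_apply, Module.End.mul_apply, map_sub, eps_F, sub_zero]

abbrev VQ := V ⧸ J

def Hq (i : Fin 10) : Module.End ℚ VQ := J.mapQ J (H i) (H_J i)
def Eq1 (i : Fin 10) : Module.End ℚ VQ := J.mapQ J (E i) (E_J i)
def Fq (i : Fin 10) : Module.End ℚ VQ := J.mapQ J (F i) (F_J i)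

lemma ext_q {S T : Module.End ℚ VQ} (h : ∀ v, S (J.mkQ v) = T (J.mkQ v)) : S = T := by
  apply LinearMap.ext
  intro x
  obtain ⟨v, rfl⟩ := J.mkQ_surjective x
  exact h v

/-- `S` lifts to `T` -/
def Lifts (S : Module.End ℚ V) (T : Module.End ℚ VQ) : Prop := ∀ v, T (J.mkQ v) = J.mkQ (S v)

lemma Lifts.lie {S S' T T'} (h : Lifts S T) (h' : Lifts S' T') : Lifts ⁅S, S'⁆ ⁅T, T'⁆ := by
  intro v
  simp only [Ring.lie_def, LinearMap.sub_apply, Module.End.mul_apply, h _, h' _, map_sub]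

lemma Lifts.eq {S S' T T'} (h : Lifts S T) (h' : Lifts S' T') (hS : S = S') : T = T' := by
  apply ext_q
  intro v
  rw [h, h', hS]

lemma Lifts.eq0 {S T} (h : Lifts S T) (hS : ∀ v, S v ∈ J) : T = 0 := by
  apply ext_q
  intro v
  rw [h, LinearMap.zero_apply]
  exact (Submodule.Quotient.mk_eq_zero J).2 (hS v)

lemma lH (i) : Lifts (H i) (Hq i) := fun _ => rfl
lemma lE (i) : Lifts (E i) (Eq1 i) := fun _ => rfl
lemma lF (i) : Lifts (F i) (Fq i) := fun _ => rfl

lemma Lifts.smul {S T} (h : Lifts S T) (c : ℚ) : Lifts (c • S) (c • T) := by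
  intro v
  rw [LinearMap.smul_apply, LinearMap.smul_apply, h, map_smul]
lemma Lifts.neg {S T} (h : Lifts S T) : Lifts (-S) (-T) := by
  intro v
  rw [LinearMap.neg_apply, LinearMap.neg_apply, h, map_neg]

lemma zero_J {S : Module.End ℚ V} (h : S = 0) (v) : S v ∈ J := by
  rw [h]; exact J.zero_mem

lemma rel : Rel Hq Eq1 Fq where
  hh i j := ((lH i).lie (lH j)).eq0 (zero_J (HH i j))
  ef i := ((lE i).lie (lF i)).eq (lH i) (preRel.ef i)
  ef' i j hij := ((lE i).lie (lF j)).eq0 (zero_J (preRel.ef' i j hij))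
  he i j := ((lH i).lie (lE j)).eq ((lE j).smul _) (HE i j)
  hf i j := ((lH i).lie (lF j)).eq ((lF j).smul _).neg (HF i j)
  se0 i j hij := ((lE i).lie (lE j)).eq0 (zero_J (SE0 i j hij))
  se1 i j hij := ((lE i).lie ((lE i).lie (lE j))).eq0 (zero_J (SE1 i j hij))
  sf0 i j hij := ((lF i).lie (lF j)).eq0 (SF0 i j hij)
  sf1 i j hij := ((lF i).lie ((lF i).lie (lF j))).eq0 (SF1 i j hij)

lemma Hq_ne (i) : Hq i ≠ 0 := by
  intro h0
  have h1 := lH i (bas [])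
  rw [h0, LinearMap.zero_apply, H_bas] at h1
  have h2 : hw i [] • bas [] ∈ J := (Submodule.Quotient.mk_eq_zero J).1 h1.symm
  have h3 := h2 []
  simp [EW, eps, bas, hw] at h3

end Rep

section
attribute [local instance] LieRing.ofAssociativeRing

theorem h_ne (i) : h i ≠ 0 := by
  obtain ⟨φ, hφ, -, -⟩ := exists_lift Rep.rel
  intro h0
  apply Rep.Hq_ne i
  rw [← hφ, h0, map_zero]

end

theorem e_ne (i) : e i ≠ 0 := by
  intro h0
  apply h_ne i
  rw [← G_rel.ef, h0, zero_lie]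

end E10

/-! ## The cobracket -/

namespace E10

/-- Semidirect product of a Lie algebra and a module. -/
structure SD (L M : Type*) where
  fst : L
  snd : M

namespace SD
variable {L M : Type*} [LieRing L] [LieAlgebra ℚ L] [AddCommGroup M] [Module ℚ M]
  [LieRingModule L M] [LieModule ℚ L M]

@[ext] lemma ext' {x y : SD L M} (h1 : x.fst = y.fst) (h2 : x.snd = y.snd) : x = y := by
  cases x; cases y; simp_all

def toProd : SD L M → L × M := fun x => (x.fst, x.snd)
lemma toProd_inj : Function.Injective (toProd : SD L M → L × M) := by
  intro x y h
  simp only [toProd, Prod.mk.injEq] at h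
  exact ext' h.1 h.2

instance : Zero (SD L M) := ⟨⟨0, 0⟩⟩
instance : Add (SD L M) := ⟨fun x y => ⟨x.fst + y.fst, x.snd + y.snd⟩⟩
instance : Neg (SD L M) := ⟨fun x => ⟨-x.fst, -x.snd⟩⟩
instance : Sub (SD L M) := ⟨fun x y => ⟨x.fst - y.fst, x.snd - y.snd⟩⟩
instance : SMul ℕ (SD L M) := ⟨fun c x => ⟨c • x.fst, c • x.snd⟩⟩
instance : SMul ℤ (SD L M) := ⟨fun c x => ⟨c • x.fst, c • x.snd⟩⟩
instance : SMul ℚ (SD L M) := ⟨fun c x => ⟨c • x.fst, c • x.snd⟩⟩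

instance : AddCommGroup (SD L M) :=
  toProd_inj.addCommGroup _ rfl (fun _ _ => rfl) (fun _ => rfl) (fun _ _ => rfl)
    (fun _ _ => rfl) (fun _ _ => rfl)

@[simp] lemma add_fst (x y : SD L M) : (x + y).fst = x.fst + y.fst := rfl
@[simp] lemma add_snd (x y : SD L M) : (x + y).snd = x.snd + y.snd := rfl
@[simp] lemma neg_fst (x : SD L M) : (-x).fst = -x.fst := rfl
@[simp] lemma neg_snd (x : SD L M) : (-x).snd = -x.snd := rfl
@[simp] lemma zero_fst : (0 : SD L M).fst = 0 := rfl
@[simp] lemma zero_snd : (0 : SD L M).snd = 0 := rfl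
@[simp] lemma smul_fst (c : ℚ) (x : SD L M) : (c • x).fst = c • x.fst := rfl
@[simp] lemma smul_snd (c : ℚ) (x : SD L M) : (c • x).snd = c • x.snd := rfl

def toProdHom : SD L M →+ L × M := ⟨⟨toProd, rfl⟩, fun _ _ => rfl⟩

instance : Module ℚ (SD L M) := toProd_inj.module ℚ toProdHom (fun _ _ => rfl)

instance : Bracket (SD L M) (SD L M) :=
  ⟨fun x y => ⟨⁅x.fst, y.fst⁆, ⁅x.fst, y.snd⁆ - ⁅y.fst, x.snd⁆⟩⟩

@[simp] lemma lie_fst (x y : SD L M) : ⁅x, y⁆.fst = ⁅x.fst, y.fst⁆ := rfl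
@[simp] lemma lie_snd (x y : SD L M) : ⁅x, y⁆.snd = ⁅x.fst, y.snd⁆ - ⁅y.fst, x.snd⁆ := rfl

instance : LieRing (SD L M) where
  add_lie x y z := by
    apply ext' <;> simp
    abel
  lie_add x y z := by
    apply ext' <;> simp
    abel
  lie_self x := by apply ext' <;> simp
  leibniz_lie x y z := by
    apply ext'
    · simp
    · simp only [lie_fst, lie_snd, add_snd, lie_sub, lie_lie]
      abel

instance : LieAlgebra ℚ (SD L M) where
  lie_smul c x y := by
    apply ext'
    · simp
    · simp [smul_sub]

end SD

section
variable {L M : Type*} [LieRing L] [LieAlgebra ℚ L] [AddCommGroup M] [Module ℚ M]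
  [LieRingModule L M] [LieModule ℚ L M] {H E F : Fin 10 → L}

lemma serre_coc (w : L →ₗ[ℚ] L →ₗ[ℚ] M)
    (hw : ∀ (x u v : L), ⁅x, w u v⁆ = w ⁅x, u⁆ v + w u ⁅x, v⁆) (ha : ∀ u v, w u v = - w v u)
    {hi hj ei ej : L} (c : ℚ)
    (hii : ⁅hi, ei⁆ = (2 * c) • ei) (hij : ⁅hi, ej⁆ = -c • ej) (hji : ⁅hj, ei⁆ = -c • ei)
    (se : ⁅ei, ⁅ei, ej⁆⁆ = 0) :
    ⁅ei, ⁅ei, w hj ej⁆ - ⁅ej, w hi ei⁆⁆ - ⁅⁅ei, ej⁆, w hi ei⁆ = 0 := by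
  have haa : ∀ u, w u u = 0 := fun u => by
    have := ha u u
    have h2 : (2 : ℚ) • w u u = 0 := by rw [two_smul]; nth_rewrite 2 [this]; exact add_neg_cancel _
    exact (smul_eq_zero.1 h2).resolve_left (by norm_num)
  have a1 : ⁅ei, hi⁆ = -((2 * c) • ei) := by rw [← lie_skew, hii]
  have a2 : ⁅ej, hi⁆ = c • ej := by rw [← lie_skew, hij]; simp
  have a3 : ⁅ei, hj⁆ = c • ei := by rw [← lie_skew, hji]; simp
  have a4 : ⁅ej, ei⁆ = -⁅ei, ej⁆ := by rw [← lie_skew]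
  have a5 : ⁅⁅ei, ej⁆, ei⁆ = 0 := by rw [← lie_skew, se, neg_zero]
  have a6 : ⁅⁅ei, ej⁆, hi⁆ = -(c • ⁅ei, ej⁆) := by
    rw [lie_lie, a2, a1]
    simp only [lie_smul, lie_neg, a4]
    module
  simp only [lie_sub, hw, lie_add, a1, a2, a3, a4, a5, a6, map_smul, map_neg, map_add,
    LinearMap.smul_apply, LinearMap.neg_apply, lie_self, se, map_zero, lie_smul, lie_neg]
  simp only [LinearMap.zero_apply]
  module

lemma sd_rel (r : Rel H E F) (w : L →ₗ[ℚ] L →ₗ[ℚ] M)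
    (hw : ∀ (x u v : L), ⁅x, w u v⁆ = w ⁅x, u⁆ v + w u ⁅x, v⁆) (ha : ∀ u v, w u v = - w v u) :
    Rel (fun i => (⟨H i, 0⟩ : SD L M)) (fun i => ⟨E i, w (H i) (E i)⟩)
      (fun i => ⟨F i, w (H i) (F i)⟩) := by
  have haa : ∀ u, w u u = 0 := fun u => by
    have := ha u u
    have h2 : (2 : ℚ) • w u u = 0 := by rw [two_smul]; nth_rewrite 2 [this]; exact add_neg_cancel _
    exact (smul_eq_zero.1 h2).resolve_left (by norm_num)
  have eh : ∀ i j, ⁅E i, H j⁆ = -((E10M j i : ℚ) • E i) := fun i j => by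
    rw [← lie_skew, r.he]
  have fh : ∀ i j, ⁅F i, H j⁆ = (E10M j i : ℚ) • F i := fun i j => by
    rw [← lie_skew, r.hf, neg_neg]
  constructor
  · intro i j; apply SD.ext' <;> simp [r.hh]
  · intro i
    apply SD.ext'
    · simp [r.ef]
    · have fe : ⁅F i, E i⁆ = - H i := by rw [← lie_skew, r.ef]
      simp only [SD.lie_snd, hw, eh, fh, r.ef, fe]
      generalize (E10M i i : ℚ) = c
      simp only [map_neg, map_smul, haa, LinearMap.neg_apply, LinearMap.smul_apply]
      rw [ha (F i)]; simp
  · intro i j hij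
    apply SD.ext'
    · simp [r.ef' _ _ hij]
    · have fe : ⁅F j, E i⁆ = 0 := by rw [← lie_skew, r.ef' _ _ hij, neg_zero]
      simp only [SD.lie_snd, hw, eh, fh, r.ef' _ _ hij, fe]
      rw [A_symm j i]
      generalize (E10M i j : ℚ) = c
      simp only [map_neg, map_smul, map_zero, LinearMap.neg_apply, LinearMap.smul_apply]
      rw [ha (F j)]; simp
  · intro i j
    apply SD.ext'
    · simp [r.he]
    · simp only [SD.lie_snd, hw, r.hh, r.he, SD.smul_snd]
      simp
  · intro i j
    apply SD.ext'
    · simp [r.hf]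
    · simp only [SD.lie_snd, hw, r.hh, r.hf, SD.smul_snd, SD.neg_snd]
      simp
  · intro i j h0
    have h0' : E10M j i = 0 := by rw [A_symm]; exact h0
    have ee : ⁅E j, E i⁆ = 0 := r.se0 _ _ h0'
    apply SD.ext'
    · simp [r.se0 _ _ h0]
    · simp only [SD.lie_snd, hw, eh, r.se0 _ _ h0, ee, h0, h0']
      simp
  · intro i j h0
    have h0' : E10M j i = -1 := by rw [A_symm]; exact h0
    apply SD.ext'
    · simp [r.se1 _ _ h0]
    · refine serre_coc w hw ha 1 ?_ ?_ ?_ (r.se1 _ _ h0)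
      · rw [r.he, A_diag]; norm_num
      · rw [r.he, h0]; norm_num
      · rw [r.he, h0']; norm_num
  · intro i j h0
    have h0' : E10M j i = 0 := by rw [A_symm]; exact h0
    have ee : ⁅F j, F i⁆ = 0 := r.sf0 _ _ h0'
    apply SD.ext'
    · simp [r.sf0 _ _ h0]
    · simp only [SD.lie_snd, hw, fh, r.sf0 _ _ h0, ee, h0, h0']
      simp
  · intro i j h0
    have h0' : E10M j i = -1 := by rw [A_symm]; exact h0
    apply SD.ext'
    · simp [r.sf1 _ _ h0]
    · refine serre_coc w hw ha (-1) ?_ ?_ ?_ (r.sf1 _ _ h0)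
      · rw [r.hf, A_diag]; norm_num
      · rw [r.hf, h0]; norm_num
      · rw [r.hf, h0']; norm_num

end

/-- Existence of cocycles. -/
theorem exists_cocycle {M : Type*} [AddCommGroup M] [Module ℚ M]
    [LieRingModule G M] [LieModule ℚ G M] (w : G →ₗ[ℚ] G →ₗ[ℚ] M)
    (hw : ∀ (x u v : G), ⁅x, w u v⁆ = w ⁅x, u⁆ v + w u ⁅x, v⁆) (ha : ∀ u v, w u v = - w v u) :
    ∃ δ : G →ₗ[ℚ] M, (∀ x y, δ ⁅x, y⁆ = ⁅x, δ y⁆ - ⁅y, δ x⁆) ∧ (∀ i, δ (e i) = w (h i) (e i)) := by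
  obtain ⟨φ, h1, h2, h3⟩ := exists_lift (sd_rel G_rel w hw ha)
  let p : SD G M →ₗ⁅ℚ⁆ G :=
    { toFun := SD.fst, map_add' := fun _ _ => rfl, map_smul' := fun _ _ => rfl,
      map_lie' := fun {_ _} => rfl }
  have hp : p.comp φ = LieHom.id := by
    apply hom_ext
    · intro i; rw [LieHom.comp_apply, h1]; rfl
    · intro i; rw [LieHom.comp_apply, h2]; rfl
    · intro i; rw [LieHom.comp_apply, h3]; rfl
  have hp' : ∀ x, (φ x).fst = x := fun x => LieHom.congr_fun hp x
  refine ⟨{ toFun := fun x => (φ x).snd, map_add' := ?_, map_smul' := ?_ }, ?_, ?_⟩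
  · intro x y; rw [map_add]; rfl
  · intro c x; rw [map_smul]; rfl
  · intro x y
    change (φ ⁅x, y⁆).snd = ⁅x, (φ y).snd⁆ - ⁅y, (φ x).snd⁆
    rw [LieHom.map_lie, SD.lie_snd, hp', hp']
  · intro i
    change (φ (e i)).snd = _
    rw [h2]

end E10

/-! ## The reduced cobracket -/

namespace E10
open scoped TensorProduct

/-- the bilinear form -/
def bil (a b : Q10) : ℤ := ∑ i, a i * pr i b

lemma bil_add_left (a b c : Q10) : bil (a + b) c = bil a c + bil b c := by
  simp [bil, add_mul, Finset.sum_add_distrib]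
lemma bil_add_right (a b c : Q10) : bil a (b + c) = bil a b + bil a c := by
  simp [bil, pr_add, mul_add, Finset.sum_add_distrib]
lemma bil_comm (a b : Q10) : bil a b = bil b a := by
  simp only [bil, pr, Finset.mul_sum]
  rw [Finset.sum_comm]
  refine Finset.sum_congr rfl fun i _ => Finset.sum_congr rfl fun j _ => ?_
  rw [A_symm]; ring
lemma bil_neg_left (a b : Q10) : bil (-a) b = - bil a b := by
  simp [bil]
lemma bil_neg_right (a b : Q10) : bil a (-b) = - bil a b := by
  simp [bil, pr_neg]
lemma bil_sub_left (a b c : Q10) : bil (a - b) c = bil a c - bil b c := by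
  rw [sub_eq_add_neg, bil_add_left, bil_neg_left]; ring
lemma bil_sub_right (a b c : Q10) : bil a (b - c) = bil a b - bil a c := by
  rw [sub_eq_add_neg, bil_add_right, bil_neg_right]; ring
lemma bil_al (i) (b : Q10) : bil (al i) b = pr i b := by
  simp [bil, Pi.single_apply]

def hb (a : Q10) : G := ∑ i, (a i : ℚ) • h i

lemma hb_add (a b : Q10) : hb (a + b) = hb a + hb b := by
  simp [hb, add_smul, Finset.sum_add_distrib]

lemma hb_al (i) : hb (al i) = h i := by
  unfold hb
  rw [Finset.sum_eq_single i]
  · simp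
  · intro j _ hj; simp [hj]
  · simp

lemma hb_lie (a : Q10) {b : Q10} {x : G} (hx : x ∈ R b) : ⁅hb a, x⁆ = (bil a b : ℚ) • x := by
  rw [hb, sum_lie]
  have : ∀ i, ⁅(a i : ℚ) • h i, x⁆ = ((a i * pr i b : ℤ) : ℚ) • x := by
    intro i
    rw [smul_lie, mem_R.1 hx i, smul_smul]; push_cast; rfl
  rw [Finset.sum_congr rfl fun i _ => this i, ← Finset.sum_smul, bil]
  push_cast; rfl

/-- the wedge -/
def wg : G →ₗ[ℚ] G →ₗ[ℚ] G ⊗[ℚ] G := TensorProduct.mk ℚ G G - (TensorProduct.mk ℚ G G).flip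

lemma wg_apply (u v : G) : wg u v = u ⊗ₜ[ℚ] v - v ⊗ₜ[ℚ] u := rfl

lemma wg_lie (x u v : G) : ⁅x, wg u v⁆ = wg ⁅x, u⁆ v + wg u ⁅x, v⁆ := by
  simp only [wg_apply, lie_sub, TensorProduct.LieModule.lie_tmul_right]
  abel

lemma wg_anti (u v : G) : wg u v = - wg v u := by
  simp only [wg_apply]; abel

/-- The cobracket. -/
def cob : G →ₗ[ℚ] G ⊗[ℚ] G := (exists_cocycle wg wg_lie wg_anti).choose
lemma cob_lie (x y : G) : cob ⁅x, y⁆ = ⁅x, cob y⁆ - ⁅y, cob x⁆ :=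
  (exists_cocycle wg wg_lie wg_anti).choose_spec.1 x y
lemma cob_e (i) : cob (e i) = wg (h i) (e i) :=
  (exists_cocycle wg wg_lie wg_anti).choose_spec.2 i

/-- reduced cobracket at weight `b` -/
def rcob (b : Q10) : G →ₗ[ℚ] G ⊗[ℚ] G := cob - wg (hb b)

lemma rcob_lie {a b : Q10} {x y : G} (hx : x ∈ R a) (hy : y ∈ R b) :
    rcob (a + b) ⁅x, y⁆ = ⁅x, rcob b y⁆ - ⁅y, rcob a x⁆ - (2 * bil a b : ℚ) • wg x y := by
  have h1 : ⁅x, hb b⁆ = -((bil a b : ℚ) • x) := by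
    rw [← lie_skew, hb_lie b hx, bil_comm]
  have h2 : ⁅y, hb a⁆ = -((bil a b : ℚ) • y) := by
    rw [← lie_skew, hb_lie a hy]
  have h3 : ⁅y, x⁆ = -⁅x, y⁆ := by rw [← lie_skew]
  simp only [rcob, LinearMap.sub_apply, lie_sub, cob_lie, wg_lie, h1, h2, hb_add, map_add,
    LinearMap.add_apply, map_neg, map_smul, LinearMap.neg_apply, LinearMap.smul_apply]
  rw [h3, map_neg, wg_anti y x]
  module

lemma rcob_e (i) : rcob (al i) (e i) = 0 := by
  rw [rcob, LinearMap.sub_apply, cob_e, hb_al, sub_self]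

/-- positive tensors of weight b -/
def PT (b : Q10) : Submodule ℚ (G ⊗[ℚ] G) :=
  Submodule.span ℚ {t | ∃ a c u v, 0 < a ∧ 0 < c ∧ a + c = b ∧ u ∈ R a ∧ v ∈ R c ∧ t = u ⊗ₜ[ℚ] v}

lemma tmul_PT {a c : Q10} (ha : 0 < a) (hc : 0 < c) {u v : G} (hu : u ∈ R a) (hv : v ∈ R c) :
    u ⊗ₜ[ℚ] v ∈ PT (a + c) :=
  Submodule.subset_span ⟨a, c, u, v, ha, hc, rfl, hu, hv, rfl⟩

lemma lie_PT {a b : Q10} (ha : 0 < a) {x : G} (hx : x ∈ R a) :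
    ∀ t ∈ PT b, ⁅x, t⁆ ∈ PT (a + b) := by
  intro t ht
  induction ht using Submodule.span_induction with
  | mem y hy =>
    obtain ⟨a', c, u, v, ha', hc, rfl, hu, hv, rfl⟩ := hy
    rw [TensorProduct.LieModule.lie_tmul_right]
    apply Submodule.add_mem
    · rw [← add_assoc]
      exact tmul_PT (add_pos ha ha') hc (lie_mem hx hu) hv
    · rw [add_left_comm]
      exact tmul_PT ha' (add_pos ha hc) hu (lie_mem hx hv)
  | zero => rw [lie_zero]; exact Submodule.zero_mem _
  | add y z _ _ hy hz => rw [lie_add]; exact Submodule.add_mem _ hy hz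
  | smul c y _ hy => rw [lie_smul]; exact Submodule.smul_mem _ c hy

lemma al_pos (i) : 0 < al i := by
  refine lt_of_le_of_ne (al_nonneg i) ?_
  intro h
  have := congrFun h i
  simp at this

lemma ww_pos (l j) : 0 < ww l j := by
  cases l with
  | nil => exact al_pos j
  | cons i l => exact add_pos_of_pos_of_nonneg (al_pos i) (ww_nonneg l j)

lemma rcob_word (l j) : rcob (ww l j) (ew l j) ∈ PT (ww l j) := by
  induction l with
  | nil => rw [ww, ew, rcob_e]; exact Submodule.zero_mem _
  | cons i l ih =>
    rw [ww, ew, rcob_lie (e_mem i) (ew_mem l j), rcob_e, lie_zero, sub_zero]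
    apply Submodule.sub_mem
    · exact lie_PT (al_pos i) (e_mem i) _ ih
    · apply Submodule.smul_mem
      rw [wg_apply]
      apply Submodule.sub_mem
      · exact tmul_PT (al_pos i) (ww_pos l j) (e_mem i) (ew_mem l j)
      · rw [add_comm]; exact tmul_PT (ww_pos l j) (al_pos i) (ew_mem l j) (e_mem i)

lemma ht_pos' {n : Q10} (hn : 0 < n) : 0 < ht n := ht_pos hn.le hn.ne'

lemma rcob_mem {b : Q10} (hb : 0 < b) : ∀ x ∈ R b, rcob b x ∈ PT b := by
  refine R_induction (ht_pos' hb) (p := fun x => rcob b x ∈ PT b) ?_ ?_ ?_ ?_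
  · rw [map_zero]; exact Submodule.zero_mem _
  · intro x y _ _ hx hy
    rw [map_add]; exact Submodule.add_mem _ hx hy
  · intro c x _ hx
    rw [map_smul]; exact Submodule.smul_mem _ c hx
  · rintro l j rfl
    exact rcob_word l j

/-- the bracket as a linear map -/
def br : G ⊗[ℚ] G →ₗ[ℚ] G := (LieModule.toModuleHom ℚ G G : G ⊗[ℚ] G →ₗ[ℚ] G)
lemma br_tmul (u v : G) : br (u ⊗ₜ[ℚ] v) = ⁅u, v⁆ := LieModule.toModuleHom_apply ℚ G G u v
lemma br_lie (x : G) (t : G ⊗[ℚ] G) : br ⁅x, t⁆ = ⁅x, br t⁆ :=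
  LieModuleHom.map_lie (LieModule.toModuleHom ℚ G G) x t

lemma br_cob_word (l j) : br (cob (ew l j)) = (4 * ht (ww l j) : ℚ) • ew l j := by
  induction l with
  | nil =>
    rw [ew, cob_e, wg_apply, map_sub, br_tmul, br_tmul, ← lie_skew (e j), G_rel.he, A_diag, ww, ht_al]
    push_cast; module
  | cons i l ih =>
    have hbase : br (cob (e i)) = (4 : ℚ) • e i := by
      rw [cob_e, wg_apply, map_sub, br_tmul, br_tmul, ← lie_skew (e i), G_rel.he, A_diag]
      push_cast; module
    rw [ew, cob_lie, map_sub, br_lie, br_lie, ih, hbase, ← lie_skew (ew l j), smul_lie, lie_smul,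
      ww, ht_add, ht_al]
    push_cast; module

lemma br_rcob {b : Q10} (hb' : 0 < b) : ∀ x ∈ R b,
    br (rcob b x) = (4 * ht b - 2 * bil b b : ℚ) • x := by
  have h1 : ∀ x ∈ R b, br (cob x) = (4 * ht b : ℚ) • x := by
    refine R_induction (ht_pos' hb') (p := fun x => br (cob x) = (4 * ht b : ℚ) • x) ?_ ?_ ?_ ?_
    · simp
    · intro x y _ _ hx hy
      rw [map_add, map_add, hx, hy, smul_add]
    · intro c x _ hx
      rw [map_smul, map_smul, hx, smul_comm]
    · rintro l j rfl
      exact br_cob_word l j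
  intro x hx
  rw [rcob, LinearMap.sub_apply, map_sub, h1 x hx, wg_apply, map_sub, br_tmul, br_tmul,
    ← lie_skew x, hb_lie b hx]
  module

end E10

/-! ## Structure constants -/

namespace E10
open scoped TensorProduct

lemma R_int : DirectSum.IsInternal R :=
  DirectSum.isInternal_submodule_of_iSupIndep_of_iSup_eq_top R_indep R_iSup

/-- Index type of the homogeneous basis. -/
abbrev IX := Σ n : Q10, Module.Basis.ofVectorSpaceIndex ℚ (R n)

noncomputable instance : DecidableEq IX := Classical.decEq _

def B : Module.Basis IX ℚ G := R_int.collectedBasis fun n => Module.Basis.ofVectorSpace ℚ (R n)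

lemma B_mem (s : IX) : B s ∈ R s.1 := R_int.collectedBasis_mem _ s

lemma B_ne {s : IX} {n : Q10} (hs : n ≠ s.1) {x : G} (hx : x ∈ R n) : B.repr x s = 0 := by
  rcases s with ⟨m, a⟩
  exact R_int.collectedBasis_repr_of_mem_ne _ hs hx

/-- Truncated positive index type. -/
abbrev IM (M : ℤ) := {s : IX // 0 < s.1 ∧ ht s.1 ≤ M}

lemma fin_wt (M : ℤ) : {n : Q10 | 0 < n ∧ ht n ≤ M}.Finite := by
  refine (Set.finite_Icc (0 : Q10) (fun _ => M)).subset ?_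
  rintro n ⟨h1, h2⟩
  refine ⟨h1.le, fun i => ?_⟩
  refine le_trans ?_ h2
  exact Finset.single_le_sum (f := n) (fun j _ => h1.le j) (Finset.mem_univ i)

lemma ofv_fin {n : Q10} (hn : 0 < n) : Finite (Module.Basis.ofVectorSpaceIndex ℚ (R n)) := by
  haveI := R_fin (ht_pos' hn)
  exact Module.Finite.finite_basis (Module.Basis.ofVectorSpace ℚ (R n))

instance IM_fin (M : ℤ) : Finite (IM M) := by
  haveI : Finite {n : Q10 // 0 < n ∧ ht n ≤ M} := (fin_wt M).to_subtype
  haveI : ∀ n : {n : Q10 // 0 < n ∧ ht n ≤ M}, Finite (Module.Basis.ofVectorSpaceIndex ℚ (R n.1)) :=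
    fun n => ofv_fin n.2.1
  refine Finite.of_injective (β := Σ n : {n : Q10 // 0 < n ∧ ht n ≤ M},
    Module.Basis.ofVectorSpaceIndex ℚ (R n.1)) (fun s => ⟨⟨s.1.1, s.2⟩, s.1.2⟩) ?_
  rintro ⟨⟨n, a⟩, h⟩ ⟨⟨m, b⟩, h'⟩ hh
  simp only [Sigma.mk.injEq, Subtype.mk.injEq] at hh
  obtain ⟨rfl, h2⟩ := hh
  simp only [heq_eq_eq] at h2
  subst h2; rfl

noncomputable instance IM_fintype (M : ℤ) : Fintype (IM M) := Fintype.ofFinite _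

lemma card_IM {M : ℤ} {n : Q10} (hn : 0 < n) (hM : ht n ≤ M) :
    Nat.card {s : IM M // s.1.1 = n} = rootMult E10M n := by
  have e1 : {s : IM M // s.1.1 = n} ≃ Module.Basis.ofVectorSpaceIndex ℚ (R n) :=
    { toFun := fun s => s.2 ▸ s.1.1.2
      invFun := fun a => ⟨⟨⟨n, a⟩, hn, hM⟩, rfl⟩
      left_inv := by rintro ⟨⟨⟨m, a⟩, h⟩, rfl⟩; rfl
      right_inv := fun a => rfl }
  rw [Nat.card_congr e1, rootMult]
  exact (Module.finrank_eq_nat_card_basis (Module.Basis.ofVectorSpace ℚ (R n))).symm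

/-- coordinates on tensors -/
def Xi (s t : IX) : G ⊗[ℚ] G →ₗ[ℚ] ℚ :=
  LinearMap.mul' ℚ ℚ ∘ₗ TensorProduct.map (B.coord s) (B.coord t)

lemma Xi_tmul (s t : IX) (u v : G) : Xi s t (u ⊗ₜ[ℚ] v) = B.repr u s * B.repr v t := by
  simp [Xi]

lemma expand {M : ℤ} {n : Q10} (hn : 0 < n) (hM : ht n ≤ M) {x : G} (hx : x ∈ R n) :
    x = ∑ i : IM M, B.repr x i.1 • B i.1 := by
  apply B.repr.injective
  ext s
  rw [map_sum, Finset.sum_apply']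
  simp only [map_smul, Module.Basis.repr_self, Finsupp.smul_apply, Finsupp.single_apply, smul_eq_mul]
  by_cases hs : 0 < s.1 ∧ ht s.1 ≤ M
  · rw [Finset.sum_eq_single (⟨s, hs⟩ : IM M)]
    · simp
    · intro b _ hb
      rw [if_neg, mul_zero]
      rintro rfl; exact hb rfl
    · simp
  · rw [Finset.sum_eq_zero]
    · apply B_ne _ hx
      rintro rfl; exact hs ⟨hn, hM⟩
    · intro b _
      rw [if_neg, mul_zero]
      rintro rfl; exact hs b.2

lemma expand2 {M : ℤ} {n : Q10} (hM : ht n ≤ M) : ∀ t ∈ PT n,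
    t = ∑ p : IM M, ∑ q : IM M, Xi p.1 q.1 t • (B p.1 ⊗ₜ[ℚ] B q.1) := by
  intro t ht'
  induction ht' using Submodule.span_induction with
  | mem y hy =>
    obtain ⟨a, c, u, v, ha, hc, rfl, hu, hv, rfl⟩ := hy
    rw [ht_add] at hM
    have h1 := ht_pos' ha
    have h2 := ht_pos' hc
    conv_lhs => rw [expand ha (by omega : ht a ≤ M) hu, expand hc (by omega : ht c ≤ M) hv]
    rw [TensorProduct.sum_tmul]
    refine Finset.sum_congr rfl fun p _ => ?_
    rw [TensorProduct.tmul_sum]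
    refine Finset.sum_congr rfl fun q _ => ?_
    rw [Xi_tmul, TensorProduct.smul_tmul_smul]
  | zero => simp
  | add y z _ _ hy hz =>
    conv_lhs => rw [hy, hz]
    rw [← Finset.sum_add_distrib]
    refine Finset.sum_congr rfl fun p _ => ?_
    rw [← Finset.sum_add_distrib]
    refine Finset.sum_congr rfl fun q _ => ?_
    rw [map_add, add_smul]
  | smul c y _ hy =>
    conv_lhs => rw [hy]
    rw [Finset.smul_sum]
    refine Finset.sum_congr rfl fun p _ => ?_
    rw [Finset.smul_sum]
    refine Finset.sum_congr rfl fun q _ => ?_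
    rw [map_smul, smul_smul, smul_eq_mul]

lemma Xi_zero {n : Q10} {s t : IX} (hst : n ≠ s.1 + t.1) : ∀ y ∈ PT n, Xi s t y = 0 := by
  intro y hy
  induction hy using Submodule.span_induction with
  | mem y hy =>
    obtain ⟨a, c, u, v, ha, hc, rfl, hu, hv, rfl⟩ := hy
    rw [Xi_tmul]
    by_cases h1 : a = s.1
    · have h2 : c ≠ t.1 := by rintro rfl; exact hst (by rw [h1])
      rw [B_ne h2 hv, mul_zero]
    · rw [B_ne h1 hu, zero_mul]
  | zero => simp
  | add y z _ _ hy hz => rw [map_add, hy, hz, add_zero]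
  | smul c y _ hy => rw [map_smul, hy, smul_zero]

/-- structure constants -/
def cc (i j k : IX) : ℚ := B.repr ⁅B i, B j⁆ k
/-- reduced costructure constants -/
def dd (k i j : IX) : ℚ := Xi i j (rcob k.1 (B k))

lemma dd_ne {k i j : IX} (hk : 0 < k.1) (h : dd k i j ≠ 0) : k.1 = i.1 + j.1 := by
  by_contra hne
  exact h (Xi_zero hne _ (rcob_mem hk _ (B_mem k)))

lemma cc_skew (i j k : IX) : cc i j k = - cc j i k := by
  rw [cc, ← lie_skew, map_neg]; rfl

lemma main2 (M : ℤ) (k : IM M) : ∑ i : IM M, ∑ j : IM M, dd k.1 i.1 j.1 * cc i.1 j.1 k.1 =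
    4 * ht k.1.1 - 2 * bil k.1.1 k.1.1 := by
  have h1 := br_rcob k.2.1 _ (B_mem k.1)
  rw [expand2 k.2.2 _ (rcob_mem k.2.1 _ (B_mem k.1))] at h1
  have h2 := congrArg (fun x => B.repr x k.1) h1
  simp only [map_sum, map_smul, br_tmul, Finset.sum_apply', Finsupp.smul_apply,
    Module.Basis.repr_self, Finsupp.single_eq_same, smul_eq_mul, mul_one] at h2
  exact h2

lemma main3 (M : ℤ) (i j : IM M) (hM : ht (i.1.1 + j.1.1) ≤ M) :
    ∑ k : IM M, cc i.1 j.1 k.1 * dd k.1 i.1 j.1 =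
      -2 * bil i.1.1 j.1.1 * (1 - if i = j then 1 else 0) +
      ∑ q : IM M, dd j.1 i.1 q.1 * cc i.1 q.1 j.1 + ∑ p : IM M, dd i.1 p.1 j.1 * cc p.1 j.1 i.1 := by
  have hpos : 0 < i.1.1 + j.1.1 := add_pos i.2.1 j.2.1
  have h1 := congrArg (Xi i.1 j.1) (rcob_lie (B_mem i.1) (B_mem j.1))
  have hL : Xi i.1 j.1 (rcob (i.1.1 + j.1.1) ⁅B i.1, B j.1⁆) =
      ∑ k : IM M, cc i.1 j.1 k.1 * dd k.1 i.1 j.1 := by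
    conv_lhs => rw [expand hpos hM (lie_mem (B_mem i.1) (B_mem j.1))]
    simp only [map_sum, map_smul, smul_eq_mul]
    refine Finset.sum_congr rfl fun k _ => ?_
    change cc i.1 j.1 k.1 * _ = _
    by_cases hk : i.1.1 + j.1.1 = k.1.1
    · rw [hk]; rfl
    · have : cc i.1 j.1 k.1 = 0 := B_ne hk (lie_mem (B_mem i.1) (B_mem j.1))
      rw [this]; simp
  rw [hL, map_sub, map_sub, map_smul] at h1
  have hR1 : Xi i.1 j.1 ⁅B i.1, rcob j.1.1 (B j.1)⁆ = ∑ q : IM M, dd j.1 i.1 q.1 * cc i.1 q.1 j.1 := by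
    conv_lhs => rw [expand2 j.2.2 _ (rcob_mem j.2.1 _ (B_mem j.1))]
    simp only [lie_sum, lie_smul, map_sum, map_smul, TensorProduct.LieModule.lie_tmul_right,
      map_add, Xi_tmul, Module.Basis.repr_self, smul_eq_mul, Finsupp.single_apply]
    change ∑ p : IM M, ∑ q : IM M, dd j.1 p.1 q.1 * (cc i.1 p.1 i.1 * _ + _ * cc i.1 q.1 j.1) = _
    rw [Finset.sum_eq_single i]
    · refine Finset.sum_congr rfl fun q _ => ?_
      by_cases hq : q.1 = j.1
      · have : dd j.1 i.1 q.1 = 0 := by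
          by_contra hne
          have := dd_ne j.2.1 hne
          rw [hq] at this
          exact i.2.1.ne' (right_eq_add.1 this)
        rw [this]; simp
      · rw [if_neg hq]; simp
    · intro p _ hp
      apply Finset.sum_eq_zero
      intro q _
      have hp' : p.1 ≠ i.1 := fun h => hp (Subtype.ext h)
      rw [if_neg hp']
      by_cases hq : q.1 = j.1
      · have : dd j.1 p.1 q.1 = 0 := by
          by_contra hne
          have := dd_ne j.2.1 hne
          rw [hq] at this
          exact p.2.1.ne' (right_eq_add.1 this)
        rw [this]; simp
      · rw [if_neg hq]; simp
    · simp
  have hR2 : Xi i.1 j.1 ⁅B j.1, rcob i.1.1 (B i.1)⁆ = - ∑ p : IM M, dd i.1 p.1 j.1 * cc p.1 j.1 i.1 := by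
    conv_lhs => rw [expand2 i.2.2 _ (rcob_mem i.2.1 _ (B_mem i.1))]
    simp only [lie_sum, lie_smul, map_sum, map_smul, TensorProduct.LieModule.lie_tmul_right,
      map_add, Xi_tmul, Module.Basis.repr_self, smul_eq_mul, Finsupp.single_apply]
    change ∑ p : IM M, ∑ q : IM M, dd i.1 p.1 q.1 * (cc j.1 p.1 i.1 * _ + _ * cc j.1 q.1 j.1) = _
    rw [← Finset.sum_neg_distrib]
    refine Finset.sum_congr rfl fun p _ => ?_
    have hz : ∀ q : IM M, dd i.1 p.1 q.1 * ((if p.1 = i.1 then (1:ℚ) else 0) * cc j.1 q.1 j.1) = 0 := by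
      intro q
      by_cases hp : p.1 = i.1
      · have : dd i.1 p.1 q.1 = 0 := by
          by_contra hne
          have := dd_ne i.2.1 hne
          rw [hp] at this
          exact q.2.1.ne' (left_eq_add.1 this)
        rw [this]; simp
      · rw [if_neg hp]; simp
    simp only [mul_add, hz, add_zero]
    rw [Finset.sum_eq_single j]
    · rw [if_pos rfl, cc_skew]; ring
    · intro q _ hq
      have hq' : q.1 ≠ j.1 := fun h => hq (Subtype.ext h)
      rw [if_neg hq']; simp
    · simp
  have hR3 : Xi i.1 j.1 (wg (B i.1) (B j.1)) = 1 - if i = j then 1 else 0 := by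
    rw [wg_apply, map_sub, Xi_tmul, Xi_tmul]
    simp only [Module.Basis.repr_self, Finsupp.single_apply]
    by_cases hij : i = j
    · subst hij; simp
    · have h' : i.1 ≠ j.1 := fun h => hij (Subtype.ext h)
      simp [hij, h', h'.symm]
  rw [hR1, hR2, hR3] at h1
  rw [h1, smul_eq_mul]; ring

end E10

/-! ## Trace recursion -/

namespace E10

/-- multiplicity as a rational number -/
def mu (n : Q10) : ℚ := (rootMult E10M n : ℚ)

lemma mu_nonneg (n : Q10) : 0 ≤ mu n := Nat.cast_nonneg _

def FF (M : ℤ) (i j : IM M) : ℚ := ∑ k : IM M, cc i.1 j.1 k.1 * dd k.1 i.1 j.1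

/-- trace of bracket after cobracket -/
def tau (M : ℤ) (a c : Q10) : ℚ :=
  (1/2) * ∑ i : IM M, ∑ j : IM M, if i.1.1 = a ∧ j.1.1 = c then FF M i j else 0

lemma tau_zero {M : ℤ} {a c : Q10} (hh : ¬ (0 < a ∧ 0 < c)) : tau M a c = 0 := by
  rw [tau]
  have : ∑ i : IM M, ∑ j : IM M, (if i.1.1 = a ∧ j.1.1 = c then FF M i j else 0) = 0 := by
    refine Finset.sum_eq_zero fun i _ => Finset.sum_eq_zero fun j _ => if_neg ?_
    rintro ⟨rfl, rfl⟩
    exact hh ⟨i.2.1, j.2.1⟩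
  rw [this, mul_zero]

lemma sum_wt {M : ℤ} {n : Q10} (hn : 0 < n) (hM : ht n ≤ M) :
    ∑ i : IM M, (if i.1.1 = n then (1:ℚ) else 0) = mu n := by
  rw [mu, ← card_IM hn hM, Nat.card_eq_fintype_card, Fintype.card_subtype]
  simp

lemma tau_sum {M : ℤ} {b : Q10} (hb : 0 < b) (hM : ht b ≤ M) :
    (2 * ht b - bil b b : ℚ) * mu b = ∑ a ∈ Finset.Ioo 0 b, tau M a (b - a) := by
  have h1 : ∑ k : IM M, (if k.1.1 = b then
      ∑ i : IM M, ∑ j : IM M, dd k.1 i.1 j.1 * cc i.1 j.1 k.1 else 0) =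
      (4 * ht b - 2 * bil b b : ℚ) * mu b := by
    rw [← sum_wt hb hM, Finset.mul_sum]
    refine Finset.sum_congr rfl fun k _ => ?_
    split_ifs with hk
    · rw [main2, hk]; ring
    · simp
  have h2 : ∑ k : IM M, (if k.1.1 = b then
      ∑ i : IM M, ∑ j : IM M, dd k.1 i.1 j.1 * cc i.1 j.1 k.1 else 0) =
      ∑ i : IM M, ∑ j : IM M, if i.1.1 + j.1.1 = b then FF M i j else 0 := by
    have : ∀ k : IM M, (if k.1.1 = b then
      ∑ i : IM M, ∑ j : IM M, dd k.1 i.1 j.1 * cc i.1 j.1 k.1 else 0) =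
      ∑ i : IM M, ∑ j : IM M, if i.1.1 + j.1.1 = b then cc i.1 j.1 k.1 * dd k.1 i.1 j.1 else 0 := by
      intro k
      split_ifs with hk
      · refine Finset.sum_congr rfl fun i _ => Finset.sum_congr rfl fun j _ => ?_
        split_ifs with hij
        · ring
        · have : dd k.1 i.1 j.1 = 0 := by
            by_contra hne
            exact hij (by rw [← dd_ne k.2.1 hne, hk])
          rw [this, zero_mul]
      · symm
        refine Finset.sum_eq_zero fun i _ => Finset.sum_eq_zero fun j _ => ?_
        split_ifs with hij
        · have : dd k.1 i.1 j.1 = 0 := by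
            by_contra hne
            exact hk (by rw [dd_ne k.2.1 hne, hij])
          rw [this, mul_zero]
        · rfl
    simp only [this]
    rw [Finset.sum_comm]
    refine Finset.sum_congr rfl fun i _ => ?_
    rw [Finset.sum_comm]
    refine Finset.sum_congr rfl fun j _ => ?_
    split_ifs with hij
    · rfl
    · simp
  have h3 : ∑ a ∈ Finset.Ioo 0 b, tau M a (b - a) =
      (1/2) * ∑ i : IM M, ∑ j : IM M, if i.1.1 + j.1.1 = b then FF M i j else 0 := by
    simp only [tau]
    rw [← Finset.mul_sum]
    congr 1
    rw [Finset.sum_comm]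
    refine Finset.sum_congr rfl fun i _ => ?_
    rw [Finset.sum_comm]
    refine Finset.sum_congr rfl fun j _ => ?_
    split_ifs with hij
    · rw [Finset.sum_eq_single i.1.1]
      · rw [if_pos ⟨rfl, by rw [← hij]; abel⟩]
      · rintro x _ hx
        rw [if_neg]; rintro ⟨h, _⟩; exact hx h.symm
      · intro h
        exfalso; apply h
        rw [Finset.mem_Ioo]
        exact ⟨i.2.1, by rw [← hij]; exact lt_add_of_pos_right _ j.2.1⟩
    · refine Finset.sum_eq_zero fun x _ => if_neg ?_
      rintro ⟨rfl, h⟩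
      exact hij (by rw [h]; abel)
  rw [h3, ← h2, h1]; ring

lemma tau_rec {M : ℤ} {a c : Q10} (ha : 0 < a) (hc : 0 < c) (hM : ht (a + c) ≤ M) :
    tau M a c = - (bil a c : ℚ) * (mu a * mu c - if a = c then mu a else 0) +
      tau M a (c - a) + tau M (a - c) c := by
  have hta := ht_pos' ha
  have htc := ht_pos' hc
  rw [ht_add] at hM
  have key : ∀ i j : IM M, (if i.1.1 = a ∧ j.1.1 = c then FF M i j else 0) =
      -2 * (bil a c : ℚ) * (((if i.1.1 = a then (1:ℚ) else 0) * (if j.1.1 = c then 1 else 0)) -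
        if a = c then (if i.1.1 = a then (if i = j then (1:ℚ) else 0) else 0) else 0) +
      (∑ q : IM M, if i.1.1 = a ∧ q.1.1 = c - a then dd j.1 i.1 q.1 * cc i.1 q.1 j.1 else 0) +
      (∑ p : IM M, if p.1.1 = a - c ∧ j.1.1 = c then dd i.1 p.1 j.1 * cc p.1 j.1 i.1 else 0) := by
    intro i j
    have hq : ∀ q : IM M, (if i.1.1 = a ∧ q.1.1 = c - a then dd j.1 i.1 q.1 * cc i.1 q.1 j.1 else 0) =
        if i.1.1 = a ∧ j.1.1 = c then dd j.1 i.1 q.1 * cc i.1 q.1 j.1 else 0 := by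
      intro q
      by_cases h0 : dd j.1 i.1 q.1 = 0
      · simp [h0]
      · have h1 := dd_ne j.2.1 h0
        refine if_congr ?_ rfl rfl
        refine and_congr_right fun hi => ?_
        rw [h1, hi]
        constructor
        · intro h; rw [h]; abel
        · intro h; rw [← h]; abel
    have hp : ∀ p : IM M, (if p.1.1 = a - c ∧ j.1.1 = c then dd i.1 p.1 j.1 * cc p.1 j.1 i.1 else 0) =
        if i.1.1 = a ∧ j.1.1 = c then dd i.1 p.1 j.1 * cc p.1 j.1 i.1 else 0 := by
      intro p
      by_cases h0 : dd i.1 p.1 j.1 = 0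
      · simp [h0]
      · have h1 := dd_ne i.2.1 h0
        refine if_congr ?_ rfl rfl
        refine and_congr_left fun hi => ?_
        rw [h1, hi]
        constructor
        · intro h; rw [h]; abel
        · intro h; rw [← h]; abel
    simp only [hq, hp]
    by_cases hi : i.1.1 = a
    · by_cases hj : j.1.1 = c
      · have := main3 M i j (by rw [hi, hj, ht_add]; exact hM)
        simp only [hi, hj, and_self, if_true]
        rw [FF, this, hi, hj]
        by_cases hij : i = j
        · have hac : a = c := by rw [← hi, ← hj, hij]
          subst hij; subst hac; simp
        · simp [hij]
      · have : i = j → a ≠ c := by rintro rfl h; exact hj (by rw [hi, h])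
        by_cases hij : i = j
        · simp [hi, hj, this hij]
        · simp [hi, hj, hij]
    · simp [hi]
  have hdiag : ∑ i : IM M, ∑ j : IM M,
      (if a = c then (if i.1.1 = a then (if i = j then (1:ℚ) else 0) else 0) else 0) =
      if a = c then mu a else 0 := by
    split_ifs with hac
    · rw [← sum_wt ha (by omega : ht a ≤ M)]
      refine Finset.sum_congr rfl fun i _ => ?_
      split_ifs <;> simp
    · simp
  have hprod : ∑ i : IM M, ∑ j : IM M,
      ((if i.1.1 = a then (1:ℚ) else 0) * (if j.1.1 = c then 1 else 0)) = mu a * mu c := by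
    rw [← sum_wt ha (by omega : ht a ≤ M), ← sum_wt hc (by omega : ht c ≤ M), Finset.sum_mul_sum]
  have hq : ∑ i : IM M, ∑ j : IM M,
      (∑ q : IM M, if i.1.1 = a ∧ q.1.1 = c - a then dd j.1 i.1 q.1 * cc i.1 q.1 j.1 else 0) =
      2 * tau M a (c - a) := by
    rw [tau]
    ring_nf
    refine Finset.sum_congr rfl fun i _ => ?_
    rw [Finset.sum_comm]
    refine Finset.sum_congr rfl fun q _ => ?_
    split_ifs with hh
    · rw [FF]; refine Finset.sum_congr rfl fun j _ => by ring
    · simp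
  have hp : ∑ i : IM M, ∑ j : IM M,
      (∑ p : IM M, if p.1.1 = a - c ∧ j.1.1 = c then dd i.1 p.1 j.1 * cc p.1 j.1 i.1 else 0) =
      2 * tau M (a - c) c := by
    rw [Finset.sum_comm]
    have : ∀ j : IM M, ∑ i : IM M, (∑ p : IM M, if p.1.1 = a - c ∧ j.1.1 = c then dd i.1 p.1 j.1 * cc p.1 j.1 i.1 else 0) =
      ∑ p : IM M, if p.1.1 = a - c ∧ j.1.1 = c then FF M p j else 0 := by
      intro j
      rw [Finset.sum_comm]
      refine Finset.sum_congr rfl fun p _ => ?_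
      split_ifs with hh
      · rw [FF]; refine Finset.sum_congr rfl fun j _ => by ring
      · simp
    simp only [this]
    rw [Finset.sum_comm, tau]; ring
  have : tau M a c = (1/2) * ∑ i : IM M, ∑ j : IM M, if i.1.1 = a ∧ j.1.1 = c then FF M i j else 0 := rfl
  rw [this]
  simp only [key]
  simp only [Finset.sum_add_distrib, hq, hp]
  simp only [← Finset.mul_sum (a := -2 * (bil a c : ℚ)), Finset.sum_sub_distrib, hdiag, hprod]
  ring

end E10

/-! ## Lattice facts -/

namespace E10

/-- the null root -/
def dl : Q10 := ![0, 1, 2, 3, 4, 5, 6, 4, 2, 3]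

/-- doubled orthogonal coordinates of the `E8` part -/
def dc (x : Q10) : Fin 8 → ℤ :=
  ![2 * (x 2 - 2 * x 1) - (x 8 - 2 * x 1),
    -2 * (x 2 - 2 * x 1) + 2 * (x 3 - 3 * x 1) - (x 8 - 2 * x 1),
    -2 * (x 3 - 3 * x 1) + 2 * (x 4 - 4 * x 1) - (x 8 - 2 * x 1),
    -2 * (x 4 - 4 * x 1) + 2 * (x 5 - 5 * x 1) - (x 8 - 2 * x 1),
    -2 * (x 5 - 5 * x 1) + 2 * (x 6 - 6 * x 1) - (x 8 - 2 * x 1),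
    -2 * (x 6 - 6 * x 1) + 2 * (x 7 - 4 * x 1) + 2 * (x 9 - 3 * x 1) - (x 8 - 2 * x 1),
    -2 * (x 7 - 4 * x 1) + 2 * (x 9 - 3 * x 1) + (x 8 - 2 * x 1),
    (x 8 - 2 * x 1)]

lemma sum8 {M : Type*} [AddCommMonoid M] (g : Fin 8 → M) : ∑ i, g i =
    g 0 + g 1 + g 2 + g 3 + g 4 + g 5 + g 6 + g 7 := by
  simp [Fin.sum_univ_succ, add_assoc]

def lv (x : Q10) : ℤ := x 0
def kk (x : Q10) : ℤ := x 1 - x 0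

lemma bil_coord (x y : Q10) : 4 * bil x y =
    ∑ i, dc x i * dc y i - 4 * lv x * kk y - 4 * lv y * kk x := by
  rw [bil, sum10, sum8, pr0, pr1, pr2, pr3, pr4, pr5, pr6, pr7, pr8, pr9]
  simp only [dc, lv, kk, Matrix.cons_val]
  ring

lemma lvl0 {x : Q10} (h : x 0 = 0) : 4 * bil x x = ∑ i, (dc x i) ^ 2 := by
  rw [bil_coord]; simp [lv, h, sq]

lemma lvl0_nonneg {x : Q10} (h : x 0 = 0) : 0 ≤ bil x x := by
  have := lvl0 h
  have : 0 ≤ ∑ i, (dc x i) ^ 2 := Finset.sum_nonneg fun i _ => sq_nonneg _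
  omega

lemma lvl0_zero {x : Q10} (h : x 0 = 0) (h2 : bil x x = 0) : x = x 1 • dl := by
  have h3 := lvl0 h
  rw [h2] at h3
  have h4 : ∀ i, dc x i = 0 := by
    intro i
    have := (Finset.sum_eq_zero_iff_of_nonneg (fun i _ => sq_nonneg (dc x i))).1 h3.symm i (Finset.mem_univ _)
    exact pow_eq_zero_iff (by norm_num) |>.1 this
  have h0 := h4 0
  have h1 := h4 1
  have h2 := h4 2
  have h3 := h4 3
  have h5 := h4 4
  have h6 := h4 5
  have h7 := h4 6
  have h8 := h4 7
  simp only [dc, Matrix.cons_val] at h0 h1 h2 h3 h5 h6 h7 h8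
  apply ext10 <;> simp [dl] <;> omega

lemma bil_even (x : Q10) : ∃ t, bil x x = 2 * t := by
  refine ⟨x 0 ^ 2 + x 1 ^ 2 + x 2 ^ 2 + x 3 ^ 2 + x 4 ^ 2 + x 5 ^ 2 + x 6 ^ 2 + x 7 ^ 2 + x 8 ^ 2 + x 9 ^ 2
    - x 0 * x 1 - x 1 * x 2 - x 2 * x 3 - x 3 * x 4 - x 4 * x 5 - x 5 * x 6 - x 6 * x 7 - x 7 * x 8
    - x 6 * x 9, ?_⟩
  rw [bil, sum10, pr0, pr1, pr2, pr3, pr4, pr5, pr6, pr7, pr8, pr9]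
  ring

lemma bil_smul_left (c : ℤ) (x y : Q10) : bil (c • x) y = c * bil x y := by
  simp only [bil, Finset.mul_sum, Pi.smul_apply, smul_eq_mul]
  exact Finset.sum_congr rfl fun i _ => by ring
lemma bil_smul_right (c : ℤ) (x y : Q10) : bil x (c • y) = c * bil x y := by
  rw [bil_comm, bil_smul_left, bil_comm]

lemma bil_dl (y : Q10) : bil dl y = - y 0 := by
  rw [bil, sum10, pr0, pr1, pr2, pr3, pr4, pr5, pr6, pr7, pr8, pr9]
  simp only [dl, Matrix.cons_val]
  ring

/-- fundamental antidominant weights -/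
def om : Fin 10 → Q10 :=
  ![![0, 1, 2, 3, 4, 5, 6, 4, 2, 3], ![1, 2, 4, 6, 8, 10, 12, 8, 4, 6],
    ![2, 4, 6, 9, 12, 15, 18, 12, 6, 9], ![3, 6, 9, 12, 16, 20, 24, 16, 8, 12],
    ![4, 8, 12, 16, 20, 25, 30, 20, 10, 15], ![5, 10, 15, 20, 25, 30, 36, 24, 12, 18],
    ![6, 12, 18, 24, 30, 36, 42, 28, 14, 21], ![4, 8, 12, 16, 20, 24, 28, 18, 9, 14],
    ![2, 4, 6, 8, 10, 12, 14, 9, 4, 7], ![3, 6, 9, 12, 15, 18, 21, 14, 7, 10]]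

lemma pr_om (i j : Fin 10) : pr i (om j) = if i = j then -1 else 0 := by
  revert i j; decide +kernel

lemma bil_om (y : Q10) (i : Fin 10) : bil y (om i) = - y i := by
  rw [bil]; simp [pr_om]

lemma om_pos (i : Fin 10) (hi : i ≠ 0) : 0 < om i 0 ∧ 0 < om i i := by
  revert i; decide +kernel

/-- vectors with a vanishing coordinate have non-negative norm -/
lemma norm_of_zero {y : Q10} {i : Fin 10} (hy : y i = 0) : 0 ≤ bil y y ∧ (bil y y = 0 → y = y 1 • dl) := by
  by_cases hi : i = 0
  · subst hi; exact ⟨lvl0_nonneg hy, lvl0_zero hy⟩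
  obtain ⟨h1, h2⟩ := om_pos i hi
  set z := om i 0 • y - y 0 • om i with hz
  have hz0 : z 0 = 0 := by simp [hz]; ring
  have h3 := lvl0_nonneg hz0
  have h4 : bil z z = (om i 0)^2 * bil y y - (y 0)^2 * om i i := by
    rw [hz]; simp only [bil_sub_left, bil_sub_right, bil_smul_left, bil_smul_right]
    rw [bil_comm (om i) y, bil_om, bil_om, hy]; ring
  rw [h4] at h3
  constructor
  · by_contra h; push Not at h
    nlinarith [sq_nonneg (y 0), mul_pos h1 h1, mul_nonneg (sq_nonneg (y 0)) h2.le]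
  · intro h
    rw [h] at h3
    have : y 0 = 0 := by
      by_contra h0
      have : 0 < (y 0)^2 := by positivity
      nlinarith [mul_pos this h2]
    exact lvl0_zero this h

/-- antidominant vectors -/
def AD (b : Q10) : Prop := ∀ i, pr i b ≤ 0

lemma AD_bil {b x : Q10} (hb : AD b) (hx : 0 ≤ x) : bil x b ≤ 0 :=
  Finset.sum_nonpos fun i _ => mul_nonpos_of_nonneg_of_nonpos (hx i) (hb i)

lemma AD_neg {x y : Q10} (hx : 0 ≤ x) (hy : 0 ≤ y) (h : AD (x + y)) : bil x y ≤ 0 := by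
  by_contra hc
  push Not at hc
  have h1 := AD_bil h hx
  have h2 := AD_bil h hy
  rw [bil_add_right] at h1 h2
  rw [bil_comm y x] at h2
  have hx0 : 0 < x 0 := lt_of_le_of_ne (hx 0) (by
    intro h0
    have := lvl0_nonneg h0.symm
    omega)
  have hy0 : 0 < y 0 := lt_of_le_of_ne (hy 0) (by
    intro h0
    have := lvl0_nonneg h0.symm
    omega)
  set z := y 0 • x - x 0 • y with hz
  have hz0 : z 0 = 0 := by simp [hz]; ring
  have h3 := lvl0_nonneg hz0
  have h4 : bil z z = (y 0)^2 * bil x x - 2 * (x 0 * y 0) * bil x y + (x 0)^2 * bil y y := by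
    rw [hz]; simp only [bil_sub_left, bil_sub_right, bil_smul_left, bil_smul_right]
    rw [bil_comm y x]; ring
  have h5 : 0 < x 0 * y 0 := mul_pos hx0 hy0
  have h6 : (y 0)^2 * bil x x ≤ 0 := mul_nonpos_of_nonneg_of_nonpos (sq_nonneg _) (by omega)
  have h7 : (x 0)^2 * bil y y ≤ 0 := mul_nonpos_of_nonneg_of_nonpos (sq_nonneg _) (by omega)
  nlinarith [mul_pos h5 hc]

lemma AD_neg' {x y : Q10} (hx : 0 ≤ x) (hy : 0 ≤ y) {a b : ℤ} (ha : 0 < a) (hb : 0 < b)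
    (h : AD (a • x + b • y)) : bil x y ≤ 0 := by
  have := AD_neg (smul_nonneg ha.le hx) (smul_nonneg hb.le hy) h
  rw [bil_smul_left, bil_smul_right] at this
  by_contra hc
  push Not at hc
  have := mul_pos ha (mul_pos hb hc)
  omega

lemma A_le (i j : Fin 10) (hij : i ≠ j) : E10M i j ≤ 0 := by
  rcases A_off i j hij with h | h <;> omega

/-- positive and negative parts -/
lemma pm_parts (x : Q10) : ∃ p m : Q10, 0 ≤ p ∧ 0 ≤ m ∧ x = p - m ∧ (∀ i, p i = 0 ∨ m i = 0) ∧
    bil p m ≤ 0 := by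
  have hd : ∀ i, x⁺ i = 0 ∨ x⁻ i = 0 := by
    intro i
    rw [Pi.posPart_apply, Pi.negPart_apply]
    rcases le_total (x i) 0 with h | h
    · left; exact posPart_eq_zero.2 h
    · right; exact negPart_eq_zero.2 h
  refine ⟨x⁺, x⁻, posPart_nonneg x, negPart_nonneg x, (posPart_sub_negPart x).symm, hd, ?_⟩
  refine Finset.sum_nonpos fun i _ => ?_
  rcases hd i with h | h
  · rw [h]; simp
  · refine mul_nonpos_of_nonneg_of_nonpos (posPart_nonneg x i) ?_
    refine Finset.sum_nonpos fun j _ => ?_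
    by_cases hij : i = j
    · subst hij; rw [h]; simp
    · exact mul_nonpos_of_nonpos_of_nonneg (A_le i j hij) (negPart_nonneg x j)

lemma dl_pos (i : Fin 10) (hi : i ≠ 0) : 0 < dl i := by
  revert i; decide +kernel

/-- (ii) -/
lemma nonneg_of_level {x : Q10} (h0 : 0 < x 0) (h2 : bil x x ≤ 2) : 0 ≤ x := by
  obtain ⟨p, m, hp, hm, hx, hd, hpm⟩ := pm_parts x
  have hx0 : x 0 = p 0 - m 0 := by rw [hx]; rfl
  have hm0 : m 0 = 0 := by
    rcases hd 0 with h | h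
    · have := hm 0
      simp only [Pi.zero_apply] at this
      omega
    · exact h
  by_cases hmz : m = 0
  · rw [hx, hmz, sub_zero]; exact hp
  exfalso
  obtain ⟨i, hi⟩ : ∃ i, m i ≠ 0 := by
    by_contra hc; push Not at hc; exact hmz (funext hc)
  have hi0 : i ≠ 0 := by rintro rfl; exact hi hm0
  have hpi : p i = 0 := (hd i).resolve_right hi
  obtain ⟨h3, h4⟩ := norm_of_zero hpi
  have h5 : bil p p ≠ 0 := by
    intro h
    have := h4 h
    have h6 := congrFun this 0
    simp [dl] at h6
    omega
  have h6 := lvl0_nonneg hm0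
  have h7 : bil x x = bil p p - 2 * bil p m + bil m m := by
    rw [hx]; simp only [bil_sub_left, bil_sub_right]; rw [bil_comm m p]; ring
  obtain ⟨t, ht⟩ := bil_even p
  have h8 : bil m m = 0 := by omega
  have h9 : bil p m = 0 := by omega
  have h10 := lvl0_zero hm0 h8
  rw [h10, bil_smul_right, bil_comm, bil_dl] at h9
  have h11 : m 1 = 0 := by
    rcases mul_eq_zero.1 h9 with h | h
    · exact h
    · omega
  rw [h11, zero_smul] at h10
  exact hmz h10

/-- (iii) -/
lemma sign_of_level0 {x : Q10} (h0 : x 0 = 0) (h2 : bil x x = 2) : 0 ≤ x ∨ x ≤ 0 := by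
  obtain ⟨p, m, hp, hm, hx, hd, hpm⟩ := pm_parts x
  have hx0 : x 0 = p 0 - m 0 := by rw [hx]; rfl
  have hm0 : m 0 = 0 := by rcases hd 0 with h | h <;> omega
  have hp0 : p 0 = 0 := by omega
  by_cases hmz : m = 0
  · left; rw [hx, hmz, sub_zero]; exact hp
  by_cases hpz : p = 0
  · right; rw [hx, hpz, zero_sub]; exact neg_nonpos.2 hm
  exfalso
  have key : ∀ p m : Q10, m 0 = 0 → p 0 = 0 → (∀ i, p i = 0 ∨ m i = 0) → p ≠ 0 → m ≠ 0 → bil p p ≠ 0 := by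
    intro p m hm0 hp0 hd hpz hmz h
    have h3 := lvl0_zero hp0 h
    apply hmz
    funext i
    by_cases hi : i = 0
    · subst hi; exact hm0
    refine (hd i).resolve_left ?_
    rw [h3]
    simp only [Pi.smul_apply, smul_eq_mul]
    refine mul_ne_zero ?_ (dl_pos i hi).ne'
    intro h4
    rw [h4, zero_smul] at h3
    exact hpz h3
  have h3 := key p m hm0 hp0 hd hpz hmz
  have h4 := key m p hp0 hm0 (fun i => (hd i).symm) hmz hpz
  have h5 := lvl0_nonneg hm0
  have h6 := lvl0_nonneg hp0
  have h7 : bil x x = bil p p - 2 * bil p m + bil m m := by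
    rw [hx]; simp only [bil_sub_left, bil_sub_right]; rw [bil_comm m p]; ring
  obtain ⟨t, ht⟩ := bil_even p
  obtain ⟨t', ht'⟩ := bil_even m
  omega

/-- (i) reflections -/
lemma refl_nonneg {n : Q10} {i : Fin 10} (hn : 0 ≤ n) (h2 : bil n n ≤ 2) (hp : 0 < pr i n)
    (hne : n ≠ al i) : 0 ≤ n - pr i n • al i := by
  set μ := n - pr i n • al i with hμ
  have hμj : ∀ j, j ≠ i → μ j = n j := by
    intro j hj; simp [hμ, hj]
  by_contra hc
  have hμi : μ i < 0 := by
    by_contra hh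
    push Not at hh
    apply hc
    intro j
    by_cases hj : j = i
    · subst hj; exact hh
    · rw [hμj j hj]; exact hn j
  set t := - μ i with ht
  set y := μ + t • al i with hy
  have hyi : y i = 0 := by simp [hy, ht]
  have hyj : ∀ j, j ≠ i → y j = n j := by
    intro j hj; rw [← hμj j hj]; simp [hy, hj]
  have hyp : pr i y ≤ 0 := by
    refine Finset.sum_nonpos fun j _ => ?_
    by_cases hj : j = i
    · subst hj; rw [hyi]; simp
    · rw [hyj j hj]; exact mul_nonpos_of_nonpos_of_nonneg (A_le i j (Ne.symm hj)) (hn j)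
  have hal : bil (al i) (al i) = 2 := by rw [bil_al, pr_al, A_diag]
  have hmm : bil μ μ = bil n n := by
    rw [hμ]; simp only [bil_sub_left, bil_sub_right, bil_smul_left, bil_smul_right, hal]
    rw [bil_comm n (al i), bil_al]; ring
  have hym : μ = y - t • al i := by rw [hy]; abel
  have h3 : bil μ μ = bil y y - 2 * t * pr i y + 2 * t * t := by
    rw [hym]; simp only [bil_sub_left, bil_sub_right, bil_smul_left, bil_smul_right, hal]
    rw [bil_comm y (al i), bil_al]; ring
  obtain ⟨h4, h5⟩ := norm_of_zero hyi
  have ht1 : 1 ≤ t := by omega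
  have h6 : 0 ≤ -(t * pr i y) := by
    have := mul_nonneg (by omega : 0 ≤ t) (by omega : 0 ≤ - pr i y)
    linarith
  have h7 : t = 1 := by nlinarith
  rw [h7] at h3 h6
  have h8 : bil y y = 0 := by omega
  have h9 : pr i y = 0 := by omega
  have h10 := h5 h8
  have hy1 : y 1 = 0 := by
    by_cases hi : i = 0
    · subst hi
      rw [pr0] at h9; omega
    · have h11 := congrFun h10 i
      rw [hyi] at h11
      simp only [Pi.smul_apply, smul_eq_mul] at h11
      rcases mul_eq_zero.1 h11.symm with h | h
      · exact h
      · exact absurd h (dl_pos i hi).ne'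
  rw [hy1, zero_smul] at h10
  have hμ' : μ = - al i := by rw [hym, h10, h7]; simp
  have hn' : n = (pr i n - 1) • al i := by
    have : n = μ + pr i n • al i := by rw [hμ]; abel
    rw [hμ'] at this
    rw [sub_smul, one_smul]; rw [← sub_eq_neg_add] at this; exact this
  have h12 : pr i n = 2 * (pr i n - 1) := by
    have := congrArg (bil (al i)) hn'
    rw [bil_smul_right, hal, bil_al] at this
    linarith
  have h13 : pr i n = 2 := by omega
  rw [h13] at hn'
  exact hne (by simpa using hn')

end E10

/-! ## Positivity of the traces -/

namespace E10

lemma mu_sq (n : Q10) : 0 ≤ mu n * mu n - mu n := by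
  rw [mu]
  rcases Nat.eq_zero_or_pos (rootMult E10M n) with h | h
  · rw [h]; simp
  · have : (1:ℚ) ≤ rootMult E10M n := by exact_mod_cast h
    nlinarith

lemma coef_nonneg (a c : Q10) : 0 ≤ mu a * mu c - if a = c then mu a else 0 := by
  split_ifs with h
  · subst h; exact mu_sq a
  · simpa using mul_nonneg (mu_nonneg a) (mu_nonneg c)

lemma tau_nonneg {M : ℤ} : ∀ (k : ℕ) {a c : Q10}, ht (a + c) ≤ k → ∀ {p q : ℤ}, 0 < p → 0 < q →
    AD (p • a + q • c) → ht (a + c) ≤ M → 0 ≤ tau M a c := by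
  intro k
  induction k with
  | zero =>
    intro a c h p q hp hq hAD hM
    by_cases hac : 0 < a ∧ 0 < c
    · exfalso
      have := ht_pos' hac.1
      have := ht_pos' hac.2
      rw [ht_add] at h; push_cast at h; omega
    · rw [tau_zero hac]
  | succ k ih =>
    intro a c h p q hp hq hAD hM
    by_cases hac : 0 < a ∧ 0 < c
    · obtain ⟨ha, hc⟩ := hac
      have h1 := ht_pos' ha
      have h2 := ht_pos' hc
      rw [tau_rec ha hc hM]
      have hneg := AD_neg' ha.le hc.le hp hq hAD
      rw [ht_add] at h hM
      push_cast at h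
      have t1 : 0 ≤ tau M a (c - a) := by
        refine ih (p := p + q) (q := q) ?_ (by omega) hq ?_ ?_
        · rw [ht_add, ht_sub]; omega
        · convert hAD using 1; module
        · rw [ht_add, ht_sub]; omega
      have t2 : 0 ≤ tau M (a - c) c := by
        refine ih (p := p) (q := p + q) ?_ hp (by omega) ?_ ?_
        · rw [ht_add, ht_sub]; omega
        · convert hAD using 1; module
        · rw [ht_add, ht_sub]; omega
      have t3 : 0 ≤ - (bil a c : ℚ) * (mu a * mu c - if a = c then mu a else 0) := by
        refine mul_nonneg ?_ (coef_nonneg a c)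
        have : (bil a c : ℚ) ≤ 0 := by exact_mod_cast hneg
        linarith
      linarith
    · rw [tau_zero hac]

lemma tau_nonneg' {M : ℤ} {a c : Q10} {p q : ℤ} (hp : 0 < p) (hq : 0 < q)
    (hAD : AD (p • a + q • c)) (hM : ht (a + c) ≤ M) : 0 ≤ tau M a c :=
  tau_nonneg (ht (a + c)).toNat (Int.self_le_toNat _) hp hq hAD hM

lemma tau_ge {M : ℤ} {a c : Q10} (ha : 0 < a) (hc : 0 < c) {p q : ℤ} (hp : 0 < p) (hq : 0 < q)
    (hAD : AD (p • a + q • c)) (hM : ht (a + c) ≤ M) :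
    - (bil a c : ℚ) * (mu a * mu c - if a = c then mu a else 0) + tau M a (c - a) ≤ tau M a c ∧
    - (bil a c : ℚ) * (mu a * mu c - if a = c then mu a else 0) + tau M (a - c) c ≤ tau M a c ∧
    - (bil a c : ℚ) * (mu a * mu c - if a = c then mu a else 0) ≤ tau M a c := by
  have h1 := ht_pos' ha
  have h2 := ht_pos' hc
  have hM' := hM
  rw [ht_add] at hM'
  have t1 : 0 ≤ tau M a (c - a) := by
    refine tau_nonneg' (p := p + q) (q := q) (by omega) hq ?_ ?_
    · convert hAD using 1; module
    · rw [ht_add, ht_sub]; omega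
  have t2 : 0 ≤ tau M (a - c) c := by
    refine tau_nonneg' (p := p) (q := p + q) hp (by omega) ?_ ?_
    · convert hAD using 1; module
    · rw [ht_add, ht_sub]; omega
  rw [tau_rec ha hc hM]
  refine ⟨?_, ?_, ?_⟩ <;> linarith

/-- multiplicity, cut to positive vectors -/
def mm (n : Q10) : ℚ := open scoped Classical in if 0 < n then mu n else 0

lemma mm_nonneg (n : Q10) : 0 ≤ mm n := by
  rw [mm]; split_ifs
  · exact mu_nonneg n
  · exact le_rfl

lemma mm_pos {n : Q10} (h : 0 < n) : mm n = mu n := if_pos h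
lemma mm_npos {n : Q10} (h : ¬ 0 < n) : mm n = 0 := if_neg h

lemma chain_aux {M : ℤ} {b x : Q10} (hb : AD b) (hM : ht b ≤ M) (hx : 0 < x) (hx0 : x 0 = 0) (hb0 : 0 < b 0)
    (C : ℕ) : ∀ c₀ : ℕ,
    ∑ c ∈ Finset.range C, -(bil x (b - ((c₀ + 1 + c : ℕ) : ℤ) • x) : ℚ) * mu x * mm (b - ((c₀ + 1 + c : ℕ) : ℤ) • x)
      ≤ tau M x (b - ((c₀ + 1 : ℕ) : ℤ) • x) ∧
    ∑ c ∈ Finset.range C, -(bil x (b - ((c₀ + 1 + c : ℕ) : ℤ) • x) : ℚ) * mu x * mm (b - ((c₀ + 1 + c : ℕ) : ℤ) • x)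
      ≤ tau M (b - ((c₀ + 1 : ℕ) : ℤ) • x) x := by
  have hxh := ht_pos' hx
  have hM2 : ∀ c : ℕ, ht (b - ((c + 1 : ℕ) : ℤ) • x) + ht x ≤ M := by
    intro c
    have : ht (((c + 1 : ℕ) : ℤ) • x) = (c + 1 : ℕ) * ht x := by simp [ht, Finset.mul_sum]
    rw [ht_sub, this]
    push_cast
    nlinarith [mul_nonneg (Int.natCast_nonneg c) hxh.le]
  have hA : ∀ c : ℕ, AD (((c + 1 : ℕ) : ℤ) • x + (1:ℤ) • (b - ((c + 1 : ℕ) : ℤ) • x)) := by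
    intro c; convert hb using 1; module
  have hA' : ∀ c : ℕ, AD ((1:ℤ) • (b - ((c + 1 : ℕ) : ℤ) • x) + ((c + 1 : ℕ) : ℤ) • x) := by
    intro c; convert hb using 1; module
  have hpos : ∀ c : ℕ, (0:ℤ) < ((c + 1 : ℕ) : ℤ) := fun c => by positivity
  have n1 : ∀ c : ℕ, 0 ≤ tau M x (b - ((c + 1 : ℕ) : ℤ) • x) := fun c =>
    tau_nonneg' (hpos c) one_pos (hA c) (by rw [ht_add]; linarith [hM2 c])
  have n2 : ∀ c : ℕ, 0 ≤ tau M (b - ((c + 1 : ℕ) : ℤ) • x) x := fun c =>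
    tau_nonneg' one_pos (hpos c) (hA' c) (by rw [ht_add]; linarith [hM2 c])
  induction C with
  | zero => intro c₀; simp only [Finset.range_zero, Finset.sum_empty]; exact ⟨n1 c₀, n2 c₀⟩
  | succ C ih =>
    intro c₀
    by_cases hp : 0 < b - ((c₀ + 1 : ℕ) : ℤ) • x
    · have hne : x ≠ b - ((c₀ + 1 : ℕ) : ℤ) • x := by
        intro h
        have := congrFun h 0
        simp [hx0] at this
        omega
      have g1 := (tau_ge (M := M) hx hp (hpos c₀) one_pos (hA c₀) (by rw [ht_add]; linarith [hM2 c₀])).1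
      have g2 := (tau_ge (M := M) hp hx one_pos (hpos c₀) (hA' c₀) (by rw [ht_add]; linarith [hM2 c₀])).2.1
      rw [if_neg hne] at g1
      rw [if_neg hne.symm, bil_comm _ x] at g2
      have e1 : b - ((c₀ + 1 : ℕ) : ℤ) • x - x = b - ((c₀ + 1 + 1 : ℕ) : ℤ) • x := by
        push_cast; module
      rw [e1] at g1 g2
      obtain ⟨i1, i2⟩ := ih (c₀ + 1)
      rw [Finset.sum_range_succ']
      have e2 : ∀ c, c₀ + 1 + (c + 1) = c₀ + 1 + 1 + c := fun c => by ring
      have e3 : c₀ + 1 + 0 = c₀ + 1 := rfl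
      rw [Finset.sum_congr rfl (fun c _ => by rw [e2 c]), e3, mm_pos hp]
      constructor <;> linarith
    · have hz : ∑ c ∈ Finset.range (C + 1), -(bil x (b - ((c₀ + 1 + c : ℕ) : ℤ) • x) : ℚ) * mu x *
          mm (b - ((c₀ + 1 + c : ℕ) : ℤ) • x) = 0 := by
        refine Finset.sum_eq_zero fun c _ => ?_
        rw [mm_npos, mul_zero]
        intro h
        apply hp
        refine lt_of_lt_of_le h ?_
        apply sub_le_sub_left
        exact smul_le_smul_of_nonneg_right (by push_cast; omega) hx.le
      rw [hz]
      exact ⟨n1 c₀, n2 c₀⟩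

/-! ## Reflections -/

def E (i : Fin 10) : Module.End ℚ G := LieAlgebra.ad ℚ G (e i)
lemma E_apply (i) (x : G) : E i x = ⁅e i, x⁆ := rfl

lemma E_mem (i) {n : Q10} {x : G} (hx : x ∈ R n) (m : ℕ) : (E i ^ m) x ∈ R (n + (m : ℤ) • al i) := by
  induction m with
  | zero => simpa using hx
  | succ m ih =>
    rw [pow_succ', Module.End.mul_apply, E_apply]
    have := lie_mem (e_mem i) ih
    have e1 : n + ((m + 1 : ℕ) : ℤ) • al i = al i + (n + (m : ℤ) • al i) := by
      rw [Nat.cast_succ, add_smul, one_smul]; abel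
    rw [e1]; exact this

lemma fE (i) {n : Q10} {x : G} (hx : x ∈ R n) (m : ℕ) :
    ⁅f i, (E i ^ (m + 1)) x⁆ = (E i ^ (m + 1)) ⁅f i, x⁆ - ((m + 1) * (m + pr i n) : ℚ) • (E i ^ m) x := by
  have hef : ∀ y : G, ⁅f i, ⁅e i, y⁆⁆ = ⁅e i, ⁅f i, y⁆⁆ - ⁅h i, y⁆ := by
    intro y
    have h1 : ⁅e i, f i⁆ = h i := G_rel.ef i
    rw [← h1, lie_lie]; abel
  induction m with
  | zero =>
    simp only [zero_add, pow_one, pow_zero, Module.End.one_apply, E_apply]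
    rw [hef, mem_R.1 hx i]; simp
  | succ m ih =>
    rw [pow_succ', Module.End.mul_apply, E_apply, hef, ih, mem_R.1 (E_mem i hx (m+1)) i]
    rw [lie_sub, lie_smul, ← E_apply, ← E_apply, ← Module.End.mul_apply, ← Module.End.mul_apply, ← pow_succ',
      ← pow_succ']
    have : (pr i (n + ((m + 1 : ℕ) : ℤ) • al i) : ℚ) = pr i n + 2 * (m + 1) := by
      rw [← bil_al, bil_add_right, bil_smul_right, bil_al, bil_al, pr_al, A_diag]
      push_cast; ring
    rw [this, sub_sub, ← add_smul]
    congr 2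
    push_cast; ring

lemma E_inj_aux (i) (N : ℕ) : ∀ (c : ℕ) (n : Q10) (x : G), x ∈ R n → pr i n = -(c : ℤ) →
    ((LieAlgebra.ad ℚ G (f i)) ^ N) x = 0 → (E i ^ c) x = 0 → x = 0 := by
  induction N with
  | zero => intro c n x _ _ h _; simpa using h
  | succ N ih =>
    intro c n x hx hc hN hE
    have hE1 : ∀ m, c ≤ m → (E i ^ m) x = 0 := by
      intro m hm
      obtain ⟨t, rfl⟩ := Nat.exists_eq_add_of_le hm
      rw [add_comm, pow_add, Module.End.mul_apply, hE, map_zero]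
    have hy : ⁅f i, x⁆ = 0 := by
      refine ih (c + 2) (-al i + n) _ (lie_mem (f_mem i) hx) ?_ ?_ ?_
      · rw [pr_add, pr_neg, pr_al, A_diag, hc]; push_cast; ring
      · rw [pow_succ, Module.End.mul_apply] at hN; exact hN
      · have := fE i hx (c + 1)
        rw [hE1 (c + 1 + 1) (by omega), hE1 (c + 1) (by omega)] at this
        simp only [lie_zero, smul_zero, sub_zero] at this
        exact this.symm
    have down : ∀ m, m ≤ c → (E i ^ m) x = 0 → x = 0 := by
      intro m
      induction m with
      | zero => intro _ h; simpa using h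
      | succ m ihm =>
        intro hm h
        apply ihm (by omega)
        have := fE i hx m
        rw [h, hy, lie_zero, map_zero, zero_sub, eq_comm, neg_eq_zero] at this
        refine (smul_eq_zero.1 this).resolve_left ?_
        rw [hc]
        push_cast
        refine mul_ne_zero (by positivity) ?_
        have : (m : ℚ) + 1 ≤ c := by exact_mod_cast hm
        intro h'; linarith
    exact down c le_rfl hE

lemma mult_refl {n : Q10} {i : Fin 10} (hn : 0 < n) (hp : 0 < pr i n)
    (hμ : 0 ≤ n - pr i n • al i) : mu (n - pr i n • al i) ≤ mu n := by
  set μ := n - pr i n • al i with hμd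
  obtain ⟨c, hc⟩ := Int.eq_ofNat_of_zero_le hp.le
  have hprμ : pr i μ = -(c : ℤ) := by
    rw [hμd, ← bil_al, bil_sub_right, bil_smul_right, bil_al, bil_al, pr_al, A_diag, hc]; ring
  have hnμ : n = μ + (c : ℤ) • al i := by rw [hμd, hc]; module
  haveI := R_fin (ht_pos' hn)
  have hinj : Function.Injective ((E i ^ c).restrict (p := R μ) (q := R n)
      (fun x hx => by have := E_mem i hx c; rwa [← hnμ] at this)) := by
    rw [injective_iff_map_eq_zero]
    rintro ⟨x, hx⟩ h0
    have h1 : (E i ^ c) x = 0 := congrArg Subtype.val h0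
    have hN : ∃ N : ℕ, ((LieAlgebra.ad ℚ G (f i)) ^ N) x = 0 := by
      refine ⟨(μ i).toNat + 1, ?_⟩
      have hm : ∀ N : ℕ, ((LieAlgebra.ad ℚ G (f i)) ^ N) x ∈ R (μ - (N : ℤ) • al i) := by
        intro N
        induction N with
        | zero => simpa using hx
        | succ N ih =>
          rw [pow_succ', Module.End.mul_apply]
          have := lie_mem (f_mem i) ih
          have e1 : μ - ((N + 1 : ℕ) : ℤ) • al i = -al i + (μ - (N : ℤ) • al i) := by
            rw [Nat.cast_succ, add_smul, one_smul]; abel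
          rw [e1]; exact this
      have h2 := hm ((μ i).toNat + 1)
      rw [R_bot] at h2
      · simpa using h2
      · intro h
        have := h i
        simp at this
      · intro h
        have hz : ∀ j, j ≠ i → μ j = 0 := by
          intro j hj
          have := h j
          simp [hj] at this
          exact le_antisymm this (hμ j)
        have : pr i μ = 2 * μ i := by
          rw [pr, Finset.sum_eq_single i]
          · rw [A_diag]
          · intro j _ hj; rw [hz j hj, mul_zero]
          · simp
        have h3 := hμ i
        simp only [Pi.zero_apply] at h3
        omega
    obtain ⟨N, hN⟩ := hN
    exact Subtype.ext (E_inj_aux i N c μ x hx hprμ hN h1)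
  have := LinearMap.finrank_le_finrank_of_injective hinj
  rw [mu, mu]
  exact_mod_cast this

end E10

/-! ### Coloured partitions -/
namespace E10

def nsum (n : ℕ) (f : ℕ → ℕ) : ℕ := Nat.rec 0 (fun i acc => acc + f i) n
def force {α : Type} (s : ℕ) (k : ℕ → α) : α := Nat.rec (k 0) (fun n _ => k (n+1)) s
def nall (n : ℕ) (f : ℕ → Bool) : Bool := Nat.rec true (fun i acc => f i && acc) n

lemma nsum_eq (n : ℕ) (f : ℕ → ℕ) : nsum n f = ∑ i ∈ Finset.range n, f i := by
  induction n with
  | zero => rfl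
  | succ n ih => rw [Finset.sum_range_succ, ← ih]; rfl

lemma force_eq {α : Type} (s : ℕ) (k : ℕ → α) : force s k = k s := by
  cases s <;> rfl

lemma nall_iff (n : ℕ) (f : ℕ → Bool) : nall n f = true ↔ ∀ i < n, f i = true := by
  induction n with
  | zero => simp [nall]
  | succ n ih =>
    have : nall (n+1) f = (f n && nall n f) := rfl
    rw [this, Bool.and_eq_true, ih]
    constructor
    · rintro ⟨h1, h2⟩ i hi
      rcases Nat.lt_succ_iff_lt_or_eq.1 hi with h | h
      · exact h2 i h
      · exact h ▸ h1
    · intro h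
      exact ⟨h n (by omega), fun i hi => h i (by omega)⟩

/-- packed table of the numbers of partitions in 8 colours -/
def ppack : ℕ := 37223414766337447426968036804045084049084064272556476427112778627690332544647588403522349360291334325526333600798114296820405192837327304165112066723775739790555876156198948165610734609411490896480661322208626436487696025272345631088181553276493304398814980249458598453807329111080911851791364655230637090095095357129495728887793789162002995601774443127494917356638435546333358977886208056729964296830389596608620186985860020481750379814878768594621634654393029512732274653252023526909914352327481102807875257163059769537028698121393881769190423125129637539368687011823238967359484687285059546922803230816902850652293253290721217917789104114067786205009348824986656486226648152771611127726284812005692437097102229089592107692861142506466654755026629302709182389280554694662325987750760894303356214885030177551865764150739388736656836685264861756720609054661083381718539537828584859621887730189168430457586256733304592321560616576660042416129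
def pt (n : ℕ) : ℕ := (ppack >>> (64*n)) % 2^64

lemma pt_big {n : ℕ} (h : 49 ≤ n) : pt n = 0 := by
  have h1 : ppack < 2 ^ (64 * 49) := by decide +kernel
  have h2 : ppack < 2 ^ (64 * n) := lt_of_lt_of_le h1 (Nat.pow_le_pow_right (by norm_num) (by omega))
  rw [pt, Nat.shiftRight_eq_div_pow, Nat.div_eq_of_lt h2, Nat.zero_mod]

abbrev Ty := ℕ+ × Fin 8

def wt (g : Ty →₀ ℕ) : ℕ := ∑ p ∈ g.support, (p.1 : ℕ) * g p

lemma wt_eq (g : Ty →₀ ℕ) (S : Finset Ty) (h : g.support ⊆ S) : wt g = ∑ p ∈ S, (p.1 : ℕ) * g p := by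
  rw [wt]
  refine Finset.sum_subset h fun x _ hx => ?_
  rw [Finsupp.notMem_support_iff.1 hx, mul_zero]

lemma wt_add (g g' : Ty →₀ ℕ) : wt (g + g') = wt g + wt g' := by
  classical
  rw [wt_eq (g+g') (g.support ∪ g'.support) Finsupp.support_add,
    wt_eq g (g.support ∪ g'.support) Finset.subset_union_left,
    wt_eq g' (g.support ∪ g'.support) Finset.subset_union_right, ← Finset.sum_add_distrib]
  exact Finset.sum_congr rfl fun p _ => by rw [Finsupp.add_apply, mul_add]

lemma wt_single (p : Ty) (i : ℕ) : wt (Finsupp.single p i) = p.1 * i := by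
  classical
  rw [wt_eq _ {p} Finsupp.support_single_subset]; simp

def TT (n : ℕ) : Finset Ty := ((Finset.range n).map ⟨Nat.succPNat, Nat.succPNat_injective⟩) ×ˢ Finset.univ

lemma mem_TT (n : ℕ) (p : Ty) : p ∈ TT n ↔ (p.1 : ℕ) ≤ n := by
  simp only [TT, Finset.mem_product, Finset.mem_map, Finset.mem_range, Finset.mem_univ, and_true,
    Function.Embedding.coeFn_mk]
  constructor
  · rintro ⟨a, ha, h⟩; rw [← h]; simp; omega
  · intro h
    refine ⟨(p.1 : ℕ) - 1, ?_, ?_⟩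
    · have := p.1.pos; omega
    · apply PNat.eq; have := p.1.pos; simp; omega

lemma le_wt (g : Ty →₀ ℕ) (p : Ty) : (p.1 : ℕ) * g p ≤ wt g := by
  by_cases h : p ∈ g.support
  · exact Finset.single_le_sum (f := fun p : Ty => (p.1 : ℕ) * g p) (fun _ _ => Nat.zero_le _) h
  · rw [Finsupp.notMem_support_iff.1 h]; simp

open Classical in
def FS (n : ℕ) : Finset (Ty →₀ ℕ) := ((TT n).finsupp (fun _ => Finset.range (n+1))).filter (fun g => wt g = n)

lemma supp_TT {g : Ty →₀ ℕ} {n : ℕ} (h : wt g = n) : g.support ⊆ TT n := by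
  intro p hp
  have h1 := le_wt g p
  have h2 : 0 < g p := Nat.pos_of_ne_zero (Finsupp.mem_support_iff.1 hp)
  rw [mem_TT]
  nlinarith [p.1.pos]

lemma apply_le {g : Ty →₀ ℕ} {n : ℕ} (h : wt g = n) (p : Ty) : g p ≤ n := by
  have h1 := le_wt g p
  nlinarith [p.1.pos]

lemma mem_FS (n : ℕ) (g : Ty →₀ ℕ) : g ∈ FS n ↔ wt g = n := by
  classical
  rw [FS, Finset.mem_filter, Finset.mem_finsupp_iff]
  constructor
  · exact fun h => h.2
  · intro h
    refine ⟨⟨supp_TT h, fun p _ => ?_⟩, h⟩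
    rw [Finset.mem_range]; have := apply_le h p; omega

lemma card_FS (n : ℕ) : coloredPartitions 8 (n : ℤ) = (FS n).card := by
  rw [coloredPartitions, if_neg (by omega), Int.toNat_natCast]
  rw [← Nat.card_eq_finsetCard]
  exact Nat.card_congr (Equiv.subtypeEquivRight fun g => by rw [mem_FS]; rfl)

lemma card_ge (n i : ℕ) (p : Ty) : ((FS n).filter (fun g => i ≤ g p)).card =
    if (p.1 : ℕ) * i ≤ n then (FS (n - p.1 * i)).card else 0 := by
  classical
  split_ifs with h
  · symm
    refine Finset.card_bij (fun g _ => g + Finsupp.single p i) ?_ ?_ ?_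
    · intro g hg
      rw [mem_FS] at hg
      rw [Finset.mem_filter, mem_FS, wt_add, wt_single, hg]
      simp; omega
    · intro g _ g' _ h; exact add_right_cancel h
    · intro g hg
      rw [Finset.mem_filter, mem_FS] at hg
      have h1 : g - Finsupp.single p i + Finsupp.single p i = g := by
        ext q
        simp only [Finsupp.add_apply, Finsupp.tsub_apply]
        by_cases hq : p = q
        · subst hq; simp; omega
        · simp [Finsupp.single_apply, hq]
      refine ⟨g - Finsupp.single p i, ?_, h1⟩
      rw [mem_FS]
      have h2 := wt_add (g - Finsupp.single p i) (Finsupp.single p i)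
      rw [h1, wt_single, hg.1] at h2
      omega
  · rw [Finset.card_eq_zero, Finset.filter_eq_empty_iff]
    intro g hg hi
    rw [mem_FS] at hg
    have := le_wt g p
    have := Nat.mul_le_mul_left (p.1 : ℕ) hi
    omega

lemma FS_rec (n : ℕ) : n * (FS n).card = ∑ j ∈ Finset.range n, ∑ i ∈ Finset.range n,
    if (j+1)*(i+1) ≤ n then 8*(j+1)*(FS (n-(j+1)*(i+1))).card else 0 := by
  classical
  have h1 : n * (FS n).card = ∑ g ∈ FS n, ∑ p ∈ TT n, (p.1 : ℕ) * g p := by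
    rw [mul_comm, ← smul_eq_mul, ← Finset.sum_const]
    refine Finset.sum_congr rfl fun g hg => ?_
    rw [mem_FS] at hg
    rw [← wt_eq g _ (supp_TT hg), hg]
  have h2 : ∀ g ∈ FS n, ∀ p, g p = ∑ i ∈ Finset.range n, if i + 1 ≤ g p then 1 else 0 := by
    intro g hg p
    rw [mem_FS] at hg
    have := apply_le hg p
    rw [← Finset.card_filter]
    have : (Finset.range n).filter (fun i => i + 1 ≤ g p) = Finset.range (g p) := by
      ext i; simp; omega
    rw [this, Finset.card_range]
  rw [h1, Finset.sum_comm]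
  have h3 : ∀ p : Ty, ∑ g ∈ FS n, (p.1 : ℕ) * g p = ∑ i ∈ Finset.range n,
      if (p.1 : ℕ)*(i+1) ≤ n then (p.1 : ℕ) * (FS (n - p.1*(i+1))).card else 0 := by
    intro p
    rw [← Finset.mul_sum, Finset.sum_congr rfl fun g hg => h2 g hg p, Finset.sum_comm, Finset.mul_sum]
    refine Finset.sum_congr rfl fun i _ => ?_
    rw [← Finset.card_filter, card_ge]
    split_ifs <;> simp
  rw [Finset.sum_congr rfl fun p _ => h3 p, TT, Finset.sum_product, Finset.sum_map]
  refine Finset.sum_congr rfl fun j _ => ?_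
  have h4 : ∀ y ∈ (Finset.univ : Finset (Fin 8)), (∑ i ∈ Finset.range n,
      if ((((⟨Nat.succPNat, Nat.succPNat_injective⟩ : ℕ ↪ ℕ+) j, y) : Ty).1 : ℕ)*(i+1) ≤ n then
        ((((⟨Nat.succPNat, Nat.succPNat_injective⟩ : ℕ ↪ ℕ+) j, y) : Ty).1 : ℕ) *
          (FS (n - (((⟨Nat.succPNat, Nat.succPNat_injective⟩ : ℕ ↪ ℕ+) j, y) : Ty).1*(i+1))).card else 0) =
      ∑ i ∈ Finset.range n, if (j+1)*(i+1) ≤ n then (j+1)*(FS (n-(j+1)*(i+1))).card else 0 :=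
    fun y _ => rfl
  rw [Finset.sum_congr rfl h4]
  rw [Finset.sum_const, Finset.card_univ, Fintype.card_fin, smul_eq_mul, Finset.mul_sum]
  refine Finset.sum_congr rfl fun i _ => ?_
  split_ifs <;> ring

def ptchk : Bool := nall 48 fun m => Nat.beq ((m+1) * pt (m+1)) (nsum (m+1) fun j => nsum ((m+1)/(j+1)) fun i =>
    8*(j+1)*pt (m+1-(j+1)*(i+1)))

set_option maxRecDepth 100000 in
lemma ptchk_true : ptchk = true := by decide +kernel

lemma FS_card {n : ℕ} (h : n ≤ 48) : (FS n).card = pt n := by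
  induction n using Nat.strong_induction_on with
  | _ n ih =>
  rcases n with _ | m
  · have : FS 0 = {0} := by
      ext g
      rw [mem_FS, Finset.mem_singleton]
      constructor
      · intro h
        ext p
        have := apply_le h p
        simpa using this
      · rintro rfl; rfl
    rw [this, Finset.card_singleton]
    decide +kernel
  · have h1 := FS_rec (m+1)
    have h2 := (nall_iff _ _).1 ptchk_true m (by omega)
    replace h2 := Nat.eq_of_beq_eq_true h2
    rw [nsum_eq] at h2
    have h3 : (m+1) * (FS (m+1)).card = (m+1) * pt (m+1) := by
      rw [h1, h2]
      refine Finset.sum_congr rfl fun j _ => ?_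
      rw [nsum_eq, ← Finset.sum_filter]
      have : (Finset.range (m+1)).filter (fun i => (j+1)*(i+1) ≤ m+1) = Finset.range ((m+1)/(j+1)) := by
        ext i
        rw [Finset.mem_filter, Finset.mem_range, Finset.mem_range, ← Nat.succ_le_iff (n := (m+1)/(j+1)),
          Nat.le_div_iff_mul_le (by omega), Nat.succ_eq_add_one, mul_comm (i+1)]
        constructor
        · exact fun h => h.2
        · intro h; refine ⟨?_, h⟩; nlinarith
      rw [this]
      refine Finset.sum_congr rfl fun i hi => ?_
      rw [ih _ _ (by omega)]
      have : 0 < (j+1)*(i+1) := by positivity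
      omega
    exact Nat.eq_of_mul_eq_mul_left (by omega) h3

def pp (n : ℤ) : ℕ := coloredPartitions 8 n

lemma pp_neg {n : ℤ} (h : n < 0) : pp n = 0 := by rw [pp, coloredPartitions, if_pos h]

lemma pp_eq {n : ℕ} (h : n ≤ 48) : pp n = pt n := by rw [pp, card_FS, FS_card h]

lemma pt_le (n : ℕ) : pt n ≤ pp n := by
  by_cases h : n ≤ 48
  · rw [pp_eq h]
  · rw [pt_big (by omega)]; exact Nat.zero_le _

lemma pp_zero : pp 0 = 1 := by
  have := pp_eq (n := 0) (by omega)
  rw [Nat.cast_zero] at this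
  rw [this]; decide +kernel
lemma pp_one : pp 1 = 8 := by
  have := pp_eq (n := 1) (by omega)
  rw [Nat.cast_one] at this
  rw [this]; decide +kernel

end E10

/-! ### Counting by Kronecker substitution -/
namespace E10

lemma low_lt {ι : Type*} (I : Finset ι) (e : ι → ℕ) {X : ℕ} (hI : I.card < X) (m : ℕ)
    (h : ∀ i ∈ I, e i < m) : ∑ i ∈ I, X ^ e i < X ^ m := by
  rcases m with _ | m
  · have : I = ∅ := Finset.eq_empty_of_forall_notMem fun i hi => by have := h i hi; omega
    subst this; simp
  · have hX : 0 < X := by omega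
    calc ∑ i ∈ I, X ^ e i ≤ ∑ i ∈ I, X ^ m :=
          Finset.sum_le_sum fun i hi => Nat.pow_le_pow_right hX (by have := h i hi; omega)
      _ = I.card * X ^ m := by rw [Finset.sum_const, smul_eq_mul]
      _ < X ^ (m+1) := by rw [pow_succ, mul_comm]; exact Nat.mul_lt_mul_of_pos_left hI (by positivity)

lemma slice {ι : Type*} (I : Finset ι) (e : ι → ℕ) {X : ℕ} (hI : I.card < X) (m w : ℕ) :
    (∑ i ∈ I, X ^ e i) / X ^ m % X ^ w = ∑ i ∈ I with (m ≤ e i ∧ e i < m + w), X ^ (e i - m) := by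
  classical
  have hX : 0 < X := by omega
  have hs : ∑ i ∈ I, X ^ e i = (∑ i ∈ I with e i < m, X ^ e i) +
      X ^ m * ((∑ i ∈ I with (m ≤ e i ∧ e i < m + w), X ^ (e i - m)) +
        X ^ w * ∑ i ∈ I with m + w ≤ e i, X ^ (e i - (m + w))) := by
    rw [mul_add, ← mul_assoc, ← pow_add, Finset.mul_sum, Finset.mul_sum, ← add_assoc]
    simp only [Finset.sum_filter]
    rw [← Finset.sum_add_distrib, ← Finset.sum_add_distrib]
    refine Finset.sum_congr rfl fun i _ => ?_
    by_cases h1 : e i < m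
    · rw [if_pos h1, if_neg (by omega), if_neg (by omega)]; rfl
    · by_cases h2 : e i < m + w
      · rw [if_neg h1, if_pos ⟨by omega, h2⟩, if_neg (by omega), zero_add, add_zero, ← pow_add]
        congr 1; omega
      · rw [if_neg h1, if_neg (by omega), if_pos (by omega), zero_add, zero_add, ← pow_add]
        congr 1; omega
  have h1 : (∑ i ∈ I with e i < m, X ^ e i) < X ^ m :=
    low_lt _ _ (lt_of_le_of_lt (Finset.card_filter_le _ _) hI) _ fun i hi => (Finset.mem_filter.1 hi).2
  have h2 : (∑ i ∈ I with (m ≤ e i ∧ e i < m + w), X ^ (e i - m)) < X ^ w :=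
    low_lt _ _ (lt_of_le_of_lt (Finset.card_filter_le _ _) hI) _ fun i hi => by
      have := (Finset.mem_filter.1 hi).2; omega
  rw [hs, Nat.add_mul_div_left _ _ (by positivity), Nat.div_eq_of_lt h1, zero_add,
    Nat.add_mul_mod_self_left, Nat.mod_eq_of_lt h2]

lemma digit {ι : Type*} (I : Finset ι) (e : ι → ℕ) {X : ℕ} (hI : I.card < X) (m : ℕ) :
    (∑ i ∈ I, X ^ e i) / X ^ m % X = (I.filter (fun i => e i = m)).card := by
  have := slice I e hI m 1
  rw [pow_one] at this
  rw [this, Finset.card_eq_sum_ones]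
  have h : I.filter (fun i => m ≤ e i ∧ e i < m + 1) = I.filter (fun i => e i = m) := by
    ext i; simp only [Finset.mem_filter]; constructor <;> rintro ⟨h1, h2⟩ <;> exact ⟨h1, by omega⟩
  rw [h]
  refine Finset.sum_congr rfl fun i hi => ?_
  rw [(Finset.mem_filter.1 hi).2, Nat.sub_self, pow_zero]

/-! numeric polynomials -/

def ex (p c : ℕ) : ℕ := c*c + (25-5*p) - (10-p)*c
def kf (p W u v c : ℕ) : ℕ := ex p c * W + c*u + (10-c)*v
def cA (p W u v : ℕ) : ℕ := nsum 5 fun j => 2^(20*kf p W u v (2*j))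
def cB (p W u v : ℕ) : ℕ := nsum 5 fun j => 2^(20*kf p W u v (2*j+1))

def stp (A B E O : ℕ) (k : ℕ → ℕ → ℕ) : ℕ :=
  force A fun A => force B fun B => force (E*A+O*B) fun E' => force (E*B+O*A) fun O' => k E' O'

lemma stp_eq (A B E O : ℕ) (k : ℕ → ℕ → ℕ) : stp A B E O k = k (E*A+O*B) (E*B+O*A) := by
  simp only [stp, force_eq]

def poly (p W u0 u1 u2 u3 u4 u5 u6 v6 u7 : ℕ) : ℕ :=
  stp (cA p W u0 0) (cB p W u0 0) 1 0 fun E O =>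
  stp (cA p W u1 0) (cB p W u1 0) E O fun E O =>
  stp (cA p W u2 0) (cB p W u2 0) E O fun E O =>
  stp (cA p W u3 0) (cB p W u3 0) E O fun E O =>
  stp (cA p W u4 0) (cB p W u4 0) E O fun E O =>
  stp (cA p W u5 0) (cB p W u5 0) E O fun E O =>
  stp (cA p W u6 v6) (cB p W u6 v6) E O fun E O =>
  force (cA p W u7 0) fun A => force (cB p W u7 0) fun B => E*A+O*B

lemma stp_spec (Q : ℕ → Prop) {A B E O : ℕ} {k : ℕ → ℕ → ℕ} {s d : ℤ}
    (h1 : (E : ℤ) + O = s) (h2 : (E : ℤ) - O = d)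
    (h : ∀ E' O' : ℕ, (E' : ℤ) + O' = s * (A + B) → (E' : ℤ) - O' = d * (A - B) → Q (k E' O')) :
    Q (stp A B E O k) := by
  rw [stp_eq]
  apply h <;> subst h1 h2 <;> push_cast <;> ring

lemma poly_prod (p W u0 u1 u2 u3 u4 u5 u6 v6 u7 : ℕ) (u v : Fin 8 → ℕ)
    (hu : u = ![u0, u1, u2, u3, u4, u5, u6, u7]) (hv : v = ![0, 0, 0, 0, 0, 0, v6, 0]) :
    2 * (poly p W u0 u1 u2 u3 u4 u5 u6 v6 u7 : ℤ) =
      ∏ i, ((cA p W (u i) (v i) : ℤ) + cB p W (u i) (v i)) +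
      ∏ i, ((cA p W (u i) (v i) : ℤ) - cB p W (u i) (v i)) := by
  have e1 : u 0 = u0 ∧ u 1 = u1 ∧ u 2 = u2 ∧ u 3 = u3 ∧ u 4 = u4 ∧ u 5 = u5 ∧ u 6 = u6 ∧ u 7 = u7 := by
    rw [hu]; exact ⟨rfl, rfl, rfl, rfl, rfl, rfl, rfl, rfl⟩
  have e2 : v 0 = 0 ∧ v 1 = 0 ∧ v 2 = 0 ∧ v 3 = 0 ∧ v 4 = 0 ∧ v 5 = 0 ∧ v 6 = v6 ∧ v 7 = 0 := by
    rw [hv]; exact ⟨rfl, rfl, rfl, rfl, rfl, rfl, rfl, rfl⟩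
  obtain ⟨a0, a1, a2, a3, a4, a5, a6, a7⟩ := e1
  obtain ⟨b0, b1, b2, b3, b4, b5, b6, b7⟩ := e2
  rw [Fin.prod_univ_eight, Fin.prod_univ_eight, a0, a1, a2, a3, a4, a5, a6, a7, b0, b1, b2, b3, b4, b5, b6, b7]
  rw [poly]
  rw [← one_mul ((cA p W u0 0 : ℤ) + cB p W u0 0), ← one_mul ((cA p W u0 0 : ℤ) - cB p W u0 0)]
  refine stp_spec (fun n => 2 * (n : ℤ) = _) (s := 1) (d := 1) (by simp) (by simp) fun E O h1 h2 => ?_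
  refine stp_spec (fun n => 2 * (n : ℤ) = _) h1 h2 fun E O h1 h2 => ?_
  refine stp_spec (fun n => 2 * (n : ℤ) = _) h1 h2 fun E O h1 h2 => ?_
  refine stp_spec (fun n => 2 * (n : ℤ) = _) h1 h2 fun E O h1 h2 => ?_
  refine stp_spec (fun n => 2 * (n : ℤ) = _) h1 h2 fun E O h1 h2 => ?_
  refine stp_spec (fun n => 2 * (n : ℤ) = _) h1 h2 fun E O h1 h2 => ?_
  refine stp_spec (fun n => 2 * (n : ℤ) = _) h1 h2 fun E O h1 h2 => ?_
  rw [← h1, ← h2, force_eq, force_eq]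
  push_cast
  ring

abbrev Ix := Fin 2 × (Fin 8 → Fin 10)

def evs : Finset (Fin 8 → Fin 10) := Finset.univ.filter fun c => Even (∑ i, (c i : ℕ))

lemma sum_plus (p W u v : ℕ) : (cA p W u v : ℤ) + cB p W u v =
    ∑ c : Fin 10, (2:ℤ)^(20*kf p W u v c) := by
  rw [cA, cB, nsum_eq, nsum_eq]
  simp only [Finset.sum_range_succ, Finset.sum_range_zero, Fin.sum_univ_succ]
  simp
  ring

lemma sum_minus (p W u v : ℕ) : (cA p W u v : ℤ) - cB p W u v =
    ∑ c : Fin 10, (-1)^(c:ℕ) * (2:ℤ)^(20*kf p W u v c) := by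
  rw [cA, cB, nsum_eq, nsum_eq]
  simp only [Finset.sum_range_succ, Finset.sum_range_zero, Fin.sum_univ_succ]
  simp
  ring

lemma poly_eq (p W u0 u1 u2 u3 u4 u5 u6 v6 u7 : ℕ) (u v : Fin 8 → ℕ)
    (hu : u = ![u0, u1, u2, u3, u4, u5, u6, u7]) (hv : v = ![0, 0, 0, 0, 0, 0, v6, 0]) :
    poly p W u0 u1 u2 u3 u4 u5 u6 v6 u7 =
      ∑ c ∈ evs, 2^(20 * ∑ i, kf p W (u i) (v i) (c i)) := by
  have h := poly_prod p W u0 u1 u2 u3 u4 u5 u6 v6 u7 u v hu hv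
  simp only [sum_plus, sum_minus] at h
  rw [Finset.prod_univ_sum, Finset.prod_univ_sum, ← Finset.sum_add_distrib] at h
  have h2 : (2:ℤ) * poly p W u0 u1 u2 u3 u4 u5 u6 v6 u7 =
      2 * ((∑ c ∈ evs, 2^(20 * ∑ i, kf p W (u i) (v i) (c i)) : ℕ) : ℤ) := by
    rw [h, evs, Finset.sum_filter, Fintype.piFinset_univ]
    push_cast
    rw [Finset.mul_sum]
    refine Finset.sum_congr rfl fun c _ => ?_
    rw [Finset.prod_mul_distrib, Finset.prod_pow_eq_pow_sum, Finset.prod_pow_eq_pow_sum, ← Finset.mul_sum]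
    split_ifs with he
    · rw [he.neg_one_pow]; push_cast; ring
    · rw [(Nat.not_even_iff_odd.1 he).neg_one_pow]; push_cast; ring
  have h3 := mul_left_cancel₀ (by norm_num) h2
  exact_mod_cast h3

end E10

/-! ### The lattice points counted by the generating number -/
namespace E10

def II : Finset Ix := Finset.univ ×ˢ evs

/-- doubled orthogonal coordinates of the vector with index `i` -/
def dv (i : Ix) (j : Fin 8) : ℤ := 2 * (i.2 j : ℤ) - 10 + (i.1 : ℤ)

def gv (i : Ix) (j : Fin 8) : ℤ := (i.2 j : ℤ) + (i.2 7 : ℤ) - 10 + (i.1 : ℤ)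

def nine (i : Ix) : ℤ := (∑ j, (i.2 j : ℤ)) / 2 - 20 + 2 * (i.1 : ℤ) + dv i 7

/-- the vector of the `E8` lattice with orthogonal coordinates `dv i / 2` -/
def rv (i : Ix) : Q10 :=
  ![0, 0, gv i 0, gv i 0 + gv i 1, gv i 0 + gv i 1 + gv i 2, gv i 0 + gv i 1 + gv i 2 + gv i 3,
    gv i 0 + gv i 1 + gv i 2 + gv i 3 + gv i 4, nine i - ((i.2 6 : ℤ) - (i.2 7 : ℤ)), dv i 7, nine i]

lemma mem_II {i : Ix} : i ∈ II ↔ Even (∑ j, (i.2 j : ℕ)) := by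
  simp [II, evs]

lemma II_even {i : Ix} (hi : i ∈ II) : ∃ t : ℤ, ∑ j, (i.2 j : ℤ) = 2 * t := by
  obtain ⟨t, ht⟩ := mem_II.1 hi
  refine ⟨t, ?_⟩
  have : ((∑ j, (i.2 j : ℕ) : ℕ) : ℤ) = ((t + t : ℕ) : ℤ) := by rw [ht]
  push_cast at this
  rw [this]; ring

lemma dc_rv {i : Ix} (hi : i ∈ II) (j : Fin 8) : dc (rv i) j = dv i j := by
  obtain ⟨t, ht⟩ := II_even hi
  have h9 : nine i = t - 20 + 2 * (i.1 : ℤ) + dv i 7 := by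
    rw [nine, ht]; congr 3; omega
  rw [sum8] at ht
  fin_cases j <;> simp only [dc, rv, Matrix.cons_val, h9, dv, gv] <;> simp <;> linarith

lemma dv_inj {i i' : Ix} (h : ∀ j, dv i j = dv i' j) : i = i' := by
  obtain ⟨p, c⟩ := i
  obtain ⟨p', c'⟩ := i'
  have h0 := h 0
  simp only [dv] at h h0
  have hp : p = p' := by
    apply Fin.ext; omega
  subst hp
  congr 1
  funext j
  have := h j
  apply Fin.ext; omega

lemma II_card : II.card < 2 ^ 40 := by
  refine lt_of_le_of_lt (Finset.card_le_univ _) ?_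
  simp

/-- half of the norm -/
def aa (i : Ix) : ℕ := (∑ j, ex i.1 (i.2 j)) / 2 + i.1

lemma ex_cast (i : Ix) (j : Fin 8) : 4 * (ex i.1 (i.2 j) : ℤ) = dv i j ^ 2 - (i.1 : ℤ) := by
  obtain ⟨p, c⟩ := i
  simp only [dv]
  generalize c j = x
  revert p x
  decide +kernel

lemma sum_dv_sq (i : Ix) : ∑ j, dv i j ^ 2 = 4 * ((∑ j, ex i.1 (i.2 j) : ℕ) : ℤ) + 8 * (i.1 : ℤ) := by
  push_cast
  rw [Finset.mul_sum]
  simp only [ex_cast]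
  rw [Finset.sum_sub_distrib]; simp

lemma rv0 (i : Ix) : rv i 0 = 0 := rfl
lemma rv1 (i : Ix) : rv i 1 = 0 := rfl

lemma ex_par {i : Ix} (hi : i ∈ II) : ∃ t, ∑ j, ex i.1 (i.2 j) = 2 * t := by
  obtain ⟨t, ht⟩ := bil_even (rv i)
  have h := lvl0 (rv0 i)
  simp only [dc_rv hi] at h
  rw [ht, sum_dv_sq] at h
  refine ⟨(t - i.1).toNat, ?_⟩
  omega

lemma two_aa {i : Ix} (hi : i ∈ II) : 2 * aa i = ∑ j, ex i.1 (i.2 j) + 2 * (i.1 : ℕ) := by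
  obtain ⟨t, ht⟩ := ex_par hi
  rw [aa, ht]; omega

lemma bil_rv {i : Ix} (hi : i ∈ II) : bil (rv i) (rv i) = 2 * (aa i : ℤ) := by
  have h := lvl0 (rv0 i)
  simp only [dc_rv hi] at h
  rw [sum_dv_sq] at h
  have := two_aa hi
  omega

lemma bil_rv_right {i : Ix} (hi : i ∈ II) (b : Q10) : 4 * bil (rv i) b = ∑ j, dv i j * dc b j := by
  rw [bil_coord]
  simp only [dc_rv hi, lv, kk, rv0, rv1]
  ring

/-- data attached to `b` -/
structure Dat (b : Q10) (u v : Fin 8 → ℕ) (h W Z : ℕ) : Prop where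
  hd : ∀ j, dc b j = (v j : ℤ) - u j
  hh : 2 * h = 5 * ∑ j, (u j + v j)
  hW : W = 2 * h + 1
  hZ : Z = ∑ c ∈ evs, 2^(20 * ∑ i, kf 0 W (u i) (v i) (c i)) +
    (∑ c ∈ evs, 2^(20 * ∑ i, kf 1 W (u i) (v i) (c i))) * 2^(20*(2*W+(∑ i, u i - ∑ i, v i)/2))
  hs : ∑ i, v i ≤ ∑ i, u i

lemma bb_bound {b : Q10} {u v : Fin 8 → ℕ} {h W Z : ℕ} (D : Dat b u v h W Z) {i : Ix} (hi : i ∈ II) :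
    -(h:ℤ) ≤ bil (rv i) b ∧ bil (rv i) b ≤ h := by
  have h1 := bil_rv_right hi b
  have h2 : |∑ j, dv i j * dc b j| ≤ ∑ j, 10 * ((u j : ℤ) + v j) := by
    refine (Finset.abs_sum_le_sum_abs _ _).trans (Finset.sum_le_sum fun j _ => ?_)
    rw [abs_mul]
    refine mul_le_mul ?_ ?_ (abs_nonneg _) (by norm_num)
    · rw [abs_le, dv]; have := (i.2 j).2; have := i.1.2; constructor <;> omega
    · rw [D.hd, abs_le]; constructor <;> omega
  rw [← h1, ← Finset.mul_sum] at h2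
  have h3 := D.hh
  have h4 : 2 * (h : ℤ) = 5 * ∑ j, ((u j : ℤ) + v j) := by exact_mod_cast h3
  rw [abs_le] at h2
  constructor <;> omega

def hgt (b : Q10) (h : ℕ) (i : Ix) : ℕ := ((h : ℤ) - bil (rv i) b).toNat

lemma hgt_cast {b : Q10} {u v : Fin 8 → ℕ} {h W Z : ℕ} (D : Dat b u v h W Z) {i : Ix} (hi : i ∈ II) :
    (hgt b h i : ℤ) = h - bil (rv i) b := by
  have := bb_bound D hi
  rw [hgt]; omega

lemma hgt_lt {b : Q10} {u v : Fin 8 → ℕ} {h W Z : ℕ} (D : Dat b u v h W Z) {i : Ix} (hi : i ∈ II) :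
    hgt b h i < W := by
  have := bb_bound D hi
  have := hgt_cast D hi
  have := D.hW
  omega

lemma kf_sum {b : Q10} {u v : Fin 8 → ℕ} {h W Z : ℕ} (D : Dat b u v h W Z) {i : Ix} (hi : i ∈ II) :
    ∑ j, kf i.1 W (u j) (v j) (i.2 j) + i.1 * (2*W+(∑ j, u j - ∑ j, v j)/2) =
      2 * (aa i * W + hgt b h i) := by
  have e1 : (((∑ j, u j - ∑ j, v j)/2 : ℕ) : ℤ) * 2 = ∑ j, (u j : ℤ) - ∑ j, (v j : ℤ) := by
    have h3 := D.hh
    have h5 := D.hs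
    rw [Finset.sum_add_distrib] at h3
    have : (((∑ j, u j - ∑ j, v j)/2 : ℕ)) * 2 + ∑ j, v j = ∑ j, u j := by omega
    have : ((((∑ j, u j - ∑ j, v j)/2 : ℕ)) : ℤ) * 2 + ∑ j, (v j : ℤ) = ∑ j, (u j : ℤ) := by
      exact_mod_cast this
    linarith
  generalize (∑ j, u j - ∑ j, v j)/2 = S at e1 ⊢
  have e2 : 2 * (aa i : ℤ) = ∑ j, (ex i.1 (i.2 j) : ℤ) + 2 * ((i.1 : ℕ) : ℤ) := by exact_mod_cast two_aa hi
  have e3 := hgt_cast D hi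
  have e4 := bil_rv_right hi b
  have e5 : 2 * (h : ℤ) = 5 * ∑ j, ((u j : ℤ) + v j) := by exact_mod_cast D.hh
  have e6 : ∀ j, 2 * (kf i.1 W (u j) (v j) (i.2 j) : ℤ) =
      2 * (ex i.1 (i.2 j) : ℤ) * W - dv i j * dc b j + 10 * ((u j : ℤ) + v j) - ((i.1 : ℕ) : ℤ) * (u j - v j) := by
    intro j
    rw [D.hd, kf, dv]
    have hc := (i.2 j).2
    push_cast [Nat.cast_sub (show (i.2 j : ℕ) ≤ 10 by omega)]
    ring
  have e7 : 2 * ∑ j, (kf i.1 W (u j) (v j) (i.2 j) : ℤ) =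
      2 * (∑ j, (ex i.1 (i.2 j) : ℤ)) * W - ∑ j, dv i j * dc b j + 10 * ∑ j, ((u j : ℤ) + v j)
        - ((i.1 : ℕ) : ℤ) * (∑ j, (u j : ℤ) - ∑ j, (v j : ℤ)) := by
    rw [Finset.mul_sum, Finset.sum_congr rfl fun j _ => e6 j]
    rw [Finset.sum_sub_distrib, Finset.sum_add_distrib, Finset.sum_sub_distrib, ← Finset.mul_sum,
      ← Finset.mul_sum, Finset.sum_sub_distrib, ← Finset.sum_mul, ← Finset.mul_sum]
  have goal : 2 * ((∑ j, kf i.1 W (u j) (v j) (i.2 j) + i.1 * (2*W+S) : ℕ) : ℤ) =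
      2 * ((2 * (aa i * W + hgt b h i) : ℕ) : ℤ) := by
    push_cast
    rw [mul_add, e7, e3, ← e4]
    linear_combination (-2 * (W:ℤ)) * e2 + ((i.1 : ℕ) : ℤ) * e1 - 2 * e5
  omega

lemma Z_eq {b : Q10} {u v : Fin 8 → ℕ} {h W Z : ℕ} (D : Dat b u v h W Z) :
    Z = ∑ i ∈ II, (2^40) ^ (aa i * W + hgt b h i) := by
  have key : ∀ i ∈ II, (2^40) ^ (aa i * W + hgt b h i) =
      2^(20 * ∑ j, kf i.1 W (u j) (v j) (i.2 j)) * 2^(20 * (i.1 * (2*W+(∑ j, u j - ∑ j, v j)/2))) := by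
    intro i hi
    rw [← pow_mul, ← pow_add, ← mul_add, kf_sum D hi]
    congr 1; ring
  rw [Finset.sum_congr rfl key, II, Finset.sum_product, Fin.sum_univ_two, D.hZ]
  refine congrArg₂ (· + ·) ?_ ?_
  · refine Finset.sum_congr rfl fun c _ => ?_
    simp
  · rw [Finset.sum_mul]
    refine Finset.sum_congr rfl fun c _ => ?_
    simp

lemma row {b : Q10} {u v : Fin 8 → ℕ} {h W Z : ℕ} (D : Dat b u v h W Z) (a : ℕ) :
    (Z >>> (40*a*W)) % 2^(40*W) = ∑ i ∈ II with aa i = a, (2^40) ^ (hgt b h i) := by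
  have h1 := slice II (fun i => aa i * W + hgt b h i) II_card (a * W) W
  rw [← Z_eq D] at h1
  rw [Nat.shiftRight_eq_div_pow, mul_assoc, pow_mul 2 40 (a * W), pow_mul 2 40 W, h1]
  have hf : II.filter (fun i => a * W ≤ aa i * W + hgt b h i ∧ aa i * W + hgt b h i < a * W + W) =
      II.filter (fun i => aa i = a) := by
    ext i
    simp only [Finset.mem_filter, and_congr_right_iff]
    intro hi
    have h2 := hgt_lt D hi
    constructor
    · rintro ⟨h3, h4⟩
      rcases lt_trichotomy (aa i) a with h5 | h5 | h5
      · have : (aa i + 1) * W ≤ a * W := Nat.mul_le_mul_right _ h5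
        rw [add_mul] at this; omega
      · exact h5
      · have : (a + 1) * W ≤ aa i * W := Nat.mul_le_mul_right _ h5
        rw [add_mul] at this; omega
    · rintro rfl; omega
  rw [hf]
  refine Finset.sum_congr rfl fun i hi => ?_
  rw [(Finset.mem_filter.1 hi).2, Nat.add_sub_cancel_left]

/-- number of lattice vectors of given norm and inner product with `b` -/
def cnt (b : Q10) (a : ℕ) (m : ℤ) : ℕ := (II.filter fun i => aa i = a ∧ bil (rv i) b = m).card

lemma cnt_eq {b : Q10} {u v : Fin 8 → ℕ} {h W Z : ℕ} (D : Dat b u v h W Z) (a s t : ℕ) :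
    ((((Z >>> (40*a*W)) % 2^(40*W)) <<< (40*s)) >>> (40*t)) % 2^40 = cnt b a ((h : ℤ) + s - t) := by
  rw [row D, Nat.shiftLeft_eq, Nat.shiftRight_eq_div_pow, Finset.sum_mul]
  have h1 : ∑ i ∈ II with aa i = a, (2^40) ^ (hgt b h i) * 2^(40*s) =
      ∑ i ∈ II with aa i = a, (2^40) ^ (hgt b h i + s) := by
    refine Finset.sum_congr rfl fun i _ => ?_
    rw [pow_mul, ← pow_add]
  rw [h1, pow_mul 2 40 t, digit _ _ (lt_of_le_of_lt (Finset.card_filter_le _ _) II_card), cnt,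
    Finset.filter_filter]
  congr 1
  ext i
  simp only [Finset.mem_filter, and_congr_right_iff]
  intro hi _
  have := hgt_cast D hi
  omega

end E10

/-! ### Lower bounds for the pieces of the trace formula -/
namespace E10

def ee : Q10 := ![1, 1, 2, 3, 4, 5, 6, 4, 2, 3]

def XX (l1 k1 : ℤ) (i : Ix) : Q10 := rv i + l1 • ee + k1 • dl

lemma XX_zero (l1 k1 : ℤ) (i : Ix) : XX l1 k1 i 0 = l1 := by
  have : XX l1 k1 i 0 = rv i 0 + l1 * 1 + k1 * 0 := rfl
  rw [this, rv0]; ring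
lemma XX_one (l1 k1 : ℤ) (i : Ix) : XX l1 k1 i 1 = l1 + k1 := by
  have : XX l1 k1 i 1 = rv i 1 + l1 * 1 + k1 * 1 := rfl
  rw [this, rv1]; ring

lemma bil_ee (y : Q10) : bil ee y = - kk y := by
  rw [bil, sum10, pr0, pr1, pr2, pr3, pr4, pr5, pr6, pr7, pr8, pr9]
  simp only [ee, kk, Matrix.cons_val]
  ring

lemma bil_XX (l1 k1 : ℤ) (i : Ix) (b : Q10) : bil (XX l1 k1 i) b = bil (rv i) b - l1 * kk b - k1 * b 0 := by
  rw [XX, bil_add_left, bil_add_left, bil_smul_left, bil_smul_left, bil_ee, bil_dl]; ring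

lemma bil_XX_self (l1 k1 : ℤ) {i : Ix} (hi : i ∈ II) : bil (XX l1 k1 i) (XX l1 k1 i) = 2 * aa i - 2 * l1 * k1 := by
  rw [bil_XX, bil_comm, bil_XX, bil_rv hi]
  simp only [kk, XX_one, XX_zero, rv0, rv1]; ring

lemma dc_dl (j : Fin 8) : dc dl j = 0 := by
  revert j; decide +kernel

lemma rv_inj {i i' : Ix} (hi : i ∈ II) (hi' : i' ∈ II) (h : rv i = rv i') : i = i' := by
  apply dv_inj
  intro j
  rw [← dc_rv hi, ← dc_rv hi', h]

lemma XX_inj {l1 k1 k2 : ℤ} {i i' : Ix} (hi : i ∈ II) (hi' : i' ∈ II) (h : XX l1 k1 i = XX l1 k2 i') :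
    k1 = k2 ∧ i = i' := by
  have h1 := congrFun h 1
  rw [XX_one, XX_one] at h1
  have h2 : k1 = k2 := by linarith
  subst h2
  refine ⟨rfl, rv_inj hi hi' ?_⟩
  simpa [XX] using h

/-! summation lemmas -/

lemma sum_inj {ι : Type*} (J : Finset ι) (S : Finset Q10) (x : ι → Q10) (f : ι → ℚ) (t : Q10 → ℚ)
    (hx : ∀ i ∈ J, ∀ j ∈ J, x i = x j → i = j) (ht : ∀ y ∈ S, 0 ≤ t y)
    (h1 : ∀ i ∈ J, x i ∈ S → f i ≤ t (x i)) (h2 : ∀ i ∈ J, x i ∉ S → f i ≤ 0) :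
    ∑ i ∈ J, f i ≤ ∑ y ∈ S, t y := by
  classical
  calc ∑ i ∈ J, f i ≤ ∑ i ∈ J, (if x i ∈ S then t (x i) else 0) := by
        refine Finset.sum_le_sum fun i hi => ?_
        split_ifs with h
        · exact h1 i hi h
        · exact h2 i hi h
    _ = ∑ i ∈ J with x i ∈ S, t (x i) := (Finset.sum_filter _ _).symm
    _ = ∑ y ∈ (J.filter fun i => x i ∈ S).image x, t y := by
        rw [Finset.sum_image]
        intro i hi j hj hij
        exact hx i (Finset.mem_filter.1 hi).1 j (Finset.mem_filter.1 hj).1 hij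
    _ ≤ ∑ y ∈ S, t y := by
        refine Finset.sum_le_sum_of_subset_of_nonneg ?_ fun y hy _ => ht y hy
        intro y hy
        obtain ⟨i, hi, rfl⟩ := Finset.mem_image.1 hy
        exact (Finset.mem_filter.1 hi).2

lemma sum_fib {ι : Type*} (J : Finset ι) (q : ι → ℤ) (w : ι → ℚ) (hw : ∀ i ∈ J, 0 ≤ w i) (n : ℕ) :
    ∑ a ∈ Finset.range n, ∑ i ∈ J with q i = a, w i ≤ ∑ i ∈ J, w i := by
  classical
  simp only [Finset.sum_filter]
  rw [Finset.sum_comm]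
  refine Finset.sum_le_sum fun i hi => ?_
  by_cases h : ∃ a ∈ Finset.range n, q i = a
  · obtain ⟨a, ha, hq⟩ := h
    rw [Finset.sum_eq_single a]
    · rw [if_pos hq]
    · intro c _ hc; rw [if_neg]; omega
    · intro h; exact absurd ha h
  · rw [Finset.sum_eq_zero]
    · exact hw i hi
    · intro a ha; rw [if_neg]; intro hq; exact h ⟨a, ha, hq⟩

lemma sum_cnt {ι : Type*} (J : Finset ι) (q : ι → ℤ) (w : ι → ℚ) (hw : ∀ i ∈ J, 0 ≤ w i) (n : ℕ) (F : ℕ → ℕ)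
    (h : ∀ a < n, ∀ i ∈ J, q i = a → (F a : ℚ) ≤ w i) :
    ∑ a ∈ Finset.range n, ((J.filter fun i => q i = a).card : ℚ) * F a ≤ ∑ i ∈ J, w i := by
  refine le_trans (Finset.sum_le_sum fun a ha => ?_) (sum_fib J q w hw n)
  rw [← nsmul_eq_mul, ← Finset.sum_const]
  refine Finset.sum_le_sum fun i hi => ?_
  rw [Finset.mem_filter] at hi
  exact h a (Finset.mem_range.1 ha) i hi.1 hi.2

structure Hyp (b : Q10) (l k al N : ℕ) : Prop where
  pos : 0 < b
  ad : AD b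
  hl : b 0 = l
  hl1 : 1 ≤ l
  hk : kk b = k
  hn : bil b b = 2 * al - 2 * l * k
  hN : (N : ℤ) = 1 + l * k - al
  ih : ∀ n, 0 < n → ht n < ht b → bil n n ≤ 2 → (pp (1 - bil n n / 2) : ℚ) ≤ mu n

section
variable {b : Q10} {l k al N : ℕ}

def tt (b y : Q10) : ℚ := tau (ht b) y (b - y)
def tr (b y : Q10) : ℚ := tau (ht b) (b - y) y

lemma tt_nonneg (H : Hyp b l k al N) (y : Q10) : 0 ≤ tt b y := by
  refine tau_nonneg' (p := 1) (q := 1) one_pos one_pos ?_ ?_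
  · simpa using H.ad
  · simp

lemma tr_nonneg (H : Hyp b l k al N) (y : Q10) : 0 ≤ tr b y := by
  refine tau_nonneg' (p := 1) (q := 1) one_pos one_pos ?_ ?_
  · simpa using H.ad
  · simp

lemma mem_Ioo' {b y : Q10} : y ∈ Finset.Ioo 0 b ↔ 0 < y ∧ 0 < b - y := by
  rw [Finset.mem_Ioo, sub_pos]

lemma tt_zero {y : Q10} (hy : y ∉ Finset.Ioo 0 b) : tt b y = 0 :=
  tau_zero fun h => hy (mem_Ioo'.2 h)

lemma tr_zero {y : Q10} (hy : y ∉ Finset.Ioo 0 b) : tr b y = 0 :=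
  tau_zero fun h => hy (mem_Ioo'.2 h.symm)

lemma pos_of_level {x : Q10} (h0 : 0 < x 0) (h2 : bil x x ≤ 2) : 0 < x := by
  refine lt_of_le_of_ne (nonneg_of_level h0 h2) ?_
  rintro rfl
  simp at h0

lemma ih_pt (H : Hyp b l k al N) {n : Q10} (h0 : 0 < n) (h1 : ht n < ht b) (m : ℕ) (h2 : bil n n = 2 - 2 * m) : (pt m : ℚ) ≤ mu n := by
  have := H.ih n h0 h1 (by omega)
  have e : 1 - bil n n / 2 = m := by omega
  rw [e] at this
  exact le_trans (by exact_mod_cast pt_le m) this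

lemma ht_smul (c : ℤ) (x : Q10) : ht (c • x) = c * ht x := by simp [ht, Finset.mul_sum]

lemma chain_gen (H : Hyp b l k al N) {x : Q10} (hx : 0 < x) (hx0 : x 0 = 0) (ν E m0 : ℕ) (hν : bil x x = 2 * ν)
    (hE : bil x b = - E) (hm0 : ht x < ht b → (m0 : ℚ) ≤ mu x) (C : ℕ) :
    ((∑ c ∈ Finset.range C, if (c+1)*E + ν*((c+1)*(c+1)) ≤ N then
      (2*ν*(c+1)+E) * m0 * pt (N - ((c+1)*E + ν*((c+1)*(c+1)))) else 0 : ℕ) : ℚ) ≤ tt b x ∧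
    ((∑ c ∈ Finset.range C, if (c+1)*E + ν*((c+1)*(c+1)) ≤ N then
      (2*ν*(c+1)+E) * m0 * pt (N - ((c+1)*E + ν*((c+1)*(c+1)))) else 0 : ℕ) : ℚ) ≤ tr b x := by
  have hb0 : 0 < b 0 := by rw [H.hl]; exact_mod_cast H.hl1
  have key := chain_aux H.ad (le_refl (ht b)) hx hx0 hb0 C 0
  have hle : ((∑ c ∈ Finset.range C, if (c+1)*E + ν*((c+1)*(c+1)) ≤ N then
      (2*ν*(c+1)+E) * m0 * pt (N - ((c+1)*E + ν*((c+1)*(c+1)))) else 0 : ℕ) : ℚ) ≤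
      ∑ c ∈ Finset.range C, -(bil x (b - ((0 + 1 + c : ℕ) : ℤ) • x) : ℚ) * mu x * mm (b - ((0 + 1 + c : ℕ) : ℤ) • x) := by
    rw [Nat.cast_sum]
    refine Finset.sum_le_sum fun c _ => ?_
    have hco : -(bil x (b - ((0 + 1 + c : ℕ) : ℤ) • x) : ℚ) = (2*ν*(c+1)+E : ℕ) := by
      rw [bil_sub_right, bil_smul_right, hE, hν]; push_cast; ring
    rw [hco]
    split_ifs with hc
    · obtain ⟨m, hm⟩ := Nat.exists_eq_add_of_le hc
      have hm' : (N : ℤ) = ((c+1)*E + ν*((c+1)*(c+1))) + m := by exact_mod_cast hm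
      have e1 : N - ((c+1)*E + ν*((c+1)*(c+1))) = m := by omega
      rw [e1]
      set z := b - ((0 + 1 + c : ℕ) : ℤ) • x with hz
      have hzz : bil z z = 2 - 2 * m := by
        rw [hz, bil_sub_left, bil_sub_right, bil_sub_right, bil_smul_left, bil_smul_right, bil_smul_right,
          bil_smul_left, bil_comm b x, hE, hν, H.hn]
        have := H.hN
        push_cast
        linear_combination (-2) * hm' + 2 * this
      have hz0 : z 0 = b 0 := by rw [hz]; simp [hx0]
      have hzp : 0 < z := pos_of_level (by rw [hz0]; exact hb0) (by omega)
      have hhz : ht z = ht b - (c + 1) * ht x := by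
        rw [hz, ht_sub, ht_smul]; push_cast; ring
      have p1 := ht_pos' hx
      have p2 := ht_pos' hzp
      have p3 : 0 ≤ (c : ℤ) * ht x := by positivity
      have q1 := hm0 (by nlinarith)
      have q2 := ih_pt H hzp (by nlinarith) m hzz
      rw [mm_pos hzp]
      push_cast
      refine mul_le_mul (mul_le_mul_of_nonneg_left q1 (by positivity)) q2 (by positivity) ?_
      exact mul_nonneg (by positivity) (mu_nonneg x)
    · rw [Nat.cast_zero]
      exact mul_nonneg (mul_nonneg (Nat.cast_nonneg _) (mu_nonneg x)) (mm_nonneg _)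
  have e2 : ((0 + 1 : ℕ) : ℤ) • x = x := by simp
  rw [e2] at key
  exact ⟨hle.trans key.1, hle.trans key.2⟩

end

def HN (N D : ℕ) : ℕ := nsum 6 fun c => if Nat.ble ((c+1)*D+(c+1)*(c+1)) N then
  (2*(c+1)+D)*pt (N-((c+1)*D+(c+1)*(c+1))) else 0

section
variable {b : Q10} {l k al N : ℕ}

lemma chain_real (H : Hyp b l k al N) {x : Q10} (hx : 0 < x) (hx0 : x 0 = 0) (E : ℕ) (hν : bil x x = 2)
    (hE : bil x b = - E) : (HN N E : ℚ) ≤ tt b x ∧ (HN N E : ℚ) ≤ tr b x := by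
  have := chain_gen H hx hx0 1 E 1 (by simpa using hν) hE (fun h => by
    have := H.ih x hx h (by omega)
    rw [hν] at this
    norm_num at this
    rw [pp_zero] at this
    exact_mod_cast this) 6
  have e : HN N E = ∑ c ∈ Finset.range 6, if (c+1)*E + 1*((c+1)*(c+1)) ≤ N then
      (2*1*(c+1)+E) * 1 * pt (N - ((c+1)*E + 1*((c+1)*(c+1)))) else 0 := by
    rw [HN, nsum_eq]
    refine Finset.sum_congr rfl fun c _ => ?_
    simp only [Nat.ble_eq, one_mul, mul_one]
  rw [e]
  exact this

/-! level zero -/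

def S0 (b : Q10) : Finset Q10 := (Finset.Ioo 0 b).filter fun y => y 0 = 0

lemma part_kk (H : Hyp b l k al N) (w : Q10 → ℚ) (hw : ∀ y, 0 ≤ w y) (hw0 : ∀ y, y ∉ Finset.Ioo 0 b → w y = 0)
    (hch : ∀ x, 0 < x → x 0 = 0 → ∀ E : ℕ, bil x x = 2 → bil x b = - E → (HN N E : ℚ) ≤ w x) (n : ℕ) :
    ∑ κ ∈ Finset.range n, ∑ D ∈ Finset.range N, (cnt b 1 (l * (κ + 1) - D) : ℚ) * HN N D ≤
      ∑ y ∈ (S0 b).filter (fun y => bil y y = 2 ∧ y 1 ≠ 0), w y := by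
  have h1 : ∀ κ ∈ Finset.range n, ∑ D ∈ Finset.range N, (cnt b 1 (l * (κ + 1) - D) : ℚ) * HN N D ≤
      ∑ i ∈ II with aa i = 1, w (XX 0 (κ + 1) i) := by
    intro κ _
    refine le_trans (le_of_eq ?_) (sum_cnt (II.filter fun i => aa i = 1) (fun i => l * (κ + 1) - bil (rv i) b)
      (fun i => w (XX 0 (κ + 1) i)) (fun i _ => hw _) N (HN N) ?_)
    · refine Finset.sum_congr rfl fun D _ => ?_
      rw [cnt, Finset.filter_filter]
      refine congrArg (fun n : ℕ => (n : ℚ) * HN N D) (congrArg Finset.card (Finset.filter_congr fun i _ => ?_))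
      constructor <;> rintro ⟨h, h'⟩ <;> exact ⟨h, by linarith⟩
    · intro D hD i hi hq
      obtain ⟨hi, ha⟩ := Finset.mem_filter.1 hi
      have hxx : bil (XX 0 (κ+1) i) (XX 0 (κ+1) i) = 2 := by
        rw [bil_XX_self _ _ hi, ha]; ring
      apply hch _ _ (XX_zero _ _ _) D hxx
      · rw [bil_XX, H.hl]
        linarith
      · have h1 : 0 < XX 0 (κ+1) i 1 := by rw [XX_one]; positivity
        rcases sign_of_level0 (XX_zero 0 (κ+1) i) hxx with h | h
        · refine lt_of_le_of_ne h ?_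
          intro h0; rw [← h0] at h1; simp at h1
        · have := h 1; simp at this; omega
  refine (Finset.sum_le_sum h1).trans ?_
  rw [← Finset.sum_product']
  refine sum_inj _ _ (fun p : ℕ × Ix => XX 0 (p.1 + 1) p.2) _ w ?_ (fun y _ => hw y) (fun _ _ _ => le_rfl) ?_
  · rintro ⟨κ, i⟩ h ⟨κ', i'⟩ h' he
    simp only [Finset.mem_product, Finset.mem_filter] at h h'
    obtain ⟨e1, e2⟩ := XX_inj h.2.1 h'.2.1 he
    rw [e2]; congr 1; omega
  · rintro ⟨κ, i⟩ h hn
    simp only [Finset.mem_product, Finset.mem_filter] at h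
    refine (hw0 _ fun hI => hn ?_).le
    simp only [S0, Finset.mem_filter]
    refine ⟨⟨hI, XX_zero _ _ _⟩, ?_, ?_⟩
    · rw [bil_XX_self _ _ h.2.1, h.2.2]; ring
    · rw [XX_one]; positivity

lemma part_jd (H : Hyp b l k al N) (w : Q10 → ℚ) (hw : ∀ y, 0 ≤ w y) (hw0 : ∀ y, y ∉ Finset.Ioo 0 b → w y = 0)
    (hch : ∀ j : ℕ, ((∑ c ∈ Finset.range N, if l*(j+1)*(c+1) ≤ N then 8*l*(j+1)*pt (N-l*(j+1)*(c+1)) else 0 : ℕ) : ℚ)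
      ≤ w ((j + 1 : ℤ) • dl)) :
    ((∑ j ∈ Finset.range N, ∑ c ∈ Finset.range N, if l*(j+1)*(c+1) ≤ N then 8*l*(j+1)*pt (N-l*(j+1)*(c+1)) else 0 : ℕ) : ℚ)
      ≤ ∑ y ∈ (S0 b).filter (fun y => bil y y = 0), w y := by
  rw [Nat.cast_sum]
  refine (Finset.sum_le_sum fun j _ => hch j).trans ?_
  refine sum_inj _ _ (fun j : ℕ => (j + 1 : ℤ) • dl) _ w ?_ (fun y _ => hw y) (fun _ _ _ => le_rfl) ?_
  · intro j _ j' _ he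
    have := congrFun he 1
    simp [dl] at this
    exact this
  · intro j _ hn
    refine (hw0 _ fun hI => hn ?_).le
    simp only [S0, Finset.mem_filter]
    refine ⟨⟨hI, by simp [dl]⟩, ?_⟩
    rw [bil_smul_left, bil_smul_right, bil_dl]; simp [dl]

lemma chain_jd (H : Hyp b l k al N) (j : ℕ) :
    ((∑ c ∈ Finset.range N, if l*(j+1)*(c+1) ≤ N then 8*l*(j+1)*pt (N-l*(j+1)*(c+1)) else 0 : ℕ) : ℚ)
      ≤ tt b ((j + 1 : ℤ) • dl) ∧
    ((∑ c ∈ Finset.range N, if l*(j+1)*(c+1) ≤ N then 8*l*(j+1)*pt (N-l*(j+1)*(c+1)) else 0 : ℕ) : ℚ)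
      ≤ tr b ((j + 1 : ℤ) • dl) := by
  have hd : bil ((j + 1 : ℤ) • dl) ((j + 1 : ℤ) • dl) = 0 := by
    rw [bil_smul_left, bil_smul_right, bil_dl]; simp [dl]
  have hx : 0 < ((j + 1 : ℤ) • dl) := by
    refine lt_of_le_of_ne (fun i => ?_) ?_
    · have : 0 ≤ dl i := by revert i; decide +kernel
      have h : 0 ≤ (j + 1 : ℤ) * dl i := by positivity
      simpa using h
    · intro h0
      have := congrFun h0 1
      simp [dl] at this
      omega
  have := chain_gen H hx (by simp [dl]) 0 (l * (j+1)) 8 (by simpa using hd)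
    (by rw [bil_smul_left, bil_dl, H.hl]; push_cast; ring) (fun h => by
    have := H.ih _ hx h (by omega)
    rw [hd] at this
    norm_num at this
    rw [pp_one] at this
    exact_mod_cast this) N
  have e : (∑ c ∈ Finset.range N, if l*(j+1)*(c+1) ≤ N then 8*l*(j+1)*pt (N-l*(j+1)*(c+1)) else 0) =
      ∑ c ∈ Finset.range N, if (c+1)*(l*(j+1)) + 0*((c+1)*(c+1)) ≤ N then
      (2*0*(c+1)+l*(j+1)) * 8 * pt (N - ((c+1)*(l*(j+1)) + 0*((c+1)*(c+1)))) else 0 := by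
    refine Finset.sum_congr rfl fun c _ => ?_
    rw [zero_mul, add_zero, mul_comm (c+1)]
    congr 1; ring
  rw [e]
  exact this

lemma part_zero (H : Hyp b l k al N) :
    ∑ D ∈ Finset.range N, ((if D = 0 then 0 else cnt b 1 D : ℕ) + cnt b 1 (-D) : ℚ) * HN N D ≤
      ∑ y ∈ (S0 b).filter (fun y => bil y y = 2 ∧ y 1 = 0), tt b y +
      ∑ y ∈ (S0 b).filter (fun y => bil y y = 2 ∧ y 1 = 0), tr b y := by
  haveI hdec : ∀ i : Ix, Decidable (0 < rv i) := fun _ => Classical.dec _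
  have hsgn : ∀ i ∈ II.filter (fun i => aa i = 1), 0 < rv i ∨ 0 < - rv i := by
    intro i hi
    obtain ⟨hi, ha⟩ := Finset.mem_filter.1 hi
    have h2 : bil (rv i) (rv i) = 2 := by rw [bil_rv hi, ha]; rfl
    have hne : rv i ≠ 0 := by intro h0; rw [h0] at h2; simp [bil] at h2
    rcases sign_of_level0 (rv0 i) h2 with h | h
    · left; exact lt_of_le_of_ne h hne.symm
    · right; rw [Left.neg_pos_iff]; exact lt_of_le_of_ne h hne
  set w : Ix → ℚ := fun i => if 0 < rv i then tt b (rv i) else tr b (- rv i) with hw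
  have hw0 : ∀ i, 0 ≤ w i := by
    intro i; simp only [hw]; split_ifs
    · exact tt_nonneg H _
    · exact tr_nonneg H _
  have h1 : ∑ D ∈ Finset.range N, ((if D = 0 then 0 else cnt b 1 D : ℕ) + cnt b 1 (-D) : ℚ) * HN N D ≤
      ∑ i ∈ II with aa i = 1, w i := by
    refine le_trans (le_of_eq ?_) (sum_cnt (II.filter fun i => aa i = 1) (fun i => |bil (rv i) b|) w
      (fun i _ => hw0 i) N (HN N) ?_)
    · refine Finset.sum_congr rfl fun D _ => ?_
      refine congrArg (fun n : ℚ => n * HN N D) ?_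
      suffices hh : (if D = 0 then 0 else cnt b 1 D) + cnt b 1 (-D) =
          ((II.filter fun i => aa i = 1).filter fun i => |bil (rv i) b| = D).card by
        rw [← hh, Nat.cast_add]
      rw [Finset.filter_filter]
      split_ifs with hD
      · subst hD; rw [zero_add, cnt]; refine congrArg Finset.card (Finset.filter_congr fun i _ => ?_); simp
      · rw [cnt, cnt, ← Finset.card_union_of_disjoint]
        · refine congrArg Finset.card ?_; ext i
          simp only [Finset.mem_union, Finset.mem_filter]
          rw [abs_eq (by positivity)]
          rw [← and_or_left, ← and_or_left]
        · rw [Finset.disjoint_filter]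
          rintro i _ ⟨_, h1⟩ ⟨_, h2⟩
          omega
    · intro D hD i hi hq
      have hs := hsgn i hi
      obtain ⟨hi, ha⟩ := Finset.mem_filter.1 hi
      have h2 : bil (rv i) (rv i) = 2 := by rw [bil_rv hi, ha]; rfl
      simp only [hw]
      split_ifs with hp
      · refine (chain_real H hp (rv0 i) D h2 ?_).1
        have := AD_bil H.ad hp.le
        rw [abs_of_nonpos this] at hq; linarith
      · have hm := hs.resolve_left hp
        refine (chain_real H hm (by simp [rv0]) D (by rw [bil_neg_left, bil_neg_right, h2]; rfl) ?_).2
        have := AD_bil H.ad hm.le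
        rw [bil_neg_left] at this ⊢
        rw [abs_of_nonneg (by linarith)] at hq; linarith
  refine h1.trans ?_
  simp only [hw]
  rw [Finset.sum_ite]
  refine add_le_add ?_ ?_
  · refine sum_inj _ _ rv _ (tt b) ?_ (fun y _ => tt_nonneg H y) (fun _ _ _ => le_rfl) ?_
    · intro i hi j hj
      simp only [Finset.mem_filter] at hi hj
      exact rv_inj hi.1.1 hj.1.1
    · intro i hi hn
      simp only [Finset.mem_filter] at hi
      refine (tt_zero fun hI => hn ?_).le
      simp only [S0, Finset.mem_filter]
      exact ⟨⟨hI, rv0 i⟩, by rw [bil_rv hi.1.1, hi.1.2]; rfl, rv1 i⟩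
  · refine sum_inj _ _ (fun i => - rv i) _ (tr b) ?_ (fun y _ => tr_nonneg H y) (fun _ _ _ => le_rfl) ?_
    · intro i hi j hj he
      simp only [Finset.mem_filter] at hi hj
      exact rv_inj hi.1.1 hj.1.1 (neg_injective he)
    · intro i hi hn
      simp only [Finset.mem_filter] at hi
      refine (tr_zero fun hI => hn ?_).le
      simp only [S0, Finset.mem_filter]
      exact ⟨⟨hI, by simp [rv0 i]⟩, by rw [bil_neg_left, bil_neg_right, bil_rv hi.1.1, hi.1.2]; rfl, by simp [rv1 i]⟩

end
end E10

/-! ### The middle levels and the numerical criterion -/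
namespace E10

section
variable {b : Q10} {l k al N : ℕ}

def pq (y : Q10) : ℕ := if bil y y ≤ 2 then pt (1 - bil y y / 2).toNat else 0

lemma pq_eq {y : Q10} (m : ℕ) (h : bil y y = 2 - 2 * m) : pq y = pt m := by
  rw [pq, if_pos (by omega)]; congr 1; omega

lemma pq_le (H : Hyp b l k al N) {y : Q10} (hy : y ∈ Finset.Ioo 0 b) : (pq y : ℚ) ≤ mu y := by
  obtain ⟨h1, h2⟩ := mem_Ioo'.1 hy
  rw [pq]
  split_ifs with h
  · obtain ⟨t, ht'⟩ := bil_even y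
    have hp := ht_pos' h2
    rw [ht_sub] at hp
    have h3 := ih_pt H h1 (by linarith) (1 - bil y y / 2).toNat (by omega)
    exact h3
  · rw [Nat.cast_zero]; exact mu_nonneg y

def gg (b y : Q10) : ℚ := -(bil y (b - y) : ℚ) * ((pq y : ℚ) * pq (b - y))

lemma neg_bil (H : Hyp b l k al N) {y : Q10} (hy : y ∈ Finset.Ioo 0 b) : bil y (b - y) ≤ 0 := by
  obtain ⟨h1, h2⟩ := mem_Ioo'.1 hy
  exact AD_neg h1.le h2.le (by simpa using H.ad)

lemma gg_nonneg (H : Hyp b l k al N) {y : Q10} (hy : y ∈ Finset.Ioo 0 b) : 0 ≤ gg b y := by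
  have h : (bil y (b - y) : ℚ) ≤ 0 := by exact_mod_cast neg_bil H hy
  rw [gg]
  exact mul_nonneg (by linarith) (by positivity)

lemma gg_symm (y : Q10) : gg b (b - y) = gg b y := by
  rw [gg, gg, sub_sub_cancel, bil_comm, mul_comm (pq y : ℚ)]

lemma sub_mem {y : Q10} (hy : y ∈ Finset.Ioo 0 b) : b - y ∈ Finset.Ioo 0 b := by
  rw [mem_Ioo'] at hy ⊢
  rw [sub_sub_cancel]; exact hy.symm

def corr (b y : Q10) : ℚ := if y = b - y then -(bil y y : ℚ) * pq y else 0

lemma tt_ge (H : Hyp b l k al N) {y : Q10} (hy : y ∈ Finset.Ioo 0 b) : gg b y - corr b y ≤ tt b y := by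
  obtain ⟨h1, h2⟩ := mem_Ioo'.1 hy
  have h3 := (tau_ge h1 h2 (p := 1) (q := 1) one_pos one_pos (by simpa using H.ad) (M := ht b) (by simp)).2.2
  refine le_trans ?_ h3
  have hb : (bil y (b - y) : ℚ) ≤ 0 := by exact_mod_cast neg_bil H hy
  have q1 := pq_le H hy
  have q2 := pq_le H (sub_mem hy)
  rw [gg, corr]
  split_ifs with h
  · rw [← h] at hb q2 ⊢
    have q3 : (0:ℚ) ≤ pq y := Nat.cast_nonneg _
    have key : (pq y : ℚ) * pq y - pq y ≤ mu y * mu y - mu y := by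
      rcases Nat.eq_zero_or_pos (pq y) with h0 | h0
      · rw [h0]; simpa using mu_sq y
      · have : (1:ℚ) ≤ pq y := by exact_mod_cast h0
        nlinarith
    have := mul_le_mul_of_nonneg_left key (show (0:ℚ) ≤ -(bil y y : ℚ) by linarith)
    linarith
  · rw [sub_zero, sub_zero]
    refine mul_le_mul_of_nonneg_left ?_ (by linarith)
    exact mul_le_mul q1 q2 (Nat.cast_nonneg _) (mu_nonneg y)

def GLv (b : Q10) (l1 : ℕ) : ℚ := ∑ y ∈ (Finset.Ioo (0:Q10) b).filter (fun y : Q10 => y 0 = (l1:ℤ)), gg b y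

lemma GLv_symm (H : Hyp b l k al N) {l1 l2 : ℕ} (h : l1 + l2 = l) : GLv b l1 = GLv b l2 := by
  have hl := H.hl
  have hh : (l1 : ℤ) + l2 = l := by exact_mod_cast h
  rw [GLv, GLv]
  refine Finset.sum_nbij' (fun y => b - y) (fun y => b - y) ?_ ?_ ?_ ?_ ?_
  · intro y hy
    rw [Finset.mem_filter] at hy ⊢
    exact ⟨sub_mem hy.1, by rw [Pi.sub_apply]; omega⟩
  · intro y hy
    rw [Finset.mem_filter] at hy ⊢
    exact ⟨sub_mem hy.1, by rw [Pi.sub_apply]; omega⟩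
  · intro y _; exact sub_sub_cancel b y
  · intro y _; exact sub_sub_cancel b y
  · intro y _; exact (gg_symm y).symm

end

def mid (Z W h al k N l1 l2 : ℕ) : ℕ :=
  nsum (k+3) fun κ => nsum (l1*κ+2-l1) fun a1 =>
    force (((Z >>> (40*a1*W)) % 2^(40*W)) <<< (40*(al+a1)) >>> (40*h)) fun R =>
    force (l1*κ+1-l1-a1) fun N1 => force (l2*(k+2-κ)+1-l2) fun M2 =>
    pt N1 * nsum (l2*(k+2-κ)+2-l2) fun a2 =>
      ((R >>> (40*a2)) % 2^40) * ((N+1-N1-(M2-a2)) * pt (M2-a2))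

lemma mid_eq {b : Q10} {u v : Fin 8 → ℕ} {h W Z : ℕ} (D : Dat b u v h W Z) (al k N l1 l2 : ℕ) :
    mid Z W h al k N l1 l2 = ∑ κ ∈ Finset.range (k+3), ∑ a1 ∈ Finset.range (l1*κ+2-l1),
      ∑ a2 ∈ Finset.range (l2*(k+2-κ)+2-l2), cnt b a1 ((al:ℤ) + a1 - a2) *
        (pt (l1*κ+1-l1-a1) * ((N+1-(l1*κ+1-l1-a1)-(l2*(k+2-κ)+1-l2-a2)) * pt (l2*(k+2-κ)+1-l2-a2))) := by
  rw [mid, nsum_eq]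
  refine Finset.sum_congr rfl fun κ _ => ?_
  rw [nsum_eq]
  refine Finset.sum_congr rfl fun a1 _ => ?_
  simp only [force_eq]
  rw [nsum_eq, Finset.mul_sum]
  refine Finset.sum_congr rfl fun a2 _ => ?_
  rw [← Nat.shiftRight_add, ← mul_add, cnt_eq D]
  have e : (h : ℤ) + (al + a1 : ℕ) - (h + a2 : ℕ) = al + a1 - a2 := by push_cast; ring
  rw [e]; ring

lemma mid_le {b : Q10} {u v : Fin 8 → ℕ} {h W Z l k al N : ℕ} (D : Dat b u v h W Z) (H : Hyp b l k al N)
    {l1 l2 : ℕ} (hl1 : 1 ≤ l1) (hl2 : 1 ≤ l2) (hll : l1 + l2 = l) :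
    (mid Z W h al k N l1 l2 : ℚ) ≤ GLv b l1 := by
  have hl := H.hl
  have hlz : (l1 : ℤ) + l2 = l := by exact_mod_cast hll
  haveI hdec : ∀ y : Q10, Decidable (y ∈ Finset.Ioo 0 b) := fun _ => Classical.dec _
  set w : ℕ → Ix → ℚ := fun κ i => if XX l1 ((κ:ℤ) - 1) i ∈ Finset.Ioo 0 b then gg b (XX l1 ((κ:ℤ) - 1) i) else 0 with hw
  have hw0 : ∀ κ i, 0 ≤ w κ i := by
    intro κ i; simp only [hw]; split_ifs with h
    · exact gg_nonneg H h
    · exact le_rfl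
  rw [mid_eq D, Nat.cast_sum]
  have h1 : ∀ κ ∈ Finset.range (k+3), ((∑ a1 ∈ Finset.range (l1*κ+2-l1),
      ∑ a2 ∈ Finset.range (l2*(k+2-κ)+2-l2), cnt b a1 ((al:ℤ) + a1 - a2) *
        (pt (l1*κ+1-l1-a1) * ((N+1-(l1*κ+1-l1-a1)-(l2*(k+2-κ)+1-l2-a2)) * pt (l2*(k+2-κ)+1-l2-a2))) : ℕ) : ℚ) ≤
      ∑ i ∈ II, w κ i := by
    intro κ hκ
    have hκ' : κ ≤ k + 2 := by have := Finset.mem_range.1 hκ; omega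
    rw [Nat.cast_sum]
    refine le_trans (Finset.sum_le_sum fun a1 ha1 => ?_)
      (sum_fib II (fun i => (aa i : ℤ)) (w κ) (fun i _ => hw0 κ i) (l1*κ+2-l1))
    rw [Nat.cast_sum]
    simp only [Nat.cast_mul (cnt _ _ _)]
    refine le_trans (le_of_eq ?_) (sum_cnt (II.filter fun i => (aa i : ℤ) = a1) (fun i => al + a1 - bil (rv i) b)
      (w κ) (fun i _ => hw0 κ i) (l2*(k+2-κ)+2-l2) (fun a2 => (pt (l1*κ+1-l1-a1) *
        ((N+1-(l1*κ+1-l1-a1)-(l2*(k+2-κ)+1-l2-a2)) * pt (l2*(k+2-κ)+1-l2-a2)))) ?_)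
    · refine Finset.sum_congr rfl fun a2 _ => ?_
      rw [cnt, Finset.filter_filter]
      refine congrArg (fun n : ℕ => (n : ℚ) * _) (congrArg Finset.card (Finset.filter_congr fun i _ => ?_))
      constructor <;> rintro ⟨h, h'⟩ <;> constructor <;> linarith
    · intro a2 ha2 i hi hq
      obtain ⟨hi, ha⟩ := Finset.mem_filter.1 hi
      rw [Finset.mem_range] at ha1
      obtain ⟨n1, hn1⟩ : ∃ n1, n1 + a1 + l1 = l1*κ+1 := ⟨l1*κ+1-l1-a1, by omega⟩
      obtain ⟨n2, hn2⟩ : ∃ n2, n2 + a2 + l2 = l2*(k+2-κ)+1 := ⟨l2*(k+2-κ)+1-l2-a2, by omega⟩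
      have e1 : l1*κ+1-l1-a1 = n1 := by omega
      have e2 : l2*(k+2-κ)+1-l2-a2 = n2 := by omega
      simp only [e1, e2]
      have z1 : (n1:ℤ) + a1 + l1 = l1*κ+1 := by exact_mod_cast hn1
      have z2 : (n2:ℤ) + a2 + l2 = l2*(k+2-κ)+1 := by
        have : (n2:ℤ) + a2 + l2 = l2*((k+2-κ : ℕ):ℤ)+1 := by exact_mod_cast hn2
        rw [this]; push_cast [Nat.cast_sub hκ']; ring
      set y := XX l1 ((κ:ℤ) - 1) i with hy
      have y1 : bil y y = 2 - 2 * n1 := by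
        rw [hy, bil_XX_self _ _ hi, ha]; linear_combination 2 * z1
      have y0 : y 0 = l1 := XX_zero _ _ _
      have yb : bil y b = bil (rv i) b - l1 * k - (κ - 1) * l := by
        rw [hy, bil_XX, H.hk, H.hl]
      have y2 : bil (b - y) (b - y) = 2 - 2 * n2 := by
        rw [bil_sub_left, bil_sub_right, bil_sub_right, bil_comm b y, y1, yb, H.hn]
        have q1 : (l:ℤ) = l1 + l2 := hlz.symm
        rw [q1]
        linear_combination 2 * hq + 2 * z2 - 2 * z1
      have yp : 0 < y := pos_of_level (by omega) (by omega)
      have zp : 0 < b - y := pos_of_level (by rw [Pi.sub_apply]; omega) (by omega)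
      have hyI : y ∈ Finset.Ioo 0 b := mem_Ioo'.2 ⟨yp, zp⟩
      have hwy : w κ i = gg b y := if_pos hyI
      rw [hwy, gg, pq_eq n1 y1, pq_eq n2 y2]
      have hneg := neg_bil H hyI
      have hyz : - bil y (b - y) = N + 1 - n1 - n2 := by
        have t1 : bil (b - y) (b - y) + bil y y + 2 * bil y (b - y) = bil b b := by
          rw [bil_sub_left, bil_sub_right, bil_sub_right, bil_comm b y]; ring
        rw [y1, y2, H.hn] at t1
        have := H.hN
        nlinarith
      have hc : ((N+1-n1-n2 : ℕ) : ℤ) = - bil y (b - y) := by omega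
      have hc' : ((N+1-n1-n2 : ℕ) : ℚ) = - (bil y (b - y) : ℚ) := by exact_mod_cast hc
      rw [← hc']
      push_cast
      apply le_of_eq; ring
  refine (Finset.sum_le_sum h1).trans ?_
  rw [← Finset.sum_product', GLv]
  refine sum_inj _ _ (fun p : ℕ × Ix => XX l1 ((p.1:ℤ) - 1) p.2) _ (gg b) ?_ ?_ ?_ ?_
  · rintro ⟨κ, i⟩ h ⟨κ', i'⟩ h' he
    rw [Finset.mem_product] at h h'
    obtain ⟨e1, e2⟩ := XX_inj h.2 h'.2 he
    simp only at e1 e2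
    rw [e2]; congr 1; omega
  · intro y hy; exact gg_nonneg H (Finset.mem_filter.1 hy).1
  · intro p _ hp; exact le_of_eq (if_pos (Finset.mem_filter.1 hp).1)
  · intro p _ hp
    refine le_of_eq (if_neg fun hI => hp ?_)
    rw [Finset.mem_filter]
    exact ⟨hI, XX_zero _ _ _⟩

lemma half_sum (G : ℕ → ℚ) (l : ℕ) (hl : l ≤ 8) (hG : ∀ i ≤ l, G i = G (l - i)) :
    ∑ i ∈ Finset.range (l/2), ((if 2*(i+1) = l then 1 else 2 : ℕ) : ℚ) * G (i+1) = ∑ a ∈ Finset.range (l-1), G (a+1) := by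
  have h1 := hG 1
  have h2 := hG 2
  have h3 := hG 3
  interval_cases l <;> simp [Finset.sum_range_succ] at * <;> linarith

def Sm (b : Q10) : Finset Q10 := (Finset.Ioo 0 b).filter fun y => y 0 ≠ 0 ∧ y 0 ≠ b 0

lemma corr_sum {b : Q10} {l k al N : ℕ} (H : Hyp b l k al N) (ev : Bool) (hev : ∀ y, b = y + y → ev = true) :
    ∑ y ∈ Sm b, corr b y ≤ ((if ev then (N-1)/2*pt (1+(N-1)/4) else 0 : ℕ) : ℚ) := by
  by_cases h : ∃ y ∈ Sm b, y = b - y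
  · obtain ⟨y, hy, hyb⟩ := h
    have hb : b = y + y := by rw [← sub_eq_iff_eq_add]; exact hyb.symm
    rw [Finset.sum_eq_single y]
    · rw [corr, if_pos hyb, if_pos (hev y hb)]
      obtain ⟨s, hs⟩ := bil_even y
      have h1 : bil b b = 8 * s := by
        rw [hb, bil_add_left, bil_add_right, hs]; ring
      have h2 := AD_bil H.ad H.pos.le
      have h3 := H.hn
      have h4 := H.hN
      have h5 : (N : ℤ) - 1 = -4 * s := by linarith
      have e1 : ((N-1)/2 : ℕ) = ((-2*s).toNat) := by omega
      rw [pq_eq (1+(N-1)/4) (by omega), hs]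
      apply le_of_eq
      have e2 : (((N-1)/2 : ℕ) : ℤ) = -(2 * s) := by omega
      have e3 : (((N-1)/2 : ℕ) : ℚ) = -((2 * s : ℤ) : ℚ) := by
        have e4 : ((((N-1)/2 : ℕ) : ℤ) : ℚ) = ((-(2 * s) : ℤ) : ℚ) := congrArg _ e2
        rw [Int.cast_neg] at e4; rw [← e4]; exact (Int.cast_natCast _).symm
      rw [Nat.cast_mul, e3]
    · intro y' _ hne
      rw [corr, if_neg]
      intro h
      apply hne
      funext j
      have a1 := congrFun h j
      have a2 := congrFun hyb j
      rw [Pi.sub_apply] at a1 a2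
      omega
    · intro h; exact absurd hy h
  · rw [Finset.sum_eq_zero]
    · exact Nat.cast_nonneg _
    · intro y hy; rw [corr, if_neg]; intro hh; exact h ⟨y, hy, hh⟩

lemma mid_total {b : Q10} {u v : Fin 8 → ℕ} {h W Z l k al N : ℕ} (D : Dat b u v h W Z) (H : Hyp b l k al N)
    (hl8 : l ≤ 8) :
    ((∑ i ∈ Finset.range (l/2), (if 2*(i+1) = l then 1 else 2) * mid Z W h al k N (i+1) (l-(i+1)) : ℕ) : ℚ) ≤
      ∑ y ∈ Sm b, gg b y := by
  have h1 : ((∑ i ∈ Finset.range (l/2), (if 2*(i+1) = l then 1 else 2) * mid Z W h al k N (i+1) (l-(i+1)) : ℕ) : ℚ) ≤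
      ∑ i ∈ Finset.range (l/2), ((if 2*(i+1) = l then 1 else 2 : ℕ) : ℚ) * GLv b (i+1) := by
    rw [Nat.cast_sum]
    refine Finset.sum_le_sum fun i hi => ?_
    rw [Finset.mem_range] at hi
    rw [Nat.cast_mul]
    exact mul_le_mul_of_nonneg_left (mid_le D H (by omega) (by omega) (by omega)) (Nat.cast_nonneg _)
  refine h1.trans ?_
  rw [half_sum (GLv b) l hl8 fun i hi => GLv_symm H (by omega)]
  have hgn : ∀ y ∈ Sm b, 0 ≤ gg b y := fun y hy => gg_nonneg H (Finset.mem_filter.1 hy).1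
  refine le_trans (le_of_eq ?_) (sum_fib (Sm b) (fun y => y 0 - 1) (gg b) hgn (l - 1))
  refine Finset.sum_congr rfl fun a ha => ?_
  rw [Finset.mem_range] at ha
  rw [GLv, Sm, Finset.filter_filter]
  refine Finset.sum_congr (Finset.filter_congr fun y _ => ?_) fun _ _ => rfl
  have := H.hl
  push_cast
  constructor
  · intro hh; omega
  · rintro ⟨_, hh⟩; omega

lemma split_levels {b : Q10} (w : Q10 → ℚ) (hw : ∀ y, 0 ≤ w y) :
    ∑ y ∈ (S0 b).filter (fun y => bil y y = 2 ∧ y 1 = 0), w y +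
    ∑ y ∈ (S0 b).filter (fun y => bil y y = 2 ∧ y 1 ≠ 0), w y +
    ∑ y ∈ (S0 b).filter (fun y => bil y y = 0), w y ≤ ∑ y ∈ S0 b, w y := by
  simp only [Finset.sum_filter]
  rw [← Finset.sum_add_distrib, ← Finset.sum_add_distrib]
  refine Finset.sum_le_sum fun y _ => ?_
  have := hw y
  split_ifs <;> first | linarith | (exfalso; omega)

lemma total_split {b : Q10} (hb0 : 0 < b 0) :
    ∑ y ∈ Finset.Ioo 0 b, tt b y = ∑ y ∈ S0 b, tt b y + ∑ y ∈ S0 b, tr b y + ∑ y ∈ Sm b, tt b y := by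
  have h1 : ∑ y ∈ S0 b, tr b y = ∑ y ∈ Finset.Ioo 0 b with y 0 = b 0, tt b y := by
    rw [S0]
    refine Finset.sum_nbij' (fun y => b - y) (fun y => b - y) ?_ ?_ ?_ ?_ ?_
    · intro y hy
      rw [Finset.mem_filter] at hy ⊢
      exact ⟨sub_mem hy.1, by rw [Pi.sub_apply]; omega⟩
    · intro y hy
      rw [Finset.mem_filter] at hy ⊢
      exact ⟨sub_mem hy.1, by rw [Pi.sub_apply]; omega⟩
    · intro y _; exact sub_sub_cancel b y
    · intro y _; exact sub_sub_cancel b y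
    · intro y _; rw [tt, tr, sub_sub_cancel]
  rw [h1, S0, Sm]
  simp only [Finset.sum_filter]
  rw [← Finset.sum_add_distrib, ← Finset.sum_add_distrib]
  refine Finset.sum_congr rfl fun y _ => ?_
  split_ifs <;> first | (exfalso; omega) | ring

end E10

/-! ### The numerical criterion -/
namespace E10

def chk (e Z W h al ht l k N : ℕ) (ev : Bool) : Bool :=
  Nat.ble N 47 && (Nat.ble l 8 && force ((Z >>> (40*W)) % 2^(40*W)) fun R =>
  force (2*(nsum (N+1) fun κ => nsum N fun D => (((R <<< (40*(l*(κ+1)))) >>> (40*(h+D))) % 2^40) * HN N D)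
   + (nsum N fun D => ((if Nat.beq D 0 then 0 else ((R <<< (40*D)) >>> (40*h)) % 2^40) + (R >>> (40*(h+D))) % 2^40) * HN N D)
   + (nsum N fun j => nsum N fun c => if Nat.ble (l*(j+1)*(c+1)) N then 16*l*(j+1)*pt (N-l*(j+1)*(c+1)) else 0)) fun S0 =>
  force (nsum (l/2) fun i => (if Nat.beq (2*(i+1)) l then 1 else 2) * mid Z W h al k N (i+1) (l-(i+1))) fun S1 =>
  force (2*ht+2*l*k-2*al) fun T => Nat.blt (T*pt N + (if ev then (N-1)/2*pt (1+(N-1)/4) else 0)) (S0+S1+e*T))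

theorem criterion {b : Q10} {u v : Fin 8 → ℕ} {h W Z l k al N : ℕ} (D : Dat b u v h W Z) (H : Hyp b l k al N)
    (ev : Bool) (hev : ∀ y, b = y + y → ev = true) (e hb : ℕ) (hhb : ht b = hb)
    (hc : chk e Z W h al hb l k N ev = true) : (pp N : ℚ) < mu b + e := by
  rw [chk] at hc
  simp only [force_eq, Bool.and_eq_true, Nat.ble_eq, Nat.blt_eq, Nat.beq_eq, nsum_eq] at hc
  obtain ⟨hN47, hl8, hc⟩ := hc
  have c1 : ∀ s t : ℕ, ((((Z >>> (40*W)) % 2^(40*W)) <<< (40*s)) >>> (40*(h+t))) % 2^40 = cnt b 1 ((s:ℤ) - t) := by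
    intro s t
    have := cnt_eq D 1 s (h+t)
    rw [mul_one] at this
    rw [this]; congr 1; push_cast; ring
  have c2 : ∀ t : ℕ, (((Z >>> (40*W)) % 2^(40*W)) >>> (40*(h+t))) % 2^40 = cnt b 1 (-(t:ℤ)) := by
    intro t
    have := c1 0 t
    rw [mul_zero, Nat.shiftLeft_zero] at this
    rw [this]; congr 1; push_cast; ring
  have c3 : ∀ s : ℕ, ((((Z >>> (40*W)) % 2^(40*W)) <<< (40*s)) >>> (40*h)) % 2^40 = cnt b 1 (s:ℤ) := by
    intro s
    have := c1 s 0
    rw [add_zero] at this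
    rw [this]; rw [Nat.cast_zero, sub_zero]
  simp only [c1, c2, c3] at hc
  have htt := fun y => tt_nonneg H y
  have htr := fun y => tr_nonneg H y
  have p1 := part_kk H (tt b) htt (fun y hy => tt_zero hy)
    (fun x h1 h2 E h3 h4 => (chain_real H h1 h2 E h3 h4).1) (N+1)
  have p2 := part_kk H (tr b) htr (fun y hy => tr_zero hy)
    (fun x h1 h2 E h3 h4 => (chain_real H h1 h2 E h3 h4).2) (N+1)
  have p3 := part_jd H (tt b) htt (fun y hy => tt_zero hy) (fun j => (chain_jd H j).1)
  have p4 := part_jd H (tr b) htr (fun y hy => tr_zero hy) (fun j => (chain_jd H j).2)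
  have p5 := part_zero H
  have s1 := split_levels (b := b) (tt b) htt
  have s2 := split_levels (b := b) (tr b) htr
  have m1 := mid_total D H hl8
  have m2 := corr_sum H ev hev
  have m3 : ∑ y ∈ Sm b, (gg b y - corr b y) ≤ ∑ y ∈ Sm b, tt b y :=
    Finset.sum_le_sum fun y hy => tt_ge H (Finset.mem_filter.1 hy).1
  rw [Finset.sum_sub_distrib] at m3
  have ts := total_split (b := b) (by rw [H.hl]; have := H.hl1; omega)
  have t0 := tau_sum H.pos (le_refl (ht b))
  have t1 : ∑ a ∈ Finset.Ioo 0 b, tau (ht b) a (b - a) = ∑ y ∈ Finset.Ioo 0 b, tt b y := rfl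
  rw [t1, ts] at t0
  have hbn := AD_bil H.ad H.pos.le
  have hpos := ht_pos' H.pos
  have hTz : ((2*hb+2*l*k-2*al : ℕ) : ℤ) = 2 * ht b - bil b b := by
    have hn := H.hn
    rw [hn] at hbn ⊢
    rw [hhb] at hpos ⊢
    have q : ((2*l*k : ℕ) : ℤ) = 2 * l * k := by push_cast; ring
    rw [← q] at hbn ⊢
    omega
  have hTq : ((2*hb+2*l*k-2*al : ℕ) : ℚ) = 2 * ht b - bil b b := by
    have := congrArg (Int.cast : ℤ → ℚ) hTz
    push_cast at this ⊢
    exact this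
  have hTpos : (0:ℚ) < 2 * ht b - bil b b := by
    rw [← hTq]
    have : (0:ℤ) < ((2*hb+2*l*k-2*al : ℕ) : ℤ) := by rw [hTz]; linarith
    exact_mod_cast this
  have hpp : pp N = pt N := pp_eq (by omega)
  rw [hpp]
  have hcq : ((((2*hb+2*l*k-2*al : ℕ) * pt N + (if ev then (N-1)/2*pt (1+(N-1)/4) else 0) : ℕ)) : ℚ) < _ := Nat.cast_lt.2 hc
  have r1 : ((∑ j ∈ Finset.range N, ∑ c ∈ Finset.range N, if l*(j+1)*(c+1) ≤ N then 16*l*(j+1)*pt (N-l*(j+1)*(c+1)) else 0 : ℕ) : ℚ)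
      = 2 * ((∑ j ∈ Finset.range N, ∑ c ∈ Finset.range N, if l*(j+1)*(c+1) ≤ N then 8*l*(j+1)*pt (N-l*(j+1)*(c+1)) else 0 : ℕ) : ℚ) := by
    have : (∑ j ∈ Finset.range N, ∑ c ∈ Finset.range N, if l*(j+1)*(c+1) ≤ N then 16*l*(j+1)*pt (N-l*(j+1)*(c+1)) else 0)
      = 2 * (∑ j ∈ Finset.range N, ∑ c ∈ Finset.range N, if l*(j+1)*(c+1) ≤ N then 8*l*(j+1)*pt (N-l*(j+1)*(c+1)) else 0) := by
      rw [Finset.mul_sum]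
      refine Finset.sum_congr rfl fun j _ => ?_
      rw [Finset.mul_sum]
      refine Finset.sum_congr rfl fun c _ => ?_
      split_ifs <;> ring
    rw [this]; push_cast; ring
  rw [Nat.cast_add, Nat.cast_mul, hTq, Nat.cast_add, Nat.cast_add, Nat.cast_add, Nat.cast_add, r1, Nat.cast_mul, Nat.cast_mul, hTq] at hcq
  have r2 : ((∑ κ ∈ Finset.range (N+1), ∑ D ∈ Finset.range N, cnt b 1 (((l*(κ+1) : ℕ) : ℤ) - D) * HN N D : ℕ) : ℚ) =
      ∑ κ ∈ Finset.range (N+1), ∑ D ∈ Finset.range N, (cnt b 1 (l * (κ + 1) - D) : ℚ) * HN N D := by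
    push_cast; rfl
  have r3 : ((∑ D ∈ Finset.range N, ((if D = 0 then 0 else cnt b 1 (D:ℤ)) + cnt b 1 (-(D:ℤ))) * HN N D : ℕ) : ℚ) =
      ∑ D ∈ Finset.range N, ((if D = 0 then 0 else cnt b 1 D : ℕ) + cnt b 1 (-D) : ℚ) * HN N D := by
    rw [Nat.cast_sum]
    refine Finset.sum_congr rfl fun D _ => ?_
    rw [Nat.cast_mul, Nat.cast_add]
  rw [r2, r3] at hcq
  have fin : (2 * ht b - bil b b : ℚ) * pt N < (2 * ht b - bil b b : ℚ) * (mu b + e) := by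
    rw [mul_add, t0]
    push_cast at hcq m1 m2 p3 p4 p5 ⊢
    linarith
  exact lt_of_mul_lt_mul_left fin hTpos.le

end E10

/-! ### Antidominant vectors in coordinates and the enumeration -/
namespace E10

def cal (e a0 a1 a2 a3 a4 a5 a6 a7 a8 a9 : ℕ) : Bool :=
  force (2*a2+2*a3+2*a4+2*a5+2*a6+a7+a9) fun u0 =>
  force (2*a3+2*a4+2*a5+2*a6+a7+a9) fun u1 =>
  force (2*a4+2*a5+2*a6+a7+a9) fun u2 =>
  force (2*a5+2*a6+a7+a9) fun u3 =>
  force (2*a6+a7+a9) fun u4 =>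
  force (a7+a9) fun u5 =>
  force (a9) fun u6 =>
  force (2*a2+4*a3+6*a4+8*a5+10*a6+7*a7+4*a8+5*a9) fun u7 =>
  force (5*(u0+u1+u2+u3+u4+u5+u6+a7+u7)+1) fun W =>
  force (5*(u0+u1+u2+u3+u4+u5+u6+a7+u7)/2) fun h =>
  force ((u0*u0+u1*u1+u2*u2+u3*u3+u4*u4+u5*u5+(u6*u6+a7*a7-2*u6*a7)+u7*u7)/8) fun al =>
  force (poly 0 W u0 u1 u2 u3 u4 u5 u6 a7 u7 + poly 1 W u0 u1 u2 u3 u4 u5 u6 a7 u7 * 2^(20*(2*W+(u0+u1+u2+u3+u4+u5+u6-a7+u7)/2))) fun Z =>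
  force (a1+2*a2+3*a3+4*a4+5*a5+6*a6+4*a7+2*a8+3*a9) fun l =>
  force (30*a0+61*a1+93*a2+126*a3+160*a4+195*a5+231*a6+153*a7+76*a8+115*a9) fun ht =>
  force (a0+l) fun k => force (1+l*(a0+l)-al) fun N =>
  chk e Z W h al ht l k N (Nat.beq (a0%2+a1%2+a2%2+a3%2+a4%2+a5%2+a6%2+a7%2+a8%2+a9%2) 0)

def cls (a2 a3 a4 a5 a6 a7 a8 a9 : ℕ) (B : ℕ) : Bool :=
  force (2*a2+2*a3+2*a4+2*a5+2*a6+a7+a9) fun u0 =>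
  force (2*a3+2*a4+2*a5+2*a6+a7+a9) fun u1 =>
  force (2*a4+2*a5+2*a6+a7+a9) fun u2 =>
  force (2*a5+2*a6+a7+a9) fun u3 =>
  force (2*a6+a7+a9) fun u4 =>
  force (a7+a9) fun u5 =>
  force (a9) fun u6 =>
  force (2*a2+4*a3+6*a4+8*a5+10*a6+7*a7+4*a8+5*a9) fun u7 =>
  force (5*(u0+u1+u2+u3+u4+u5+u6+a7+u7)+1) fun W =>
  force (5*(u0+u1+u2+u3+u4+u5+u6+a7+u7)/2) fun h =>
  force ((u0*u0+u1*u1+u2*u2+u3*u3+u4*u4+u5*u5+(u6*u6+a7*a7-2*u6*a7)+u7*u7)/8) fun al =>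
  force (poly 0 W u0 u1 u2 u3 u4 u5 u6 a7 u7 + poly 1 W u0 u1 u2 u3 u4 u5 u6 a7 u7 * 2^(20*(2*W+(u0+u1+u2+u3+u4+u5+u6-a7+u7)/2))) fun Z =>
  nall (B/61+1) fun a1 => nall ((B-61*a1)/30+1) fun a0 =>
  force (a1+2*a2+3*a3+4*a4+5*a5+6*a6+4*a7+2*a8+3*a9) fun l =>
  force (30*a0+61*a1+93*a2+126*a3+160*a4+195*a5+231*a6+153*a7+76*a8+115*a9) fun ht =>
  force (a0+l) fun k => force (1+l*(a0+l)-al) fun N =>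
  Nat.beq l 0 || chk 1 Z W h al ht l k N (Nat.beq (a0%2+a1%2+a2%2+a3%2+a4%2+a5%2+a6%2+a7%2+a8%2+a9%2) 0)

lemma cls_spec {a0 a1 a2 a3 a4 a5 a6 a7 a8 a9 B : ℕ} (hc : cls a2 a3 a4 a5 a6 a7 a8 a9 B = true)
    (hB : 61 * a1 + 30 * a0 ≤ B) :
    a1+2*a2+3*a3+4*a4+5*a5+6*a6+4*a7+2*a8+3*a9 = 0 ∨ cal 1 a0 a1 a2 a3 a4 a5 a6 a7 a8 a9 = true := by
  rw [cls] at hc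
  rw [cal]
  simp only [force_eq] at hc ⊢
  have h1 := (nall_iff _ _).1 ((nall_iff _ _).1 hc a1 (by omega)) a0 (by omega)
  rw [Bool.or_eq_true] at h1
  exact h1.imp_left Nat.eq_of_beq_eq_true

def enu (a9 a8 : ℕ) : Bool := force (340-115*a9-76*a8) fun B =>
  nall (B/153+1) fun a7 => force (B-153*a7) fun B =>
  nall (B/231+1) fun a6 => force (B-231*a6) fun B =>
  nall (B/195+1) fun a5 => force (B-195*a5) fun B =>
  nall (B/160+1) fun a4 => force (B-160*a4) fun B =>
  nall (B/126+1) fun a3 => force (B-126*a3) fun B =>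
  nall (B/93+1) fun a2 => force (B-93*a2) fun B =>
  cls a2 a3 a4 a5 a6 a7 a8 a9 B

lemma enu_spec {a0 a1 a2 a3 a4 a5 a6 a7 a8 a9 : ℕ} (hc : enu a9 a8 = true)
    (hB : 30*a0+61*a1+93*a2+126*a3+160*a4+195*a5+231*a6+153*a7+76*a8+115*a9 ≤ 340) :
    a1+2*a2+3*a3+4*a4+5*a5+6*a6+4*a7+2*a8+3*a9 = 0 ∨ cal 1 a0 a1 a2 a3 a4 a5 a6 a7 a8 a9 = true := by
  rw [enu] at hc
  simp only [force_eq] at hc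
  have h7 := (nall_iff _ _).1 hc a7 (by omega)
  have h6 := (nall_iff _ _).1 h7 a6 (by omega)
  have h5 := (nall_iff _ _).1 h6 a5 (by omega)
  have h4 := (nall_iff _ _).1 h5 a4 (by omega)
  have h3 := (nall_iff _ _).1 h4 a3 (by omega)
  have h2 := (nall_iff _ _).1 h3 a2 (by omega)
  exact cls_spec h2 (by omega)

lemma b_coord {b : Q10} (a : Fin 10 → ℕ) (ha : ∀ i, (a i : ℤ) = - pr i b) (i : Fin 10) :
    b i = ∑ j, om i j * a j := by
  have h1 := bil_om b i
  rw [bil_comm, bil] at h1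
  have h2 : b i = - ∑ j, om i j * pr j b := by rw [h1]; ring
  rw [h2, ← Finset.sum_neg_distrib]
  exact Finset.sum_congr rfl fun j _ => by rw [ha]; ring

lemma mk_dat {b : Q10} {u0 u1 u2 u3 u4 u5 a9 a7 u7 : ℕ}
    (hd : ∀ j, dc b j = ((![0, 0, 0, 0, 0, 0, a7, 0] : Fin 8 → ℕ) j : ℤ) -
      (![u0, u1, u2, u3, u4, u5, a9, u7] : Fin 8 → ℕ) j)
    (hp : (u0+u1+u2+u3+u4+u5+a9+a7+u7) % 2 = 0) (h7 : a7 ≤ u5) :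
    Dat b ![u0, u1, u2, u3, u4, u5, a9, u7] ![0, 0, 0, 0, 0, 0, a7, 0]
      (5*(u0+u1+u2+u3+u4+u5+a9+a7+u7)/2) (5*(u0+u1+u2+u3+u4+u5+a9+a7+u7)+1)
      (poly 0 (5*(u0+u1+u2+u3+u4+u5+a9+a7+u7)+1) u0 u1 u2 u3 u4 u5 a9 a7 u7 +
        poly 1 (5*(u0+u1+u2+u3+u4+u5+a9+a7+u7)+1) u0 u1 u2 u3 u4 u5 a9 a7 u7 *
        2^(20*(2*(5*(u0+u1+u2+u3+u4+u5+a9+a7+u7)+1)+(u0+u1+u2+u3+u4+u5+a9-a7+u7)/2))) where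
  hd := hd
  hh := by
    rw [sum8]; simp only [Matrix.cons_val]; omega
  hW := by omega
  hZ := by
    rw [poly_eq _ _ _ _ _ _ _ _ _ _ _ _ _ rfl rfl, poly_eq _ _ _ _ _ _ _ _ _ _ _ _ _ rfl rfl]
    have e1 : u0+u1+u2+u3+u4+u5+a9-a7+u7 = ∑ i, (![u0, u1, u2, u3, u4, u5, a9, u7] : Fin 8 → ℕ) i -
        ∑ i, (![0, 0, 0, 0, 0, 0, a7, 0] : Fin 8 → ℕ) i := by
      rw [sum8, sum8]; simp only [Matrix.cons_val]; omega
    rw [e1]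
  hs := by rw [sum8, sum8]; simp only [Matrix.cons_val]; omega

lemma ev_lem {a0 a1 a2 a3 a4 a5 a6 a7 a8 a9 : ℕ}
    (hev : ∀ i, ∃ s : ℤ, ((![a0, a1, a2, a3, a4, a5, a6, a7, a8, a9] : Fin 10 → ℕ) i : ℤ) = 2 * s) :
    Nat.beq (a0%2+a1%2+a2%2+a3%2+a4%2+a5%2+a6%2+a7%2+a8%2+a9%2) 0 = true := by
  obtain ⟨s0, e0⟩ := hev 0
  obtain ⟨s1, e1⟩ := hev 1
  obtain ⟨s2, e2⟩ := hev 2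
  obtain ⟨s3, e3⟩ := hev 3
  obtain ⟨s4, e4⟩ := hev 4
  obtain ⟨s5, e5⟩ := hev 5
  obtain ⟨s6, e6⟩ := hev 6
  obtain ⟨s7, e7⟩ := hev 7
  obtain ⟨s8, e8⟩ := hev 8
  obtain ⟨s9, e9⟩ := hev 9
  simp only [Matrix.cons_val] at e0 e1 e2 e3 e4 e5 e6 e7 e8 e9
  rw [Nat.beq_eq]
  omega


set_option maxHeartbeats 1000000 in
theorem step {b : Q10} (hpos : 0 < b) (had : AD b) (h1 : 1 ≤ b 0)
    (ih : ∀ n, 0 < n → ht n < ht b → bil n n ≤ 2 → (pp (1 - bil n n / 2) : ℚ) ≤ mu n)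
    {e a0 a1 a2 a3 a4 a5 a6 a7 a8 a9 : ℕ}
    (ha : ∀ i, ((![a0, a1, a2, a3, a4, a5, a6, a7, a8, a9] : Fin 10 → ℕ) i : ℤ) = - pr i b)
    (hc : cal e a0 a1 a2 a3 a4 a5 a6 a7 a8 a9 = true) :
    (pp (1 - bil b b / 2) : ℚ) < mu b + e := by
  have hb := b_coord _ ha
  have b0 := hb 0
  have b1 := hb 1
  have b2 := hb 2
  have b3 := hb 3
  have b4 := hb 4
  have b5 := hb 5
  have b6 := hb 6
  have b7 := hb 7
  have b8 := hb 8
  have b9 := hb 9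
  simp only [sum10, om, Matrix.cons_val] at b0 b1 b2 b3 b4 b5 b6 b7 b8 b9
  have hhb : ht b = (30*a0+61*a1+93*a2+126*a3+160*a4+195*a5+231*a6+153*a7+76*a8+115*a9 : ℕ) := by
    rw [ht, sum10, b0, b1, b2, b3, b4, b5, b6, b7, b8, b9]; push_cast; ring
  have hl : b 0 = (a1+2*a2+3*a3+4*a4+5*a5+6*a6+4*a7+2*a8+3*a9 : ℕ) := by
    rw [b0]; push_cast; ring
  have hk : kk b = (a0 + (a1+2*a2+3*a3+4*a4+5*a5+6*a6+4*a7+2*a8+3*a9) : ℕ) := by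
    rw [kk, b0, b1]; push_cast; ring
  rw [cal] at hc
  simp only [force_eq] at hc
  generalize hu0 : 2*a2+2*a3+2*a4+2*a5+2*a6+a7+a9 = u0 at hc
  generalize hu1 : 2*a3+2*a4+2*a5+2*a6+a7+a9 = u1 at hc
  generalize hu2 : 2*a4+2*a5+2*a6+a7+a9 = u2 at hc
  generalize hu3 : 2*a5+2*a6+a7+a9 = u3 at hc
  generalize hu4 : 2*a6+a7+a9 = u4 at hc
  generalize hu5 : a7+a9 = u5 at hc
  generalize hu7 : 2*a2+4*a3+6*a4+8*a5+10*a6+7*a7+4*a8+5*a9 = u7 at hc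
  generalize hll : a1+2*a2+3*a3+4*a4+5*a5+6*a6+4*a7+2*a8+3*a9 = l at hc hl hk
  have hd : ∀ j, dc b j = ((![0, 0, 0, 0, 0, 0, a7, 0] : Fin 8 → ℕ) j : ℤ) -
      (![u0, u1, u2, u3, u4, u5, a9, u7] : Fin 8 → ℕ) j := by
    intro j
    have hj : ∀ P : Fin 8 → Prop, P 0 → P 1 → P 2 → P 3 → P 4 → P 5 → P 6 → P 7 → P j := by
      intro P h0 h1 h2 h3 h4 h5 h6 h7
      fin_cases j <;> assumption
    rw [← hu0, ← hu1, ← hu2, ← hu3, ← hu4, ← hu5, ← hu7]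
    apply hj <;> simp only [dc, Matrix.cons_val] <;> simp only [b0, b1, b2, b3, b4, b5, b6, b7, b8, b9] <;>
      push_cast <;> ring
  obtain ⟨t, ht'⟩ := bil_even b
  have hsq := bil_coord b b
  rw [sum8] at hsq
  simp only [hd, Matrix.cons_val, lv, hl, hk, ht'] at hsq
  have hbn := AD_bil had hpos.le
  generalize hal : (u0*u0+u1*u1+u2*u2+u3*u3+u4*u4+u5*u5+(a9*a9+a7*a7-2*a9*a7)+u7*u7)/8 = A at hc
  have hAz : (A : ℤ) = t + l * (a0 + l : ℕ) := by
    have hsub : ((a9*a9+a7*a7-2*a9*a7 : ℕ) : ℤ) = ((a7:ℤ) - a9) * ((a7:ℤ) - a9) := by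
      have : 2*a9*a7 ≤ a9*a9+a7*a7 := by
        have := two_mul_le_add_sq a9 a7; rw [pow_two, pow_two] at this; exact this
      push_cast [Nat.cast_sub this]; ring
    have h8 : ((u0*u0+u1*u1+u2*u2+u3*u3+u4*u4+u5*u5+(a9*a9+a7*a7-2*a9*a7)+u7*u7 : ℕ) : ℤ)
        = 8 * (t + l * (a0 + l : ℕ)) := by
      rw [Nat.cast_add, Nat.cast_add, hsub]
      push_cast at hsq ⊢
      linarith
    omega
  generalize hkk : a0 + l = k at hc hk hAz
  have hlk : ((l * k : ℕ) : ℤ) = l * k := by push_cast; ring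
  generalize hN : 1 + l * k - A = N at hc
  have hNz : (N : ℤ) = 1 + l * k - A := by
    rw [ht'] at hbn
    omega
  have H : Hyp b l k A N := {
    pos := hpos
    ad := had
    hl := hl
    hl1 := by omega
    hk := hk
    hn := by rw [ht', hAz]; ring
    hN := hNz
    ih := ih }
  have D := mk_dat hd (by clear hsq hd; omega) (by omega)
  have hfin := criterion D H _ ?_ e _ hhb hc
  · have : 1 - bil b b / 2 = N := by rw [ht', hNz, hAz]; omega
    rw [this]; exact hfin
  · rintro y rfl
    exact ev_lem fun i => ⟨- pr i y, by rw [ha, pr_add]; ring⟩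

end E10

/-! ### The isotropic case, the main induction -/
namespace E10

lemma card_roots : (II.filter fun i => aa i = 1).card = 240 := by
  have D : Dat dl ![0, 0, 0, 0, 0, 0, 0, 0] ![0, 0, 0, 0, 0, 0, 0, 0] _ _ _ :=
    mk_dat (b := dl) (fun j => by rw [dc_dl]; simp) (by norm_num) (by norm_num)
  have h := cnt_eq D 1 0 0
  have h2 : ((((poly 0 (5*(0+0+0+0+0+0+0+0+0)+1) 0 0 0 0 0 0 0 0 0 +
        poly 1 (5*(0+0+0+0+0+0+0+0+0)+1) 0 0 0 0 0 0 0 0 0 *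
        2^(20*(2*(5*(0+0+0+0+0+0+0+0+0)+1)+(0+0+0+0+0+0+0-0+0)/2))) >>>
        (40*1*(5*(0+0+0+0+0+0+0+0+0)+1))) % 2^(40*(5*(0+0+0+0+0+0+0+0+0)+1))) <<< (40*0)) >>> (40*0) % 2^40 = 240 := by
    decide +kernel
  rw [h2, cnt] at h
  rw [h]
  refine congrArg Finset.card (Finset.filter_congr fun i _ => ?_)
  have : bil (rv i) dl = 0 := by rw [bil_comm, bil_dl, rv0]; rfl
  rw [this]
  simp

lemma pos0 {y : Q10} (h0 : y 0 = 0) (h2 : bil y y = 2) (h1 : 0 < y 1) : 0 < y := by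
  refine lt_of_le_of_ne ?_ (by rintro rfl; simp at h1)
  rcases sign_of_level0 h0 h2 with h | h
  · exact h
  · have h3 : y 1 ≤ 0 := h 1
    omega

theorem isotropic {b : Q10} (hpos : 0 < b) (had : AD b) (h0 : b 0 = 0)
    (ih : ∀ n, 0 < n → ht n < ht b → bil n n ≤ 2 → (pp (1 - bil n n / 2) : ℚ) ≤ mu n) :
    (pp (1 - bil b b / 2) : ℚ) ≤ mu b := by
  classical
  have hb0 : bil b b = 0 := le_antisymm (AD_bil had hpos.le) (lvl0_nonneg h0)
  have hb := lvl0_zero h0 hb0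
  have hb1 : 0 ≤ b 1 := hpos.le 1
  obtain ⟨j, hj⟩ := Int.eq_ofNat_of_zero_le hb1
  rw [hj] at hb
  have hj0 : 0 < j := by
    rcases Nat.eq_zero_or_pos j with h | h
    · rw [h] at hb; rw [hb] at hpos; simp at hpos
    · exact h
  have hbz : ∀ y, y 0 = 0 → bil y b = 0 := by
    intro y hy
    rw [hb, bil_smul_right, bil_comm, bil_dl, hy]; simp
  rw [hb0]
  have e8 : pp (1 - 0 / 2) = 8 := by
    have : (1 - 0 / 2 : ℤ) = 1 := by norm_num
    rw [this, pp_one]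
  rw [e8]
  have hht : ht b = 30 * j := by
    have : ht dl = 30 := by decide +kernel
    rw [hb, ht_smul, this]; push_cast; ring
  have t0 := tau_sum hpos (le_refl (ht b))
  set s : Ix → ℤ := fun i => if 0 ≤ rv i then 0 else 1 with hs
  obtain ⟨J, hJ⟩ : ∃ J, J = (II.filter fun i => aa i = 1) ×ˢ Finset.range j := ⟨_, rfl⟩
  have key : ∑ p ∈ J, (2:ℚ) ≤
      ∑ a ∈ Finset.Ioo 0 b, tau (ht b) a (b - a) := by
    have hx : ∀ p ∈ J,
        0 < XX 0 (p.2 + s p.1) p.1 ∧ 0 < b - XX 0 (p.2 + s p.1) p.1 ∧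
        bil (XX 0 (p.2 + s p.1) p.1) (XX 0 (p.2 + s p.1) p.1) = 2 := by
      rintro ⟨i, κ⟩ hp
      rw [hJ, Finset.mem_product, Finset.mem_filter, Finset.mem_range] at hp
      obtain ⟨⟨hi, ha⟩, hκ⟩ := hp
      simp only at hi ha hκ ⊢
      have hr : bil (rv i) (rv i) = 2 := by rw [bil_rv hi, ha]; norm_num
      have hrne : rv i ≠ 0 := by
        intro h; rw [h] at hr; simp [bil] at hr
      have hsg := sign_of_level0 (rv0 i) hr
      set y := XX 0 (κ + s i) i with hy
      have y2 : bil y y = 2 := by rw [hy, bil_XX_self _ _ hi, ha]; norm_num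
      have y0 : y 0 = 0 := XX_zero _ _ _
      have y1 : y 1 = κ + s i := by rw [hy, XX_one]; ring
      have z2 : bil (b - y) (b - y) = 2 := by
        rw [bil_sub_left, bil_sub_right, bil_sub_right, hb0, hbz y y0, bil_comm b y, hbz y y0, y2]; norm_num
      have z0 : (b - y) 0 = 0 := by rw [Pi.sub_apply, h0, y0]; rfl
      have z1 : (b - y) 1 = j - κ - s i := by rw [Pi.sub_apply, y1, hj]; push_cast; ring
      have yv : y = rv i + ((κ:ℤ) + s i) • dl := by rw [hy, XX, zero_smul, add_zero]
      have zv : b - y = - rv i + ((j:ℤ) - κ - s i) • dl := by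
        rw [yv]; nth_rewrite 1 [hb]
        rw [sub_smul ((j:ℤ) - κ), sub_smul, add_smul]
        have : (Int.ofNat j) • dl = (j:ℤ) • dl := rfl
        first | rw [this]; abel | abel
      by_cases hc : 0 ≤ rv i
      · have hsi : s i = 0 := if_pos hc
        rw [hsi] at y1 yv z1
        refine ⟨?_, pos0 z0 z2 (by omega), y2⟩
        rcases Nat.eq_zero_or_pos κ with h | h
        · rw [yv, h]
          simpa using lt_of_le_of_ne hc hrne.symm
        · exact pos0 y0 y2 (by omega)
      · have hsi : s i = 1 := if_neg hc
        rw [hsi] at y1 zv z1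
        refine ⟨pos0 y0 y2 (by omega), ?_, y2⟩
        by_cases h : j = κ + 1
        · have e0 : (j:ℤ) - κ - 1 = 0 := by omega
          rw [zv, e0, zero_smul, add_zero]
          have := hsg.resolve_left hc
          rw [Left.neg_pos_iff]
          exact lt_of_le_of_ne this hrne
        · exact pos0 z0 z2 (by omega)
    refine sum_inj J _ (fun p : Ix × ℕ => XX 0 (p.2 + s p.1) p.1) _ (fun a => tau (ht b) a (b - a)) ?_ ?_ ?_ ?_
    · rintro ⟨i, κ⟩ h ⟨i', κ'⟩ h' he
      rw [hJ, Finset.mem_product, Finset.mem_filter] at h h'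
      obtain ⟨e1, e2⟩ := XX_inj h.1.1 h'.1.1 he
      simp only at e1 e2
      subst e2
      congr 1; omega
    · intro y hy
      exact tau_nonneg' (p := 1) (q := 1) one_pos one_pos (by simpa using had) (by simp)
    · intro p hp _
      obtain ⟨h1, h2, h3⟩ := hx p hp
      set y := XX 0 (p.2 + s p.1) p.1 with hy
      have y0 : y 0 = 0 := XX_zero _ _ _
      have hyz : bil y (b - y) = -2 := by rw [bil_sub_right, hbz y y0, h3]; norm_num
      have z2 : bil (b - y) (b - y) = 2 := by
        rw [bil_sub_left, bil_sub_right, bil_sub_right, hb0, hbz y y0, bil_comm b y, hbz y y0, h3]; norm_num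
      have hne : y ≠ b - y := by
        intro h
        rw [← h, h3] at hyz
        omega
      have g := (tau_ge h1 h2 (p := 1) (q := 1) one_pos one_pos (by simpa using had) (M := ht b) (by simp)).2.2
      refine le_trans ?_ g
      rw [if_neg hne, hyz]
      have p1 := ht_pos' h1
      have p2 := ht_pos' h2
      rw [ht_sub] at p2
      have i1 := ih y h1 (by linarith) (by omega)
      have i2 := ih (b - y) h2 (by rw [ht_sub]; linarith) (by omega)
      have e0 : (1 - 2 / 2 : ℤ) = 0 := by norm_num
      rw [h3, e0, pp_zero, Nat.cast_one] at i1
      rw [z2, e0, pp_zero, Nat.cast_one] at i2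
      have := mul_le_mul i1 i2 zero_le_one (zero_le_one.trans i1)
      push_cast
      linarith
    · intro p hp hp'
      obtain ⟨h1, h2, h3⟩ := hx p hp
      exact absurd (mem_Ioo'.2 ⟨h1, h2⟩) hp'
  rw [← t0, Finset.sum_const, hJ, Finset.card_product, card_roots, Finset.card_range, hht, hb0] at key
  simp only [nsmul_eq_mul] at key
  push_cast at key ⊢
  have hjq : (0:ℚ) < 60 * j := by positivity
  refine le_of_mul_le_mul_left ?_ hjq
  linarith

end E10

/-! ### Kernel computations and the main induction -/
namespace E10

set_option maxRecDepth 100000 in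
lemma enu_20 : enu 2 0 = true := by decide +kernel
set_option maxRecDepth 100000 in
lemma enu_21 : enu 2 1 = true := by decide +kernel
set_option maxRecDepth 100000 in
lemma enu_10 : enu 1 0 = true := by decide +kernel
set_option maxRecDepth 100000 in
lemma enu_11 : enu 1 1 = true := by decide +kernel
set_option maxRecDepth 100000 in
lemma enu_12 : enu 1 2 = true := by decide +kernel
set_option maxRecDepth 100000 in
lemma enu_00 : enu 0 0 = true := by decide +kernel
set_option maxRecDepth 100000 in
lemma enu_01 : enu 0 1 = true := by decide +kernel
set_option maxRecDepth 100000 in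
lemma enu_02 : enu 0 2 = true := by decide +kernel
set_option maxRecDepth 100000 in
lemma enu_03 : enu 0 3 = true := by decide +kernel
set_option maxRecDepth 100000 in
lemma enu_04 : enu 0 4 = true := by decide +kernel
set_option maxRecDepth 100000 in
lemma cal_strict : cal 0 1 0 1 0 0 0 0 0 0 0 = true := by decide +kernel

end E10

/-! ### The main induction -/
namespace E10

lemma enu_all {a9 a8 : ℕ} (h : 115 * a9 + 76 * a8 ≤ 340) : enu a9 a8 = true := by
  have h9 : a9 ≤ 2 := by omega
  have h8 : a8 ≤ 4 := by omega
  have hs : (a9 = 2 ∧ a8 = 0) ∨ (a9 = 2 ∧ a8 = 1) ∨ (a9 = 1 ∧ a8 = 0) ∨ (a9 = 1 ∧ a8 = 1) ∨ (a9 = 1 ∧ a8 = 2) ∨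
      (a9 = 0 ∧ a8 = 0) ∨ (a9 = 0 ∧ a8 = 1) ∨ (a9 = 0 ∧ a8 = 2) ∨ (a9 = 0 ∧ a8 = 3) ∨ (a9 = 0 ∧ a8 = 4) := by omega
  rcases hs with ⟨rfl, rfl⟩ | ⟨rfl, rfl⟩ | ⟨rfl, rfl⟩ | ⟨rfl, rfl⟩ | ⟨rfl, rfl⟩ | ⟨rfl, rfl⟩ | ⟨rfl, rfl⟩ | ⟨rfl, rfl⟩ |
    ⟨rfl, rfl⟩ | ⟨rfl, rfl⟩
  · exact enu_20
  · exact enu_21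
  · exact enu_10
  · exact enu_11
  · exact enu_12
  · exact enu_00
  · exact enu_01
  · exact enu_02
  · exact enu_03
  · exact enu_04

lemma mu_al (i : Fin 10) : (1:ℚ) ≤ mu (al i) := by
  haveI := R_fin (n := al i) (by rw [ht_al]; norm_num)
  have h : 0 < Module.finrank ℚ (R (al i)) := by
    haveI : Nontrivial (R (al i)) := ⟨⟨⟨e i, e_mem i⟩, 0, fun h => e_ne i (congrArg Subtype.val h)⟩⟩
    exact Module.finrank_pos
  have h' : 1 ≤ rootMult E10M (al i) := h
  rw [mu]
  exact_mod_cast h'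

lemma bil_refl (n : Q10) (i : Fin 10) : bil (n - pr i n • al i) (n - pr i n • al i) = bil n n := by
  have h1 : bil n (al i) = pr i n := by rw [bil_comm]; simp [bil, Pi.single_apply]
  have h2 : bil (al i) (al i) = 2 := by
    have : bil (al i) (al i) = pr i (al i) := by simp [bil, Pi.single_apply]
    rw [this, pr_al, A_diag]
  rw [bil_sub_left, bil_sub_right, bil_sub_right, bil_smul_left, bil_smul_right, bil_smul_left, bil_smul_right,
    bil_comm (al i) n, h1, h2]
  ring

theorem main_ind (m : ℕ) : ∀ n : Q10, 0 < n → ht n ≤ m → m ≤ 340 → bil n n ≤ 2 →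
    (pp (1 - bil n n / 2) : ℚ) ≤ mu n := by
  induction m with
  | zero =>
    intro n hn h _ _
    have := ht_pos' hn
    push_cast at h
    omega
  | succ m IH =>
    intro b hpos hht hm hb2
    have ih : ∀ n, 0 < n → ht n < ht b → bil n n ≤ 2 → (pp (1 - bil n n / 2) : ℚ) ≤ mu n :=
      fun n h1 h2 h3 => IH n h1 (by push_cast at hht; omega) (by omega) h3
    by_cases had : AD b
    · by_cases h0 : b 0 = 0
      · exact isotropic hpos had h0 ih
      · have h1 : 1 ≤ b 0 := by
          have : 0 ≤ b 0 := hpos.le 0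
          omega
        obtain ⟨a, ha⟩ : ∃ a : Fin 10 → ℕ, ∀ i, (a i : ℤ) = - pr i b :=
          ⟨fun i => (- pr i b).toNat, fun i => by have := had i; simp only; omega⟩
        have hav : (![a 0, a 1, a 2, a 3, a 4, a 5, a 6, a 7, a 8, a 9] : Fin 10 → ℕ) = a := by
          funext i; fin_cases i <;> rfl
        have hc := b_coord a ha
        have hb : ht b = (30*a 0+61*a 1+93*a 2+126*a 3+160*a 4+195*a 5+231*a 6+153*a 7+76*a 8+115*a 9 : ℕ) := by
          rw [ht, sum10]
          simp only [hc, sum10, om, Matrix.cons_val]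
          push_cast; ring
        have hl : b 0 = (a 1+2*a 2+3*a 3+4*a 4+5*a 5+6*a 6+4*a 7+2*a 8+3*a 9 : ℕ) := by
          simp only [hc, sum10, om, Matrix.cons_val]
          push_cast; ring
        have hle : 30*a 0+61*a 1+93*a 2+126*a 3+160*a 4+195*a 5+231*a 6+153*a 7+76*a 8+115*a 9 ≤ 340 := by
          push_cast at hht; omega
        have hcal := (enu_spec (enu_all (by omega)) hle).resolve_left (by omega)
        have hs := step hpos had h1 ih (by rw [hav]; exact ha) hcal
        rw [mu, Nat.cast_one] at hs
        rw [mu]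
        have : pp (1 - bil b b / 2) < rootMult E10M b + 1 := by exact_mod_cast hs
        exact_mod_cast Nat.lt_succ_iff.1 this
    · obtain ⟨i, hi⟩ : ∃ i, 0 < pr i b := by
        by_contra hcon
        exact had fun i => not_lt.1 fun h => hcon ⟨i, h⟩
      by_cases hne : b = al i
      · rw [hne]
        have h2 : bil (al i) (al i) = 2 := by
          have : bil (al i) (al i) = pr i (al i) := by simp [bil, Pi.single_apply]
          rw [this, pr_al, A_diag]
        have e0 : (1 - 2 / 2 : ℤ) = 0 := by norm_num
        rw [h2, e0, pp_zero, Nat.cast_one]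
        exact mu_al i
      · have hr := refl_nonneg hpos.le hb2 hi hne
        refine le_trans ?_ (mult_refl hpos hi hr)
        rw [← bil_refl b i]
        refine ih _ (lt_of_le_of_ne hr ?_) ?_ (by rw [bil_refl]; exact hb2)
        · intro h
          have hbe : b = pr i b • al i := (sub_eq_zero.1 h.symm)
          have hp := congrArg (pr i) hbe
          have : pr i (pr i b • al i) = pr i b * 2 := by
            have h2 : pr i (pr i b • al i) = pr i b * pr i (al i) := by
              simp only [pr, Pi.smul_apply, smul_eq_mul, Finset.mul_sum]
              exact Finset.sum_congr rfl fun j _ => by ring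
            rw [h2, pr_al, A_diag]
          omega
        · rw [ht_sub, ht_smul, ht_al]; omega

lemma qform_eq (n : Fin 10 → ℕ) : qform E10M n = bil (fun i => (n i : ℤ)) (fun i => (n i : ℤ)) := by
  rw [qform, bil]
  refine Finset.sum_congr rfl fun i _ => ?_
  rw [pr, Finset.mul_sum]
  exact Finset.sum_congr rfl fun j _ => by ring

theorem lower (n : Fin 10 → ℕ) (hn : n ≠ 0) (h : ∑ i, n i ≤ 340) (hq : qform E10M n ≤ 2) :
    coloredPartitions 8 (1 - qform E10M n / 2) ≤ rootMult E10M (fun i => (n i : ℤ)) := by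
  have hpos : (0 : Q10) < fun i => (n i : ℤ) := by
    refine lt_of_le_of_ne (fun i => Int.natCast_nonneg _) ?_
    intro h0
    apply hn
    funext i
    have := congrFun h0 i
    simpa using this.symm
  have := main_ind 340 _ hpos (by rw [ht]; exact_mod_cast h) le_rfl (by rw [← qform_eq]; exact hq)
  rw [← qform_eq, mu] at this
  exact_mod_cast this

theorem strict : ∃ n : Fin 10 → ℕ, n ≠ 0 ∧ ∑ i, n i ≤ 340 ∧ qform E10M n ≤ 2 ∧
      coloredPartitions 8 (1 - qform E10M n / 2) < rootMult E10M (fun i => (n i : ℤ)) := by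
  have hq : qform E10M ![2, 5, 8, 12, 16, 20, 24, 16, 8, 12] ≤ 2 := by decide +kernel
  refine ⟨![2, 5, 8, 12, 16, 20, 24, 16, 8, 12], by decide +kernel, by decide +kernel, hq, ?_⟩
  have hqe := qform_eq ![2, 5, 8, 12, 16, 20, 24, 16, 8, 12]
  obtain ⟨b, hb⟩ : ∃ b : Q10, b = fun i => (((![2, 5, 8, 12, 16, 20, 24, 16, 8, 12] : Fin 10 → ℕ) i : ℕ) : ℤ) := ⟨_, rfl⟩
  have hb1 : ht b = 123 := by rw [hb]; decide +kernel
  have hb2 : ∀ i, ((![1, 0, 1, 0, 0, 0, 0, 0, 0, 0] : Fin 10 → ℕ) i : ℤ) = - pr i b := by rw [hb]; decide +kernel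
  have hb3 : b 0 = 2 := by rw [hb]; rfl
  have hpos : 0 < b := by
    refine lt_of_le_of_ne (fun i => by rw [hb]; exact Int.natCast_nonneg _) ?_
    rintro rfl
    simp at hb3
  have had : AD b := fun i => by have := hb2 i; omega
  rw [← hb] at hqe ⊢
  have hs := step hpos had (by omega) (fun n h1 h2 h3 => main_ind 340 n h1 (by push_cast; omega) le_rfl h3) hb2 cal_strict
  rw [← hqe, mu, Nat.cast_zero, add_zero] at hs
  exact_mod_cast hs

end E10

/-- **Lower bound on `E10` root multiplicities up to height 340.** Every nonzero
`n ∈ ℕ¹⁰` of height at most `340` with `nᵀ A(E10) n ≤ 2` satisfies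
`mult n ≥ p₈(1 − nᵀ A(E10) n / 2)`, and for some such `n` the inequality is strict. -/
theorem e10_mult_lower_bound :
    (∀ n : Fin 10 → ℕ, n ≠ 0 → ∑ i, n i ≤ 340 → qform E10M n ≤ 2 →
      coloredPartitions 8 (1 - qform E10M n / 2) ≤ rootMult E10M (fun i => (n i : ℤ))) ∧
    (∃ n : Fin 10 → ℕ, n ≠ 0 ∧ ∑ i, n i ≤ 340 ∧ qform E10M n ≤ 2 ∧
      coloredPartitions 8 (1 - qform E10M n / 2) < rootMult E10M (fun i => (n i : ℤ))) := by
  exact ⟨E10.lower, E10.strict⟩
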